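/- arXiv:2308.14138 — 2 statements merged into one kernel-verified Lean document; each statement's English description precedes it below -/
import Mathlib

section
/- Let m = 2^t for a positive integer t and let n ≥ 2 be an integer. Then n·2^t ≤ TC_n(ℝP^m) ≤ n·2^t + 1, where ℝP^m is the m-dimensional real projective space. -/
open scoped unitInterval

noncomputable section

/-- Topology on the projectivization, as a quotient of the nonzero vectors. -/
instance projTop (K V : Type*) [DivisionRing K] [AddCommGroup V] [Module K V]
    [TopologicalSpace V] : TopologicalSpace (Projectivization K V) :=
  inferInstanceAs (TopologicalSpace (Quotient (projectivizationSetoid K V)))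

/-- The real Milnor manifold `ℝH_{r,s}`, as the subspace of `ℝPʳ × ℝPˢ` of pairs
`([x], [y])` with `x₀y₀ + ⋯ + x_sy_s = 0` (for `s ≤ r`). -/
def RealMilnor (r s : ℕ) :
    Set (Projectivization ℝ (Fin (r + 1) → ℝ) × Projectivization ℝ (Fin (s + 1) → ℝ)) :=
  {p | ∑ i : Fin (min (s + 1) (r + 1)),
      p.1.rep (Fin.castLE (min_le_right _ _) i) * p.2.rep (Fin.castLE (min_le_left _ _) i) = 0}

/-- The complex Milnor manifold `ℂH_{r,s}`, as the subspace of `ℂPʳ × ℂPˢ` of pairs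
`([z], [w])` with `z₀w̄₀ + ⋯ + z_sw̄_s = 0` (for `s ≤ r`). -/
def ComplexMilnor (r s : ℕ) :
    Set (Projectivization ℂ (Fin (r + 1) → ℂ) × Projectivization ℂ (Fin (s + 1) → ℂ)) :=
  {p | ∑ i : Fin (min (s + 1) (r + 1)),
      p.1.rep (Fin.castLE (min_le_right _ _) i) *
        (starRingEnd ℂ) (p.2.rep (Fin.castLE (min_le_left _ _) i)) = 0}

/-- The Lusternik–Schnirelmann category of `X`: the least number of open sets covering `X`,
each of whose inclusion into `X` is null-homotopic. -/
def lsCat (X : Type*) [TopologicalSpace X] : ℕ :=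
  sInf {k | 0 < k ∧ ∃ U : Fin k → Set X,
    (∀ i, IsOpen (U i)) ∧ (⋃ i, U i) = Set.univ ∧
    ∀ i, ∃ x₀ : X, ∃ H : C(U i × I, X),
      (∀ u : U i, H (u, 0) = (u : X)) ∧ (∀ u : U i, H (u, 1) = x₀)}

/-- The fibration `π_n : X^I → X^n`, evaluating a path at the times `i/(n-1)`,
`i = 0, …, n-1`. -/
def tcPi (X : Type*) [TopologicalSpace X] (n : ℕ) (γ : C(I, X)) : Fin n → X :=
  fun i => γ (Set.projIcc (0 : ℝ) 1 zero_le_one ((i : ℝ) / ((n : ℝ) - 1)))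

/-- The `n`-th higher (sequential) topological complexity of `X`: the least number of open
sets covering `X^n`, each admitting a continuous local section of `π_n : X^I → X^n`. -/
def higherTC (X : Type*) [TopologicalSpace X] (n : ℕ) : ℕ :=
  sInf {k | 0 < k ∧ ∃ U : Fin k → Set (Fin n → X),
    (∀ i, IsOpen (U i)) ∧ (⋃ i, U i) = Set.univ ∧
    ∀ i, ∃ sec : C(U i, C(I, X)), ∀ u : U i, tcPi X n (sec u) = (u : Fin n → X)}

/-- The `n`-th higher equivariant topological complexity of a `G`-space `X`:
the least number of `G`-invariant open sets covering `X^n` (with the diagonal action),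
each admitting a `G`-equivariant map to `X^I` whose composite with `π_n` is
`G`-homotopic to the inclusion. -/
def eqHigherTC (G : Type*) [Group G] (X : Type*) [TopologicalSpace X] [MulAction G X]
    (n : ℕ) : ℕ :=
  sInf {k | 0 < k ∧ ∃ U : Fin k → Set (Fin n → X),
    (∀ i, IsOpen (U i)) ∧ (⋃ i, U i) = Set.univ ∧
    (∀ i (g : G), ∀ v ∈ U i, g • v ∈ U i) ∧
    ∀ i, ∃ sec : C(U i, C(I, X)),
      (∀ (g : G) (v : U i) (hgv : g • (v : Fin n → X) ∈ U i) (t : I),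
        (sec ⟨g • (v : Fin n → X), hgv⟩) t = g • (sec v) t) ∧
      ∃ H : C(U i × I, Fin n → X),
        (∀ v : U i, H (v, 0) = tcPi X n (sec v)) ∧
        (∀ v : U i, H (v, 1) = (v : Fin n → X)) ∧
        (∀ (g : G) (v : U i) (hgv : g • (v : Fin n → X) ∈ U i) (t : I),
          H (⟨g • (v : Fin n → X), hgv⟩, t) = g • H (v, t))}

/-- `X` has covering dimension at most `m`: every finite open cover admits an open
refinement which still covers `X` and in which every point lies in at most `m + 1` sets. -/
def HasCovDimLE (X : Type*) [TopologicalSpace X] (m : ℕ) : Prop :=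
  ∀ 𝒰 : Set (Set X), 𝒰.Finite → (∀ U ∈ 𝒰, IsOpen U) → ⋃₀ 𝒰 = Set.univ →
    ∃ 𝒱 : Set (Set X), (∀ V ∈ 𝒱, IsOpen V) ∧ ⋃₀ 𝒱 = Set.univ ∧
      (∀ V ∈ 𝒱, ∃ U ∈ 𝒰, V ⊆ U) ∧
      ∀ x : X, {V ∈ 𝒱 | x ∈ V}.encard ≤ (m + 1 : ℕ)

/-- The covering dimension of `X`. -/
def covDim (X : Type*) [TopologicalSpace X] : ℕ :=
  sInf {m | HasCovDimLE X m}

end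

section Comb
set_option linter.unusedSectionVars false
variable {κ : Type*} [Fintype κ] [DecidableEq κ]

/-- Boundary (`e = 1`) and coboundary (`e = 0`) on the grid of cubes. -/
def Gam (e : ℤ) (f : (κ → ℤ) → ZMod 2) (p : κ → ℤ) : ZMod 2 :=
  ∑ l, if Odd (p l + e) then f (p + Pi.single l 1) + f (p - Pi.single l 1) else 0

lemma z2_add_self (x : ZMod 2) : x + x = 0 := CharTwo.add_self_eq_zero x

lemma sum_symm_zero {α : Type*} [Fintype α] [DecidableEq α] (g : α → α → ZMod 2)
    (hs : ∀ a b, g a b = g b a) (hd : ∀ a, g a a = 0) : ∑ a, ∑ b, g a b = 0 := by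
  rw [← Fintype.sum_prod_type']
  apply Finset.sum_involution (fun x _ => (x.2, x.1))
  · rintro ⟨a, b⟩ _
    simp only
    rw [hs b a]; exact z2_add_self _
  · rintro ⟨a, b⟩ _ h h2
    simp only [Prod.mk.injEq] at h2
    obtain ⟨rfl, _⟩ := h2
    exact h (hd _)
  · simp
  · simp

lemma Gam_Gam (e : ℤ) (f : (κ → ℤ) → ZMod 2) (p : κ → ℤ) : Gam e (Gam e f) p = 0 := by
  unfold Gam
  have key : ∀ l : κ, (if Odd (p l + e) then
      (∑ l', if Odd ((p + Pi.single l 1 : κ → ℤ) l' + e) then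
        f (p + Pi.single l 1 + Pi.single l' 1) + f (p + Pi.single l 1 - Pi.single l' 1) else 0) +
      (∑ l', if Odd ((p - Pi.single l 1 : κ → ℤ) l' + e) then
        f (p - Pi.single l 1 + Pi.single l' 1) + f (p - Pi.single l 1 - Pi.single l' 1) else 0)
      else 0) = ∑ l', if Odd (p l + e) ∧ Odd (p l' + e) ∧ l ≠ l' then
        (f (p + Pi.single l 1 + Pi.single l' 1) + f (p - Pi.single l 1 - Pi.single l' 1)) +
        (f (p + Pi.single l 1 - Pi.single l' 1) + f (p - Pi.single l 1 + Pi.single l' 1))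
        else 0 := by
    intro l
    by_cases h : Odd (p l + e)
    · rw [if_pos h, ← Finset.sum_add_distrib]
      apply Finset.sum_congr rfl
      intro l' _
      by_cases hl : l = l'
      · subst hl
        have h1 : ¬ Odd ((p + Pi.single l 1 : κ → ℤ) l + e) := by
          simp only [Pi.add_apply, Pi.single_eq_same]
          rw [Int.odd_iff] at h ⊢; omega
        have h2 : ¬ Odd ((p - Pi.single l 1 : κ → ℤ) l + e) := by
          simp only [Pi.sub_apply, Pi.single_eq_same]
          rw [Int.odd_iff] at h ⊢; omega
        rw [if_neg h1, if_neg h2]; simp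
      · have hl' : l' ≠ l := fun h => hl h.symm
        have e1 : (p + Pi.single l 1 : κ → ℤ) l' = p l' := by simp [hl']
        have e2 : (p - Pi.single l 1 : κ → ℤ) l' = p l' := by simp [hl']
        rw [e1, e2]
        by_cases h3 : Odd (p l' + e)
        · rw [if_pos h3, if_pos h3, if_pos ⟨h, h3, hl⟩]; ring
        · rw [if_neg h3, if_neg h3, if_neg (fun h => h3 h.2.1)]; simp
    · simp [h]
  rw [Finset.sum_congr rfl (fun l _ => key l)]
  apply sum_symm_zero
  · intro a b
    by_cases h : Odd (p a + e) ∧ Odd (p b + e) ∧ a ≠ b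
    · rw [if_pos h, if_pos ⟨h.2.1, h.1, h.2.2.symm⟩]
      congr 1
      · congr 2 <;> ring
      · rw [add_comm]; congr 2 <;> ring
    · rw [if_neg h, if_neg (fun h' => h ⟨h'.2.1, h'.1, h'.2.2.symm⟩)]
  · intro a; simp

lemma Gam_add (e : ℤ) (f g : (κ → ℤ) → ZMod 2) (p : κ → ℤ) :
    Gam e (fun q => f q + g q) p = Gam e f p + Gam e g p := by
  unfold Gam
  rw [← Finset.sum_add_distrib]
  apply Finset.sum_congr rfl
  intro l _
  split_ifs
  · ring
  · simp

lemma Gam_const_mul (e : ℤ) (c : ZMod 2) (f : (κ → ℤ) → ZMod 2) (p : κ → ℤ) :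
    Gam e (fun q => c * f q) p = c * Gam e f p := by
  unfold Gam
  rw [Finset.mul_sum]
  apply Finset.sum_congr rfl
  intro l _
  split_ifs
  · ring
  · simp

lemma Gam_one (e : ℤ) (p : κ → ℤ) : Gam e (fun _ => (1 : ZMod 2)) p = 0 := by
  unfold Gam
  apply Finset.sum_eq_zero
  intro l _
  split_ifs
  · exact z2_add_self _
  · rfl

/-- Adjointness of boundary and coboundary. -/
lemma Gam_adj (c f : (κ → ℤ) → ZMod 2) (hc : (Function.support c).Finite) :
    ∑ᶠ p, c p * Gam 0 f p = ∑ᶠ p, Gam 1 c p * f p := by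
  have fin1 : ∀ g : (κ → ℤ) → ZMod 2, (Function.support (fun p => c p * g p)).Finite := by
    intro g
    apply hc.subset
    intro p hp h
    exact hp (by simp [h])
  have finP : ∀ (g : (κ → ℤ) → ZMod 2) (l : κ),
      (Function.support (fun p => c (p + Pi.single l 1) * g p)).Finite := by
    intro g l
    apply (hc.preimage (f := fun p => p + Pi.single l 1)
      (fun a _ b _ h => add_right_cancel h)).subset
    intro p hp h
    exact hp (by simp [h])
  have finM : ∀ (g : (κ → ℤ) → ZMod 2) (l : κ),
      (Function.support (fun p => c (p - Pi.single l 1) * g p)).Finite := by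
    intro g l
    apply (hc.preimage (f := fun p => p - Pi.single l 1)
      (fun a _ b _ h => sub_left_injective h)).subset
    intro p hp h
    exact hp (by simp [h])
  have L : ∀ p, c p * Gam 0 f p = ∑ l, (c p * (if Odd (p l) then f (p + Pi.single l 1) else 0)
      + c p * (if Odd (p l) then f (p - Pi.single l 1) else 0)) := by
    intro p
    unfold Gam
    rw [Finset.mul_sum]
    apply Finset.sum_congr rfl
    intro l _
    simp only [add_zero]
    split_ifs <;> ring
  have R : ∀ p, Gam 1 c p * f p =
      ∑ l, (c (p - Pi.single l 1) * (if Odd (p l + 1) then f p else 0)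
      + c (p + Pi.single l 1) * (if Odd (p l + 1) then f p else 0)) := by
    intro p
    unfold Gam
    rw [Finset.sum_mul]
    apply Finset.sum_congr rfl
    intro l _
    split_ifs <;> ring
  rw [finsum_congr L, finsum_congr R, finsum_sum_comm, finsum_sum_comm]
  · apply Finset.sum_congr rfl
    intro l _
    rw [finsum_add_distrib (fin1 _) (fin1 _), finsum_add_distrib (finM _ l) (finP _ l)]
    congr 1
    · rw [← finsum_comp_equiv (Equiv.subRight (Pi.single l (1:ℤ) : κ → ℤ))]
      apply finsum_congr
      intro p
      have : Odd (p l - 1) ↔ Odd (p l + 1) := by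
        rw [Int.odd_iff, Int.odd_iff]; omega
      simp [this]
    · rw [← finsum_comp_equiv (Equiv.addRight (Pi.single l (1:ℤ) : κ → ℤ))]
      apply finsum_congr
      intro p
      simp
  · intro l _
    exact ((finM _ l).union (finP _ l)).subset (Function.support_add _ _)
  · intro l _
    exact ((fin1 _).union (fin1 _)).subset (Function.support_add _ _)

/-- Iterated coboundary words. -/
def Bw : List ((κ → ℤ) → ZMod 2) → (κ → ℤ) → ZMod 2
  | [] => fun _ => 1
  | h :: hs => Gam 0 (fun q => h q * Bw hs q)

lemma Gam_Bw (hs : List ((κ → ℤ) → ZMod 2)) (p : κ → ℤ) : Gam 0 (Bw hs) p = 0 := by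
  cases hs with
  | nil => exact Gam_one 0 p
  | cons h hs => exact Gam_Gam 0 _ p

lemma Bw_cons (h : (κ → ℤ) → ZMod 2) (hs) (p : κ → ℤ) :
    Bw (h :: hs) p = Gam 0 (fun q => (h p + h q) * Bw hs q) p := by
  have : (fun q => (h p + h q) * Bw hs q) = fun q => h p * Bw hs q + h q * Bw hs q := by
    funext q; ring
  rw [this, Gam_add, Gam_const_mul, Gam_Bw]
  simp [Bw]

/-- `q` is a face of `p`. -/
def FaceLE (q p : κ → ℤ) : Prop := ∀ l, q l = p l ∨ (Odd (p l) ∧ |q l - p l| ≤ 1)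

lemma FaceLE.refl (p : κ → ℤ) : FaceLE p p := fun _ => Or.inl rfl

/-- `q` is a facet of `p`. -/
def IsFacet (q p : κ → ℤ) : Prop :=
  ∃ l, Odd (p l) ∧ (q = p + Pi.single l 1 ∨ q = p - Pi.single l 1)

lemma IsFacet.eval {q p : κ → ℤ} (h : IsFacet q p) :
    ∃ l, Odd (p l) ∧ Even (q l) ∧ |q l - p l| = 1 ∧ ∀ l', l' ≠ l → q l' = p l' := by
  obtain ⟨l, hl, rfl | rfl⟩ := h
  · exact ⟨l, hl, by simpa using hl.add_one, by simp, fun l' h => by simp [h]⟩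
  · exact ⟨l, hl, by simpa using hl.sub_odd odd_one, by simp, fun l' h => by simp [h]⟩

lemma FaceLE.trans_facet {r q p : κ → ℤ} (h : FaceLE r q) (hq : IsFacet q p) : FaceLE r p := by
  obtain ⟨l, h1, h2, h3, h4⟩ := hq.eval
  intro l'
  by_cases e : l' = l
  · subst e
    rcases h l' with h | h
    · right; exact ⟨h1, by rw [h, h3]⟩
    · exact absurd h.1 (Int.not_odd_iff_even.2 h2)
  · rcases h l' with h | h
    · left; rw [h, h4 _ e]
    · right; rw [h4 _ e] at h; exact h

lemma IsFacet.faceLE {q p : κ → ℤ} (hq : IsFacet q p) : FaceLE q p :=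
  (FaceLE.refl q).trans_facet hq

lemma Gam_congr {f g : (κ → ℤ) → ZMod 2} {p : κ → ℤ} (h : ∀ q, IsFacet q p → f q = g q) :
    Gam 0 f p = Gam 0 g p := by
  unfold Gam
  apply Finset.sum_congr rfl
  intro l _
  by_cases hl : Odd (p l + 0)
  · rw [if_pos hl, if_pos hl, h _ ⟨l, by simpa using hl, Or.inl rfl⟩,
      h _ ⟨l, by simpa using hl, Or.inr rfl⟩]
  · rw [if_neg hl, if_neg hl]

lemma Bw_ne_zero (hs : List ((κ → ℤ) → ZMod 2)) : ∀ p : κ → ℤ, Bw hs p ≠ 0 →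
    ∀ h ∈ hs, ∃ q, FaceLE q p ∧ h q ≠ h p ∨ ∃ q q', FaceLE q p ∧ FaceLE q' p ∧ h q ≠ h q' := by
  induction hs with
  | nil => intro p _ h hh; simp at hh
  | cons h hs ih =>
    intro p hp h' hh'
    rw [Bw_cons] at hp
    obtain ⟨q, hq, hne⟩ : ∃ q, IsFacet q p ∧ (h p + h q) * Bw hs q ≠ 0 := by
      by_contra hcon
      push Not at hcon
      apply hp
      rw [Gam_congr (g := fun _ => 0 * 1) hcon, Gam_const_mul]; simp
    have h1 : h p + h q ≠ 0 := left_ne_zero_of_mul hne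
    have h2 : Bw hs q ≠ 0 := right_ne_zero_of_mul hne
    have h3 : h p ≠ h q := fun e => h1 (by rw [e]; exact z2_add_self _)
    refine ⟨p, Or.inr ?_⟩
    rcases List.mem_cons.1 hh' with rfl | hm
    · exact ⟨p, q, FaceLE.refl p, hq.faceLE, h3⟩
    · obtain ⟨a, ⟨ha, hb⟩ | ⟨a, b, ha, hb, hab⟩⟩ := ih q h2 h' hm
      · exact ⟨a, q, ha.trans_facet hq, hq.faceLE, hb⟩
      · exact ⟨a, b, ha.trans_facet hq, hb.trans_facet hq, hab⟩

lemma Bw_eq_zero (hs : List ((κ → ℤ) → ZMod 2)) (p : κ → ℤ)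
    (h : ∃ h ∈ hs, ∀ q, FaceLE q p → h q = h p) : Bw hs p = 0 := by
  by_contra hne
  obtain ⟨h, hm, hc⟩ := h
  obtain ⟨a, ⟨ha, hb⟩ | ⟨a, b, ha, hb, hab⟩⟩ := Bw_ne_zero hs p hne h hm
  · exact hb (hc _ ha)
  · exact hab ((hc _ ha).trans (hc _ hb).symm)

end Comb
section Chains
set_option linter.unusedSectionVars false

/-- density of the interval `[-N, N]` -/
def oI (N x : ℤ) : ZMod 2 := if Odd x ∧ |x| < N then 1 else 0
/-- density of the interval `[0, N]` -/
def oP (N x : ℤ) : ZMod 2 := if Odd x ∧ 0 < x ∧ x < N then 1 else 0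
/-- density of the origin -/
def oZ (x : ℤ) : ZMod 2 := if x = 0 then 1 else 0

lemma oI_neg (N x : ℤ) : oI N (-x) = oI N x := by simp [oI]
lemma oZ_neg (x : ℤ) : oZ (-x) = oZ x := by simp [oZ]
lemma oP_add (N x : ℤ) : oP N x + oP N (-x) = oI N x := by
  unfold oP oI
  by_cases h : Odd x
  · have h0 : x ≠ 0 := by rintro rfl; simp at h
    simp only [h, odd_neg, true_and]
    rcases lt_or_gt_of_ne h0 with h1 | h1
    · rw [abs_of_neg h1, if_neg (by omega)]
      simp [h1]
    · rw [abs_of_pos h1]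
      have h2 : ¬ (0 < -x ∧ -x < N) := by omega
      rw [if_neg h2]; simp [h1]
  · simp [h]

variable {m : ℕ}

/-- factors of the cube chain -/
def cF (N : ℤ) (k : ℕ) (i : Fin (m + 1)) (x : ℤ) : ZMod 2 :=
  if (i : ℕ) < k then oI N x else oZ x
/-- factors of the half cube chain -/
def hF (N : ℤ) (k : ℕ) (i : Fin (m + 1)) (x : ℤ) : ZMod 2 :=
  if (i : ℕ) < k then oI N x else if (i : ℕ) = k then oP N x else oZ x

/-- cube chain -/
def cC (N : ℤ) (k : ℕ) (p : Fin (m + 1) → ℤ) : ZMod 2 := ∏ i, cF N k i (p i)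
/-- half cube chain -/
def cH (N : ℤ) (k : ℕ) (p : Fin (m + 1) → ℤ) : ZMod 2 := ∏ i, hF N k i (p i)
/-- hemisphere chain -/
def cD (N : ℤ) (k : ℕ) (p : Fin (m + 1) → ℤ) : ZMod 2 := Gam 1 (cH N k) p + cC N k p

lemma cH_add (N : ℤ) (k : ℕ) (hk : k ≤ m) (p : Fin (m + 1) → ℤ) :
    cH N k p + cH N k (-p) = cC N (k + 1) p := by
  have hk' : k < m + 1 := by omega
  unfold cH cC
  rw [← Finset.mul_prod_erase _ _ (Finset.mem_univ (⟨k, hk'⟩ : Fin (m + 1))),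
    ← Finset.mul_prod_erase _ (fun i => hF N k i ((-p) i))
      (Finset.mem_univ (⟨k, hk'⟩ : Fin (m + 1))),
    ← Finset.mul_prod_erase _ (fun i => cF N (k + 1) i (p i))
      (Finset.mem_univ (⟨k, hk'⟩ : Fin (m + 1)))]
  have e : ∀ i ∈ Finset.univ.erase (⟨k, hk'⟩ : Fin (m + 1)),
      hF N k i (p i) = cF N (k + 1) i (p i) ∧ hF N k i ((-p) i) = cF N (k + 1) i (p i) := by
    intro i hi
    have hne : (i : ℕ) ≠ k := fun h => (Finset.ne_of_mem_erase hi) (Fin.ext h)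
    unfold hF cF
    by_cases h : (i : ℕ) < k
    · simp [h, Nat.lt_succ_of_lt h, oI_neg]
    · have : ¬ (i : ℕ) < k + 1 := by omega
      simp [h, this, hne, oZ_neg]
  rw [Finset.prod_congr rfl (fun i hi => (e i hi).1),
    Finset.prod_congr rfl (fun i hi => (e i hi).2), ← add_mul]
  congr 1
  simp [hF, cF, oP_add]

lemma Gam_neg {κ : Type*} [Fintype κ] [DecidableEq κ] (f : (κ → ℤ) → ZMod 2) (p : κ → ℤ) :
    Gam 1 f (-p) = Gam 1 (fun q => f (-q)) p := by
  unfold Gam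
  apply Finset.sum_congr rfl
  intro l _
  have : Odd ((-p) l + 1) ↔ Odd (p l + 1) := by
    simp only [Pi.neg_apply]; rw [Int.odd_iff, Int.odd_iff]; omega
  simp only [this, neg_add, neg_sub']
  split_ifs
  · rw [add_comm]; simp [sub_eq_add_neg]
  · rfl

lemma cC_neg (N : ℤ) (k : ℕ) (p : Fin (m + 1) → ℤ) : cC N k (-p) = cC N k p := by
  unfold cC
  apply Finset.prod_congr rfl
  intro i _
  unfold cF
  simp [oI_neg, oZ_neg]

lemma Gam_cD (N : ℤ) (k : ℕ) (p : Fin (m + 1) → ℤ) : Gam 1 (cD N k) p = Gam 1 (cC N k) p := by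
  have : (cD N k : (Fin (m + 1) → ℤ) → ZMod 2) = fun q => Gam 1 (cH N k) q + cC N k q := rfl
  rw [this, Gam_add, Gam_Gam, zero_add]

lemma Gam_cD_succ (N : ℤ) (k : ℕ) (hk : k ≤ m) (p : Fin (m + 1) → ℤ) :
    Gam 1 (cD N (k + 1)) p = cD N k p + cD N k (-p) := by
  rw [Gam_cD]
  have : (cC N (k + 1) : (Fin (m + 1) → ℤ) → ZMod 2) = fun q => cH N k q + cH N k (-q) := by
    funext q; rw [cH_add N k hk]
  rw [this, Gam_add]
  unfold cD
  rw [Gam_neg, cC_neg]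
  have := z2_add_self (cC N k p)
  linear_combination -this

lemma Gam_cD_zero (N : ℤ) (p : Fin (m + 1) → ℤ) : Gam 1 (cD N 0) p = 0 := by
  rw [Gam_cD]
  unfold Gam
  apply Finset.sum_eq_zero
  intro l _
  split_ifs with h
  · have h0 : p l + 1 ≠ 0 := by rintro h0; rw [h0] at h; simp at h
    have h1 : p l - 1 ≠ 0 := by
      intro h1; rw [Int.odd_iff] at h; omega
    have e1 : cC N 0 (p + Pi.single l 1) = 0 := by
      apply Finset.prod_eq_zero (Finset.mem_univ l); simp [cF, oZ, h0]
    have e2 : cC N 0 (p - Pi.single l 1) = 0 := by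
      apply Finset.prod_eq_zero (Finset.mem_univ l); simp [cF, oZ, h1]
    rw [e1, e2, add_zero]
  · rfl

lemma cH_shift (N : ℤ) (k : ℕ) (p q : Fin (m + 1) → ℤ) (l) (h : ∀ i, i ≠ l → q i = p i) :
    cH N k q = hF N k l (q l) * ∏ i ∈ Finset.univ.erase l, hF N k i (p i) := by
  unfold cH
  rw [← Finset.mul_prod_erase _ _ (Finset.mem_univ l)]
  congr 1
  apply Finset.prod_congr rfl
  intro i hi
  rw [h i (Finset.ne_of_mem_erase hi)]

lemma hF_diff (N : ℤ) (hN : Even N) (hN0 : 0 < N) (k : ℕ) (i : Fin (m + 1)) (x : ℤ)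
    (hx : Odd (x + 1)) :
    hF N k i (x + 1) + hF N k i (x - 1) =
      if (i : ℕ) < k then (if |x| = N then 1 else 0) else
      if (i : ℕ) = k then oZ x + (if x = N then 1 else 0) else 0 := by
  have hx' : Odd (x - 1) := by rw [Int.odd_iff] at hx ⊢; omega
  rw [Int.odd_iff] at hx
  rw [Int.even_iff] at hN
  unfold hF oI oP oZ
  simp only [hx', Int.odd_iff.2 hx, true_and]
  by_cases h1 : (i : ℕ) < k
  · simp only [h1, if_true, abs_lt, abs_eq hN0.le]
    split_ifs <;> first | rfl | omega
  · by_cases h2 : (i : ℕ) = k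
    · simp only [h2, lt_irrefl, if_true, if_false]
      split_ifs <;> first | rfl | omega
    · simp only [h1, h2, if_false]
      split_ifs <;> first | rfl | omega

lemma cD_formula (N : ℤ) (hN : Even N) (hN0 : 0 < N) (k : ℕ) (hk : k < m + 1)
    (p : Fin (m + 1) → ℤ) :
    cD N k p = ∑ l : Fin (m + 1), (if (l : ℕ) < k then (if |p l| = N then 1 else 0) else
      if (l : ℕ) = k then (if p l = N then 1 else 0) else 0) *
        ∏ i ∈ Finset.univ.erase l, hF N k i (p i) := by
  unfold cD Gam
  have key : ∀ l : Fin (m + 1), (if Odd (p l + 1) then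
      cH N k (p + Pi.single l 1) + cH N k (p - Pi.single l 1) else 0) =
      (if (l : ℕ) < k then (if |p l| = N then 1 else 0) else
      if (l : ℕ) = k then (if p l = N then 1 else 0) else 0) *
        (∏ i ∈ Finset.univ.erase l, hF N k i (p i)) + if l = ⟨k, hk⟩ then cC N k p else 0 := by
    intro l
    have hcC : l = ⟨k, hk⟩ → cC N k p = oZ (p l) * ∏ i ∈ Finset.univ.erase l, hF N k i (p i) := by
      rintro rfl
      unfold cC
      rw [← Finset.mul_prod_erase _ _ (Finset.mem_univ (⟨k, hk⟩ : Fin (m + 1)))]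
      congr 1
      · simp [cF]
      · apply Finset.prod_congr rfl
        intro i hi
        have hne : (i : ℕ) ≠ k := fun h => (Finset.ne_of_mem_erase hi) (Fin.ext h)
        simp [cF, hF, hne]
    have hlk : (l = ⟨k, hk⟩) ↔ (l : ℕ) = k := by rw [Fin.ext_iff]
    by_cases ho : Odd (p l + 1)
    · rw [if_pos ho, cH_shift N k p (p + Pi.single l 1) l (by intro i hi; simp [hi]),
        cH_shift N k p (p - Pi.single l 1) l (by intro i hi; simp [hi]), ← add_mul]
      simp only [Pi.add_apply, Pi.sub_apply, Pi.single_eq_same]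
      rw [hF_diff N hN hN0 k l _ ho]
      by_cases h2 : l = ⟨k, hk⟩
      · rw [if_pos h2, hcC h2]
        rw [hlk] at h2
        simp only [h2, lt_irrefl, if_true, if_false]
        ring
      · rw [if_neg h2]
        rw [hlk] at h2
        simp only [h2, if_false, add_zero]
    · rw [if_neg ho]
      rw [Int.odd_iff] at ho
      rw [Int.even_iff] at hN
      have a1 : |p l| ≠ N := by
        intro h; rw [abs_eq hN0.le] at h; omega
      have a2 : p l ≠ N := by omega
      have a3 : oZ (p l) = 0 := by
        unfold oZ; rw [if_neg]; omega
      simp only [a1, a2, if_false, ite_self, zero_mul, zero_add]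
      split_ifs with h
      · rw [hcC h, a3, zero_mul]
      · rfl
  rw [Finset.sum_congr rfl (fun l _ => key l), Finset.sum_add_distrib]
  simp only [Finset.sum_ite_eq', Finset.mem_univ, if_true]
  rw [add_assoc, z2_add_self, add_zero]

lemma hF_ne_zero {N : ℤ} {k : ℕ} {i : Fin (m + 1)} {x : ℤ} (hN0 : 0 < N) (h : hF N k i x ≠ 0) :
    |x| ≤ N := by
  unfold hF oI oP oZ at h
  rw [abs_le]
  split_ifs at h with h1 h2 h3 h4 h5
  · rw [abs_lt] at h2; omega
  · simp at h
  · omega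
  · simp at h
  · omega
  · simp at h

lemma cD_support (N : ℤ) (hN : Even N) (hN0 : 0 < N) (k : ℕ) (hk : k < m + 1)
    (p : Fin (m + 1) → ℤ) (h : cD N k p ≠ 0) : (∀ i, |p i| ≤ N) ∧ ∃ i, |p i| = N := by
  rw [cD_formula N hN hN0 k hk] at h
  obtain ⟨l, _, hl⟩ := Finset.exists_ne_zero_of_sum_ne_zero h
  have h1 := left_ne_zero_of_mul hl
  have h2 := right_ne_zero_of_mul hl
  have h3 : |p l| = N := by
    split_ifs at h1 with a b c d
    · exact b
    · simp at h1
    · rw [d]; exact abs_of_pos hN0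
    · simp at h1
    · simp at h1
  refine ⟨fun i => ?_, l, h3⟩
  by_cases hi : i = l
  · rw [hi, h3]
  · rw [Finset.prod_ne_zero_iff] at h2
    exact hF_ne_zero hN0 (h2 i (Finset.mem_erase.2 ⟨hi, Finset.mem_univ _⟩))

lemma cD_zero (N : ℤ) (hN : Even N) (hN0 : 0 < N) (p : Fin (m + 1) → ℤ) :
    cD N 0 p = if p = Pi.single 0 N then 1 else 0 := by
  rw [cD_formula N hN hN0 0 (Nat.succ_pos m), Finset.sum_eq_single 0]
  · simp only [Fin.val_zero, lt_irrefl, if_false, if_true]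
    by_cases h : p = Pi.single 0 N
    · rw [if_pos h, if_pos (by simp [h]), one_mul]
      apply Finset.prod_eq_one
      intro i hi
      have hi' := Finset.ne_of_mem_erase hi
      have hi2 : (i : ℕ) ≠ 0 := fun h => hi' (Fin.ext h)
      simp [hF, h, oZ, hi']
    · rw [if_neg h]
      by_cases h0 : p 0 = N
      · have : ∃ i, i ≠ 0 ∧ p i ≠ 0 := by
          by_contra hcon
          push Not at hcon
          apply h
          funext i
          by_cases hi : i = 0
          · rw [hi, h0]; simp
          · rw [hcon i hi]; simp [hi]
        obtain ⟨i, hi, hpi⟩ := this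
        rw [Finset.prod_eq_zero (Finset.mem_erase.2 ⟨hi, Finset.mem_univ i⟩), mul_zero]
        simp [hF, oZ, hpi, hi]
      · rw [if_neg h0, zero_mul]
  · intro l _ hl
    have : (l : ℕ) ≠ 0 := fun h => hl (Fin.ext h)
    simp [this]
  · simp

end Chains
section Prod
set_option linter.unusedSectionVars false
variable {m : ℕ} {J : Type*} [Fintype J] [DecidableEq J]

/-- product chain -/
def cP (N : ℤ) (k : J →₀ ℕ) (p : J × Fin (m + 1) → ℤ) : ZMod 2 :=
  ∏ j, cD N (k j) (fun i => p (j, i))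

/-- antipode in block `j` -/
def flp (j : J) (p : J × Fin (m + 1) → ℤ) : J × Fin (m + 1) → ℤ :=
  fun x => if x.1 = j then - p x else p x

lemma flp_flp (j : J) (p : J × Fin (m + 1) → ℤ) : flp j (flp j p) = p := by
  funext x; unfold flp; split_ifs <;> simp

/-- the product of the boundaries of the cubes -/
def YY (N : ℤ) : Set (J × Fin (m + 1) → ℤ) :=
  {p | ∀ j, (∀ i, |p (j, i)| ≤ N) ∧ ∃ i, |p (j, i)| = N}

lemma YY_flp {N : ℤ} {j : J} {p : J × Fin (m + 1) → ℤ} (h : p ∈ YY N) : flp j p ∈ YY N := by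
  intro j'
  have e : ∀ i, |flp j p (j', i)| = |p (j', i)| := by
    intro i; unfold flp; split_ifs <;> simp
  simp only [e]
  exact h j'

lemma YY_face {N : ℤ} (hN : Even N) {q p : J × Fin (m + 1) → ℤ}
    (h : p ∈ YY N) (hq : FaceLE q p) : q ∈ YY N := by
  intro j
  refine ⟨fun i => ?_, ?_⟩
  · rcases hq (j, i) with e | ⟨e1, e2⟩
    · rw [e]; exact (h j).1 i
    · have := (h j).1 i
      rw [Int.odd_iff] at e1; rw [Int.even_iff] at hN
      rw [abs_le] at *; omega
  · obtain ⟨i, hi⟩ := (h j).2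
    refine ⟨i, ?_⟩
    rcases hq (j, i) with e | ⟨e1, e2⟩
    · rw [e]; exact hi
    · exfalso
      rw [Int.odd_iff] at e1; rw [Int.even_iff] at hN
      rcases abs_choice (p (j, i)) with h | h <;> omega

lemma cP_support {N : ℤ} (hN : Even N) (hN0 : 0 < N) {k : J →₀ ℕ} (hk : ∀ j, k j ≤ m)
    {p : J × Fin (m + 1) → ℤ} (h : cP N k p ≠ 0) : p ∈ YY N := by
  intro j
  unfold cP at h
  rw [Finset.prod_ne_zero_iff] at h
  exact cD_support N hN hN0 (k j) (Nat.lt_succ_of_le (hk j)) _ (h j (Finset.mem_univ _))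

lemma YY_finite (N : ℤ) : (YY N : Set (J × Fin (m + 1) → ℤ)).Finite := by
  apply (Set.Finite.pi (fun _ : J × Fin (m + 1) => Set.finite_Icc (-N) N)).subset
  intro p hp x _
  have := (hp x.1).1 x.2
  rw [abs_le] at this
  exact this

lemma Gam_cP {N : ℤ} {k : J →₀ ℕ} (hk : ∀ j, k j ≤ m) (q : J × Fin (m + 1) → ℤ) :
    Gam 1 (cP N k) q = ∑ j, if k j = 0 then 0 else
      (cP N (k - Finsupp.single j 1) q + cP N (k - Finsupp.single j 1) (flp j q)) := by
  have split : ∀ (k' : J →₀ ℕ) (j : J) (q' : J × Fin (m + 1) → ℤ),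
      (∀ j', j' ≠ j → k' j' = k j') → (∀ j' i, j' ≠ j → q' (j', i) = q (j', i)) →
      cP N k' q' = cD N (k' j) (fun i => q' (j, i)) *
        ∏ j' ∈ Finset.univ.erase j, cD N (k j') (fun i => q (j', i)) := by
    intro k' j q' h1 h2
    unfold cP
    rw [← Finset.mul_prod_erase _ _ (Finset.mem_univ j)]
    congr 1
    apply Finset.prod_congr rfl
    intro j' hj'
    have := Finset.ne_of_mem_erase hj'
    rw [h1 j' this]
    congr 1
    funext i
    exact h2 j' i this
  unfold Gam
  rw [Fintype.sum_prod_type]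
  apply Finset.sum_congr rfl
  intro j _
  have key : (∑ i, if Odd (q (j, i) + 1) then
      cP N k (q + Pi.single (j, i) 1) + cP N k (q - Pi.single (j, i) 1) else 0) =
      Gam 1 (cD N (k j)) (fun i => q (j, i)) *
        ∏ j' ∈ Finset.univ.erase j, cD N (k j') (fun i => q (j', i)) := by
    unfold Gam
    rw [Finset.sum_mul]
    apply Finset.sum_congr rfl
    intro i _
    split_ifs with ho
    · rw [split k j (q + Pi.single (j, i) 1) (fun _ _ => rfl)
        (by intro j' i' h; simp [h]),
        split k j (q - Pi.single (j, i) 1) (fun _ _ => rfl)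
        (by intro j' i' h; simp [h]), ← add_mul]
      congr 3
      · funext i'
        by_cases h : i' = i
        · subst h; simp
        · simp [h]
      · funext i'
        by_cases h : i' = i
        · subst h; simp
        · simp [h]
    · simp
  rw [key]
  by_cases h0 : k j = 0
  · rw [if_pos h0, h0, Gam_cD_zero, zero_mul]
  · rw [if_neg h0]
    obtain ⟨a, ha⟩ := Nat.exists_eq_succ_of_ne_zero h0
    have ha' : a ≤ m := by have := hk j; omega
    have e : (k - Finsupp.single j 1 : J →₀ ℕ) j = a := by simp [ha]
    rw [split (k - Finsupp.single j 1) j q (by intro j' h; simp [h]) (fun _ _ _ => rfl),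
      split (k - Finsupp.single j 1) j (flp j q) (by intro j' h; simp [h])
        (by intro j' i h; simp [flp, h]), e, ← add_mul, ha, Nat.succ_eq_add_one,
        Gam_cD_succ N a ha']
    congr 3
    funext i
    simp [flp]

lemma flp_isFacet (j : J) {q p : J × Fin (m + 1) → ℤ} (h : IsFacet q p) :
    IsFacet (flp j q) (flp j p) := by
  obtain ⟨l, hl, h⟩ := h
  have ho : Odd (flp j p l) := by unfold flp; split_ifs <;> simpa using hl
  refine ⟨l, ho, ?_⟩
  by_cases hj : l.1 = j
  · rcases h with rfl | rfl
    · right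
      funext x
      by_cases hx : x = l
      · subst hx; simp [flp, hj]; ring
      · simp [flp, hx]
    · left
      funext x
      by_cases hx : x = l
      · subst hx; simp [flp, hj]; ring
      · simp [flp, hx]
  · rcases h with rfl | rfl
    · left
      funext x
      by_cases hx : x = l
      · subst hx; simp [flp, hj]
      · simp [flp, hx]
    · right
      funext x
      by_cases hx : x = l
      · subst hx; simp [flp, hj]
      · simp [flp, hx]

lemma Gam_flp (j : J) (f : (J × Fin (m + 1) → ℤ) → ZMod 2) (p : J × Fin (m + 1) → ℤ) :
    Gam 0 f (flp j p) = Gam 0 (fun q => f (flp j q)) p := by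
  unfold Gam
  apply Finset.sum_congr rfl
  intro l _
  have ho : Odd (flp j p l + 0) ↔ Odd (p l + 0) := by unfold flp; split_ifs <;> simp
  simp only [ho]
  by_cases hj : l.1 = j
  · have e1 : flp j p + Pi.single l 1 = flp j (p - Pi.single l 1) := by
      funext x
      by_cases hx : x = l
      · subst hx; simp [flp, hj]; ring
      · simp [flp, hx]
    have e2 : flp j p - Pi.single l 1 = flp j (p + Pi.single l 1) := by
      funext x
      by_cases hx : x = l
      · subst hx; simp [flp, hj]; ring
      · simp [flp, hx]
    rw [e1, e2, add_comm (f (flp j (p - Pi.single l 1)))]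
  · have e1 : flp j p + Pi.single l 1 = flp j (p + Pi.single l 1) := by
      funext x
      by_cases hx : x = l
      · subst hx; simp [flp, hj]
      · simp [flp, hx]
    have e2 : flp j p - Pi.single l 1 = flp j (p - Pi.single l 1) := by
      funext x
      by_cases hx : x = l
      · subst hx; simp [flp, hj]
      · simp [flp, hx]
    rw [e1, e2]

/-- equivariance of a labelling with respect to a character -/
def EqV (N : ℤ) (a : ((J × Fin (m + 1) → ℤ) → ZMod 2) × (J → ZMod 2)) : Prop :=
  ∀ p ∈ (YY N : Set (J × Fin (m + 1) → ℤ)), ∀ j, a.1 (flp j p) = a.1 p + a.2 j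

lemma Bw_flp {N : ℤ} (hN : Even N)
    (L : List (((J × Fin (m + 1) → ℤ) → ZMod 2) × (J → ZMod 2))) (hL : ∀ a ∈ L, EqV N a)
    (j : J) : ∀ p ∈ (YY N : Set (J × Fin (m + 1) → ℤ)),
      Bw (L.map Prod.fst) (flp j p) = Bw (L.map Prod.fst) p := by
  induction L with
  | nil => intro p _; rfl
  | cons a L ih =>
    intro p hp
    simp only [List.map_cons, Bw]
    rw [Gam_flp]
    have : Gam 0 (fun q => a.1 (flp j q) * Bw (L.map Prod.fst) (flp j q)) p =
        Gam 0 (fun q => a.1 q * Bw (L.map Prod.fst) q + a.2 j * Bw (L.map Prod.fst) q) p := by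
      apply Gam_congr
      intro q hq
      have hqY := YY_face hN hp hq.faceLE
      rw [ih (fun a ha => hL a (List.mem_cons_of_mem _ ha)) q hqY,
        hL a List.mem_cons_self q hqY j]
      ring
    rw [this, Gam_add, Gam_const_mul, Gam_Bw, mul_zero, add_zero]

/-- linear polynomial attached to a character -/
noncomputable def linP (χ : J → ZMod 2) : MvPolynomial J (ZMod 2) :=
  ∑ j, MvPolynomial.C (χ j) * MvPolynomial.X j

lemma coeff_linP_mul (χ : J → ZMod 2) (Q : MvPolynomial J (ZMod 2)) (k : J →₀ ℕ) :
    MvPolynomial.coeff k (linP χ * Q) = ∑ j, if k j = 0 then 0 else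
      χ j * MvPolynomial.coeff (k - Finsupp.single j 1) Q := by
  unfold linP
  rw [Finset.sum_mul, MvPolynomial.coeff_sum]
  apply Finset.sum_congr rfl
  intro j _
  rw [mul_assoc, MvPolynomial.coeff_C_mul, MvPolynomial.coeff_X_mul']
  by_cases h : k j = 0 <;> simp [h]

theorem main_count {N : ℤ} (hN : Even N) (hN0 : 0 < N)
    (L : List (((J × Fin (m + 1) → ℤ) → ZMod 2) × (J → ZMod 2))) (hL : ∀ a ∈ L, EqV N a) :
    ∀ k : J →₀ ℕ, (∀ j, k j ≤ m) → k.degree = L.length →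
      ∑ᶠ p, cP N k p * Bw (L.map Prod.fst) p =
        MvPolynomial.coeff k (L.map (fun a => linP a.2)).prod := by
  induction L with
  | nil =>
    intro k hk hd
    have hk0 : k = 0 := (Finsupp.degree_eq_zero_iff k).1 (by simpa using hd)
    subst hk0
    simp only [List.map_nil, List.prod_nil, Bw, mul_one, MvPolynomial.coeff_zero_one]
    have e : ∀ p : J × Fin (m + 1) → ℤ, cP N 0 p =
        if p = fun x => (Pi.single 0 N : Fin (m + 1) → ℤ) x.2 then 1 else 0 := by
      intro p
      unfold cP
      simp only [Finsupp.coe_zero, Pi.zero_apply, cD_zero N hN hN0]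
      split_ifs with h
      · apply Finset.prod_eq_one
        intro j _
        rw [if_pos]; rw [h]
      · obtain ⟨j, hj⟩ : ∃ j, ¬ (fun i => p (j, i)) = (Pi.single 0 N : Fin (m + 1) → ℤ) := by
          by_contra hcon
          push Not at hcon
          apply h
          funext x
          exact congrFun (hcon x.1) x.2
        apply Finset.prod_eq_zero (Finset.mem_univ j)
        rw [if_neg hj]
    rw [finsum_congr e, finsum_eq_single _ (fun x => (Pi.single 0 N : Fin (m + 1) → ℤ) x.2)]
    · simp
    · intro p hp; rw [if_neg hp]
  | cons a L ih =>
    intro k hk hd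
    have fin : ∀ (k : J →₀ ℕ) (_ : ∀ j, k j ≤ m),
        (Function.support (cP N k : (J × Fin (m + 1) → ℤ) → ZMod 2)).Finite :=
      fun k hk => (YY_finite N).subset (fun p hp => cP_support hN hN0 hk hp)
    have hL' : ∀ a ∈ L, EqV N a := fun a ha => hL a (List.mem_cons_of_mem _ ha)
    simp only [List.map_cons, List.prod_cons, Bw]
    rw [Gam_adj _ _ (fin k hk), coeff_linP_mul]
    set F : (J × Fin (m + 1) → ℤ) → ZMod 2 := fun q => a.1 q * Bw (L.map Prod.fst) q with hF
    have hk' : ∀ j j', (k - Finsupp.single j 1 : J →₀ ℕ) j' ≤ m := by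
      intro j j'
      exact le_trans (by simp [Finsupp.tsub_apply]) (hk j')
    have finf : ∀ (j : J) (g : (J × Fin (m + 1) → ℤ) → ZMod 2), (Function.support
        (fun p => cP N (k - Finsupp.single j 1) p * g p)).Finite := by
      intro j g
      apply (fin _ (hk' j)).subset
      intro p hp h
      exact hp (by simp [h])
    have finf2 : ∀ (j : J) (g : (J × Fin (m + 1) → ℤ) → ZMod 2), (Function.support
        (fun p => cP N (k - Finsupp.single j 1) (flp j p) * g p)).Finite := by
      intro j g
      apply ((fin _ (hk' j)).preimage (f := flp j) (fun x _ y _ h => by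
        rw [← flp_flp j x, h, flp_flp])).subset
      intro p hp h
      exact hp (by simp [h])
    have e1 : ∀ p, Gam 1 (cP N k) p * F p = ∑ j, if k j = 0 then 0 else
        (cP N (k - Finsupp.single j 1) p * F p + cP N (k - Finsupp.single j 1) (flp j p) * F p) := by
      intro p
      rw [Gam_cP hk, Finset.sum_mul]
      apply Finset.sum_congr rfl
      intro j _
      split_ifs <;> ring
    rw [finsum_congr e1, finsum_sum_comm]
    · apply Finset.sum_congr rfl
      intro j _
      by_cases h0 : k j = 0
      · simp [h0]
      · simp only [h0, if_false]
        have hdeg : (k - Finsupp.single j 1).degree = L.length := by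
          have h1 : Finsupp.single j 1 ≤ k := by
            rw [Finsupp.single_le_iff]; omega
          have h2 : (k - Finsupp.single j 1 + Finsupp.single j 1).degree = L.length + 1 := by
            rw [tsub_add_cancel_of_le h1, hd]; simp
          rw [map_add, Finsupp.degree_single] at h2
          omega
        rw [← ih hL' _ (hk' j) hdeg, finsum_add_distrib (finf j _) (finf2 j _)]
        have inv : Function.Involutive (flp j : (J × Fin (m + 1) → ℤ) → _) := flp_flp j
        rw [← finsum_comp_equiv inv.toPerm
          (f := fun p => cP N (k - Finsupp.single j 1) (flp j p) * F p)]
        simp only [Function.Involutive.coe_toPerm, flp_flp]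
        rw [← finsum_add_distrib (finf j _) (finf j _), mul_finsum]
        apply finsum_congr
        intro p
        by_cases hp : cP N (k - Finsupp.single j 1) p = 0
        · simp [hp]
        · have hY := cP_support hN hN0 (hk' j) hp
          simp only [hF]
          rw [Bw_flp hN L hL' j p hY, hL a List.mem_cons_self p hY j]
          have := z2_add_self (cP N (k - Finsupp.single j 1) p * a.1 p * Bw (L.map Prod.fst) p)
          linear_combination this
    · intro j _
      by_cases h0 : k j = 0
      · simp [h0, Function.HasFiniteSupport]
      · simp only [h0, if_false]
        exact ((finf j _).union (finf2 j _)).subset (Function.support_add _ _)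

end Prod

section Coeff
variable {J : Type*} [Fintype J] [DecidableEq J]
open MvPolynomial

lemma coeff_pow_aux (a b : J) (hab : a ≠ b) (s : ℕ) :
    coeff (Finsupp.single a s) ((X a + X b : MvPolynomial J (ZMod 2)) ^ s) = 1 := by
  induction s with
  | zero => simp
  | succ s ih =>
    rw [pow_succ, mul_add, coeff_add, coeff_mul_X', coeff_mul_X']
    have h1 : a ∈ (Finsupp.single a (s + 1)).support := by simp
    have h2 : b ∉ (Finsupp.single a (s + 1)).support := by simp [hab]
    rw [if_pos h1, if_neg h2, add_zero]
    have : Finsupp.single a (s + 1) - Finsupp.single a 1 = Finsupp.single a s := by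
      rw [← Finsupp.single_tsub]; simp
    rw [this, ih]

lemma coeff_prod_aux (t : ℕ) (a b : J) (hab : a ≠ b) (S : Finset J) (haS : a ∉ S) :
    coeff (Finsupp.single a (2 ^ t - 1) + ∑ j ∈ S, Finsupp.single j (2 ^ t))
      ((X a + X b : MvPolynomial J (ZMod 2)) ^ (2 ^ t - 1) *
        ∏ j ∈ S, (X a + X j) ^ (2 ^ t)) = 1 := by
  induction S using Finset.induction_on with
  | empty => simpa only [Finset.sum_empty, Finset.prod_empty, add_zero, mul_one] using coeff_pow_aux a b hab _
  | insert j S hj ih =>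
    have haj : a ≠ j := fun h => haS (by simp [h])
    have haS' : a ∉ S := fun h => haS (by simp [h])
    have hfr : (X a + X j : MvPolynomial J (ZMod 2)) ^ (2 ^ t) = X a ^ (2 ^ t) + X j ^ (2 ^ t) :=
      add_pow_char_pow _ _ 2 t
    rw [Finset.prod_insert hj, Finset.sum_insert hj, hfr, mul_left_comm, add_mul, coeff_add]
    have hpos : 0 < 2 ^ t := by positivity
    rw [X_pow_eq_monomial, X_pow_eq_monomial, coeff_monomial_mul', coeff_monomial_mul',
      if_neg, if_pos]
    · rw [zero_add, one_mul, ← ih haS']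
      congr 1
      rw [add_left_comm, add_tsub_cancel_left]
    · rw [Finsupp.single_le_iff]
      simp only [Finsupp.add_apply, Finsupp.single_eq_same]
      omega
    · rw [Finsupp.single_le_iff]
      have : (∑ i ∈ S, Finsupp.single i (2 ^ t)) a = 0 := by
        rw [Finsupp.finsetSum_apply]
        apply Finset.sum_eq_zero
        intro i hi
        have : i ≠ a := fun h => haS' (h ▸ hi)
        simp [this]
      simp only [Finsupp.add_apply, Finsupp.single_eq_same, this, Finsupp.single_eq_of_ne haj]
      omega
end Coeff
section Topo

/-- the Euclidean-type vector space -/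
abbrev VV (m : ℕ) := Fin (m + 1) → ℝ
/-- real projective space -/
abbrev PP (m : ℕ) := Projectivization ℝ (VV m)

variable {m : ℕ}

lemma dot_self_pos {v : VV m} (hv : v ≠ 0) : 0 < v ⬝ᵥ v := by
  have h1 : 0 ≤ v ⬝ᵥ v := by
    unfold dotProduct
    exact Finset.sum_nonneg (fun i _ => mul_self_nonneg _)
  exact lt_of_le_of_ne h1 (fun h => hv (dotProduct_self_eq_zero.1 h.symm))

/-- orthogonal projection onto the line `x` -/
noncomputable def Pm (x : PP m) : Fin (m + 1) → Fin (m + 1) → ℝ :=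
  Projectivization.lift (fun v : {v : VV m // v ≠ 0} =>
    fun a b => v.1 a * v.1 b / (v.1 ⬝ᵥ v.1)) (by
      rintro ⟨v, hv⟩ ⟨w, hw⟩ t h
      simp only at h
      subst h
      have ht : t ≠ 0 := by rintro rfl; simp at hv
      have hw' := (dot_self_pos hw).ne'
      funext a b
      simp only [Pi.smul_apply, smul_eq_mul, smul_dotProduct, dotProduct_smul]
      field_simp) x

lemma Pm_mk (v : VV m) (hv : v ≠ 0) (a b) :
    Pm (Projectivization.mk ℝ v hv) a b = v a * v b / (v ⬝ᵥ v) := rfl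

lemma continuous_mk : Continuous (fun v : {v : VV m // v ≠ 0} =>
    (Projectivization.mk ℝ v.1 v.2 : PP m)) := by
  exact continuous_quotient_mk'

lemma continuous_Pm : Continuous (Pm : PP m → _) := by
  unfold Pm
  apply Continuous.quotient_lift
  refine continuous_pi (fun a => continuous_pi (fun b => ?_))
  apply Continuous.div
  · exact ((continuous_apply a).comp continuous_subtype_val).mul
      ((continuous_apply b).comp continuous_subtype_val)
  · exact Continuous.dotProduct continuous_subtype_val continuous_subtype_val
  · intro v; exact (dot_self_pos v.2).ne'

lemma continuous_Pm_apply (a b : Fin (m + 1)) : Continuous (fun x : PP m => Pm x a b) :=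
  (continuous_apply b).comp ((continuous_apply a).comp continuous_Pm)

/-- apply the projection -/
noncomputable def pA (x : PP m) (w : VV m) : VV m := fun a => ∑ b, Pm x a b * w b

lemma pA_mk (v : VV m) (hv : v ≠ 0) (w : VV m) :
    pA (Projectivization.mk ℝ v hv) w = ((v ⬝ᵥ w) / (v ⬝ᵥ v)) • v := by
  funext a
  simp only [pA, Pm_mk, Pi.smul_apply, smul_eq_mul]
  rw [show v ⬝ᵥ w = ∑ b, v b * w b from rfl, Finset.sum_div, Finset.sum_mul]
  apply Finset.sum_congr rfl
  intro b _
  ring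

lemma pA_neg (x : PP m) (w : VV m) : pA x (-w) = - pA x w := by
  funext a; simp [pA]

/-- squared cosine of the angle -/
noncomputable def rho (x y : PP m) : ℝ := ∑ a, ∑ b, Pm x a b * Pm y a b

lemma rho_mk (v : VV m) (hv : v ≠ 0) (w : VV m) (hw : w ≠ 0) :
    rho (Projectivization.mk ℝ v hv) (Projectivization.mk ℝ w hw) =
      (v ⬝ᵥ w) ^ 2 / ((v ⬝ᵥ v) * (w ⬝ᵥ w)) := by
  simp only [rho, Pm_mk]
  rw [sq, show v ⬝ᵥ w = ∑ b, v b * w b from rfl, Finset.sum_mul_sum, Finset.sum_div]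
  apply Finset.sum_congr rfl
  intro a _
  rw [Finset.sum_div]
  apply Finset.sum_congr rfl
  intro b _
  rw [div_mul_div_comm]
  ring

lemma rho_self (x : PP m) : rho x x = 1 := by
  induction x using Projectivization.ind with
  | h v hv =>
    rw [rho_mk]
    have := (dot_self_pos hv).ne'
    field_simp

lemma continuous_rho : Continuous (fun z : PP m × PP m => rho z.1 z.2) := by
  unfold rho
  refine continuous_finsetSum _ (fun a _ => continuous_finsetSum _ (fun b _ => ?_))
  exact ((continuous_Pm_apply a b).comp continuous_fst).mul
    ((continuous_Pm_apply a b).comp continuous_snd)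

/-- transport of a vector along a path, sampled at the times `τ s` -/
noncomputable def walk (τ : ℕ → I) (γ : C(I, PP m)) (v : VV m) : ℕ → VV m
  | 0 => v
  | s + 1 => pA (γ (τ (s + 1))) (walk τ γ v s)

lemma walk_neg (τ : ℕ → I) (γ : C(I, PP m)) (v : VV m) (s : ℕ) :
    walk τ γ (-v) s = - walk τ γ v s := by
  induction s with
  | zero => rfl
  | succ s ih => simp only [walk, ih, pA_neg]

lemma continuous_pA {X : Type*} [TopologicalSpace X] {f : X → PP m} {g : X → VV m}
    (hf : Continuous f) (hg : Continuous g) : Continuous (fun x => pA (f x) (g x)) := by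
  unfold pA
  refine continuous_pi (fun a => continuous_finsetSum _ (fun b _ => ?_))
  exact ((continuous_Pm_apply a b).comp hf).mul ((continuous_apply b).comp hg)

lemma continuous_walk {X : Type*} [TopologicalSpace X] {f : X → C(I, PP m)} {g : X → VV m}
    (hf : Continuous f) (hg : Continuous g) (τ : ℕ → I) (s : ℕ) :
    Continuous (fun x => walk τ (f x) (g x) s) := by
  induction s with
  | zero => exact hg
  | succ s ih =>
    simp only [walk]
    exact continuous_pA ((continuous_eval_const (F := C(I, PP m)) (τ (s + 1))).comp hf) ih

lemma Continuous.rho_comp {X : Type*} [TopologicalSpace X] {f g : X → PP m}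
    (hf : Continuous f) (hg : Continuous g) : Continuous (fun x => rho (f x) (g x)) :=
  Continuous.comp (g := fun z : PP m × PP m => rho z.1 z.2) continuous_rho (hf.prodMk hg)

lemma pA_step (w : VV m) (hw : w ≠ 0) (y : PP m) (h1 : rho (Projectivization.mk ℝ w hw) y ≠ 0) :
    ∃ h4 : pA y w ≠ 0, Projectivization.mk ℝ _ h4 = y := by
  induction y using Projectivization.ind with
  | h u hu =>
    rw [rho_mk] at h1
    have h2 : w ⬝ᵥ u ≠ 0 := by
      intro h; rw [h] at h1; simp at h1
    have h3 : (u ⬝ᵥ w) / (u ⬝ᵥ u) ≠ 0 := by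
      rw [dotProduct_comm] at h2
      exact div_ne_zero h2 (dot_self_pos hu).ne'
    have h4 : pA (Projectivization.mk ℝ u hu) w ≠ 0 := by
      rw [pA_mk]; exact smul_ne_zero h3 hu
    refine ⟨h4, ?_⟩
    rw [Projectivization.mk_eq_mk_iff']
    exact ⟨_, (pA_mk u hu _).symm⟩

lemma walk_spec (τ : ℕ → I) (γ : C(I, PP m)) (v : VV m) (hv : v ≠ 0)
    (h0 : Projectivization.mk ℝ v hv = γ (τ 0)) (M : ℕ)
    (h : ∀ s < M, rho (γ (τ s)) (γ (τ (s + 1))) ≠ 0) :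
    ∃ hw : walk τ γ v M ≠ 0, Projectivization.mk ℝ _ hw = γ (τ M) := by
  induction M with
  | zero => exact ⟨hv, h0⟩
  | succ M ih =>
    obtain ⟨hw, e⟩ := ih (fun s hs => h s (Nat.lt_succ_of_lt hs))
    have h1 := h M (Nat.lt_succ_self M)
    simp only [walk]
    rw [← e] at h1
    exact pA_step _ hw _ h1

lemma dot_ne_zero_of_mk_eq {v w : VV m} (hv : v ≠ 0) (hw : w ≠ 0)
    (h : Projectivization.mk ℝ v hv = Projectivization.mk ℝ w hw) : v ⬝ᵥ w ≠ 0 := by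
  rw [Projectivization.mk_eq_mk_iff'] at h
  obtain ⟨a, rfl⟩ := h
  rw [smul_dotProduct]
  apply smul_ne_zero
  · rintro rfl; simp at hv
  · exact (dot_self_pos hw).ne'

lemma isOpen_forall_compact {X Z : Type*} [TopologicalSpace X] [TopologicalSpace Z]
    [CompactSpace Z] {S : Set (X × Z)} (hS : IsClosed S) : IsOpen {x | ∀ z, (x, z) ∉ S} := by
  have : {x | ∀ z, (x, z) ∉ S} = (Prod.fst '' S)ᶜ := by
    ext x; simp
  rw [this]
  exact (isClosedMap_fst_of_compactSpace S hS).isOpen_compl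

/-- sampled times -/
noncomputable def tau (n M : ℕ) (j : Fin n) (s : ℕ) : I :=
  Set.projIcc (0 : ℝ) 1 zero_le_one (((j : ℝ) / ((n : ℝ) - 1)) * ((s : ℝ) / ((M : ℝ) + 1)))

lemma tau_step {n : ℕ} (hn : 2 ≤ n) (M : ℕ) (j : Fin n) (s : ℕ) :
    |(tau n M j s : ℝ) - tau n M j (s + 1)| ≤ 1 / ((M : ℝ) + 1) := by
  unfold tau
  refine (Set.abs_projIcc_sub_projIcc _).trans ?_
  have h1 : (0 : ℝ) < (n : ℝ) - 1 := by
    have : (2 : ℝ) ≤ n := by exact_mod_cast hn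
    linarith
  have h2 : (j : ℝ) / ((n : ℝ) - 1) ≤ 1 := by
    rw [div_le_one h1]
    have : ((j : ℕ) : ℝ) + 1 ≤ n := by exact_mod_cast j.2
    linarith
  have h3 : 0 ≤ (j : ℝ) / ((n : ℝ) - 1) := by positivity
  have h4 : (0 : ℝ) < (M : ℝ) + 1 := by positivity
  rw [← mul_sub, abs_mul, abs_of_nonneg h3]
  have h5 : ((s : ℝ) / ((M : ℝ) + 1)) - (((s + 1 : ℕ) : ℝ) / ((M : ℝ) + 1)) =
    - (1 / ((M : ℝ) + 1)) := by push_cast; field_simp; ring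
  rw [h5, abs_neg, abs_of_pos (by positivity)]
  calc _ ≤ 1 * (1 / ((M : ℝ) + 1)) := by gcongr
    _ = _ := one_mul _

/-- the compact space of tuples of unit vectors -/
abbrev KK (m n : ℕ) := Fin n → Metric.sphere (0 : VV m) 1

lemma sph_ne (v : Metric.sphere (0 : VV m) 1) : (v : VV m) ≠ 0 := by
  intro h
  have := mem_sphere_zero_iff_norm.1 v.2
  rw [h] at this; simp at this

/-- the classes of a tuple of unit vectors -/
noncomputable def pt {n : ℕ} (v : KK m n) : Fin n → PP m := fun l => Projectivization.mk ℝ (v l : VV m) (sph_ne _)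

lemma continuous_pt {n : ℕ} : Continuous (pt : KK m n → _) := by
  refine continuous_pi (fun l => ?_)
  exact continuous_mk.comp (f := fun v : KK m n => (⟨(v l : VV m), sph_ne (v l)⟩ : {v : VV m // v ≠ 0}))
    (Continuous.subtype_mk (continuous_subtype_val.comp (continuous_apply l))
      (fun v => sph_ne (v l)))

/-- flip the sign in the block `l` -/
def ng {n : ℕ} (l : Fin n) (v : KK m n) : KK m n := Function.update v l (-(v l))

lemma pt_ng {n : ℕ} (l : Fin n) (v : KK m n) : pt (ng l v) = pt v := by
  funext j
  unfold pt
  rw [Projectivization.mk_eq_mk_iff']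
  by_cases h : j = l
  · subst h
    exact ⟨-1, by simp [ng]⟩
  · exact ⟨1, by simp [ng, h]⟩

/-- sign bit -/
noncomputable def bit (x : ℝ) : ZMod 2 := if 0 < x then 0 else 1

lemma bit_neg {x : ℝ} (hx : x ≠ 0) : bit (-x) = bit x + 1 := by
  unfold bit
  rcases lt_or_gt_of_ne hx with h | h
  · rw [if_pos (by linarith), if_neg (by linarith)]; rfl
  · rw [if_neg (by linarith), if_pos (by linarith)]; rfl

lemma bit_eq {x y : ℝ} (h : 0 < x * y) : bit x = bit y := by
  unfold bit
  rcases pos_and_pos_or_neg_and_neg_of_mul_pos h with h | h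
  · rw [if_pos h.1, if_pos h.2]
  · rw [if_neg h.1.le.not_gt, if_neg h.2.le.not_gt]

theorem topo {n r : ℕ} (hn : 2 ≤ n) (U : Fin r → Set (Fin n → PP m)) (hU : ∀ i, IsOpen (U i))
    (hc : (⋃ i, U i) = Set.univ)
    (hs : ∀ i, ∃ sec : C(U i, C(I, PP m)), ∀ u : U i, tcPi (PP m) n (sec u) = (u : Fin n → PP m))
    (j0 : Fin n) (hj0 : (j0 : ℕ) = 0) :
    ∃ (h : Fin r → Fin n → KK m n → ZMod 2) (ε : ℝ), 0 < ε ∧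
      (∀ i j, j ≠ j0 → ∀ v l, h i j (ng l v) = h i j v + if l = j0 ∨ l = j then 1 else 0) ∧
      (∀ v, ∃ i, ∀ u, dist u v < ε → ∀ j, h i j u = h i j v) := by
  choose sec hsec using hs
  let W : ℕ → Fin r → Set (KK m n) := fun M i => {v | ∃ hv : pt v ∈ U i, ∀ t t' : I,
    |(t : ℝ) - t'| ≤ 1 / ((M : ℝ) + 1) → rho (sec i ⟨pt v, hv⟩ t) (sec i ⟨pt v, hv⟩ t') ≠ 0}
  have hg : ∀ i, Continuous (fun z : {v : KK m n // pt v ∈ U i} => sec i ⟨pt z.1, z.2⟩) := by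
    intro i
    exact (sec i).continuous.comp (Continuous.subtype_mk
      (continuous_pt.comp continuous_subtype_val) _)
  have hWo : ∀ M i, IsOpen (W M i) := by
    intro M i
    have h1 : IsOpen {v : KK m n | pt v ∈ U i} := (hU i).preimage continuous_pt
    let S : Set ({v : KK m n // pt v ∈ U i} × (I × I)) := {z |
      |(z.2.1 : ℝ) - z.2.2| ≤ 1 / ((M : ℝ) + 1) ∧
      rho (sec i ⟨pt z.1.1, z.1.2⟩ z.2.1) (sec i ⟨pt z.1.1, z.1.2⟩ z.2.2) = 0}
    have hS : IsClosed S := by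
      have c1 : IsClosed {z : {v : KK m n // pt v ∈ U i} × (I × I) |
          |(z.2.1 : ℝ) - z.2.2| ≤ 1 / ((M : ℝ) + 1)} := by
        apply isClosed_le _ continuous_const
        fun_prop
      have c2 : IsClosed {z : {v : KK m n // pt v ∈ U i} × (I × I) |
          rho (sec i ⟨pt z.1.1, z.1.2⟩ z.2.1) (sec i ⟨pt z.1.1, z.1.2⟩ z.2.2) = 0} := by
        apply isClosed_eq _ continuous_const
        apply Continuous.rho_comp
        · exact continuous_eval.comp (((hg i).comp continuous_fst).prodMk
            (continuous_fst.comp continuous_snd))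
        · exact continuous_eval.comp (((hg i).comp continuous_fst).prodMk
            (continuous_snd.comp continuous_snd))
      exact c1.inter c2
    have h2 := h1.isOpenMap_subtype_val _ (isOpen_forall_compact hS)
    convert h2 using 1
    ext v
    constructor
    · rintro ⟨hv, h⟩
      exact ⟨⟨v, hv⟩, fun z hz => h z.1 z.2 hz.1 hz.2, rfl⟩
    · rintro ⟨⟨w, hv⟩, h, rfl⟩
      exact ⟨hv, fun t t' h1 h2 => h (t, t') ⟨h1, h2⟩⟩
  have hWc : ∀ v, ∃ M i, v ∈ W M i := by
    intro v
    have hv : pt v ∈ ⋃ i, U i := by rw [hc]; trivial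
    obtain ⟨i, hv⟩ := Set.mem_iUnion.1 hv
    have hcont : Continuous (fun z : I × I => rho (sec i ⟨pt v, hv⟩ z.1) (sec i ⟨pt v, hv⟩ z.2)) :=
      Continuous.rho_comp ((sec i ⟨pt v, hv⟩).continuous.comp continuous_fst)
        ((sec i ⟨pt v, hv⟩).continuous.comp continuous_snd)
    have huc := CompactSpace.uniformContinuous_of_continuous hcont
    rw [Metric.uniformContinuous_iff] at huc
    obtain ⟨δ, hδ, huc⟩ := huc 1 one_pos
    obtain ⟨M, hM⟩ := exists_nat_one_div_lt hδ
    refine ⟨M, i, hv, fun t t' htt h0 => ?_⟩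
    have := @huc (t, t') (t', t') (by
      rw [Prod.dist_eq]
      simp only [dist_self]
      rw [max_eq_left dist_nonneg, Subtype.dist_eq, Real.dist_eq]
      exact lt_of_le_of_lt htt hM)
    simp only [rho_self, h0] at this
    norm_num at this
  have hWm : ∀ M M' i, M ≤ M' → W M i ⊆ W M' i := by
    rintro M M' i hM v ⟨hv, h⟩
    refine ⟨hv, fun t t' htt => h t t' (htt.trans ?_)⟩
    have : (M : ℝ) ≤ M' := by exact_mod_cast hM
    gcongr
  obtain ⟨M, hM⟩ : ∃ M, ∀ v, ∃ i, v ∈ W M i := by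
    obtain ⟨M, hM⟩ := isCompact_univ.elim_directed_cover (fun M => ⋃ i, W M i)
      (fun M => isOpen_iUnion (hWo M)) (by
        intro v _
        obtain ⟨M, i, h⟩ := hWc v
        exact Set.mem_iUnion.2 ⟨M, Set.mem_iUnion.2 ⟨i, h⟩⟩) (by
        intro a b
        exact ⟨max a b, Set.iUnion_mono (fun i => hWm _ _ i (le_max_left _ _)),
          Set.iUnion_mono (fun i => hWm _ _ i (le_max_right _ _))⟩)
    exact ⟨M, fun v => Set.mem_iUnion.1 (hM (Set.mem_univ v))⟩
  classical
  let F : Fin r → Fin n → KK m n → ℝ := fun i j v =>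
    if hv : v ∈ W M i then
      (walk (tau n M j) (sec i ⟨pt v, hv.1⟩) (v j0) (M + 1)) ⬝ᵥ (v j : VV m)
    else ((v j0 : VV m) ⬝ᵥ (pt v j0).rep) * ((v j : VV m) ⬝ᵥ (pt v j).rep)
  have hF0 : ∀ i j v, F i j v ≠ 0 := by
    intro i j v
    simp only [F]
    split_ifs with hv
    · have hγ := hsec i ⟨pt v, hv.1⟩
      set γ := sec i ⟨pt v, hv.1⟩ with hγd
      have e0 : Projectivization.mk ℝ (v j0 : VV m) (sph_ne _) = γ (tau n M j 0) := by
        have := congrFun hγ j0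
        simp only [tcPi, hj0] at this
        simp only [tau]
        simp only [Nat.cast_zero, zero_div, mul_zero] at this ⊢
        rw [this]; rfl
      obtain ⟨hw, hw2⟩ := walk_spec (tau n M j) γ (v j0) (sph_ne _) e0 (M + 1)
        (fun s _ => hv.2 _ _ (tau_step hn M j s))
      apply dot_ne_zero_of_mk_eq hw (sph_ne _)
      rw [hw2]
      have := congrFun hγ j
      simp only [tcPi] at this
      have h4 : ((M : ℝ) + 1) ≠ 0 := by positivity
      simp only [tau]
      push_cast
      rw [div_self h4, mul_one, this]; rfl
    · apply mul_ne_zero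
      · exact dot_ne_zero_of_mk_eq (sph_ne _) (Projectivization.rep_nonzero _)
          (Projectivization.mk_rep _).symm
      · exact dot_ne_zero_of_mk_eq (sph_ne _) (Projectivization.rep_nonzero _)
          (Projectivization.mk_rep _).symm
  have hWng : ∀ i l v, ng l v ∈ W M i ↔ v ∈ W M i := by
    intro i l v
    simp only [W, Set.mem_ofPred_eq, pt_ng]
  have hFng : ∀ i j, j ≠ j0 → ∀ v l, F i j (ng l v) =
      if l = j0 ∨ l = j then - F i j v else F i j v := by
    intro i j hj v l
    simp only [F, hWng, pt_ng]
    have a0 : l = j0 → ((ng l v j0 : _) : VV m) = - (v j0 : VV m) := by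
      rintro rfl; simp [ng]
    have a1 : l ≠ j0 → ((ng l v j0 : _) : VV m) = (v j0 : VV m) := by
      intro h; simp [ng, h.symm]
    have b0 : l = j → ((ng l v j : _) : VV m) = - (v j : VV m) := by
      rintro rfl; simp [ng]
    have b1 : l ≠ j → ((ng l v j : _) : VV m) = (v j : VV m) := by
      intro h; simp [ng, h.symm]
    by_cases h1 : l = j0
    · have h2 : l ≠ j := fun h => hj (h.symm.trans h1)
      rw [if_pos (Or.inl h1), a0 h1, b1 h2]
      split_ifs
      · rw [walk_neg, neg_dotProduct]
      · rw [neg_dotProduct, neg_mul]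
    · by_cases h2 : l = j
      · rw [if_pos (Or.inr h2), a1 h1, b0 h2]
        split_ifs
        · rw [dotProduct_neg]
        · rw [neg_dotProduct, mul_neg]
      · rw [if_neg (by tauto), a1 h1, b1 h2]
  choose iv hiv using hM
  have hcont : ∀ i j, Continuous (fun z : W M i => F i j z.1) := by
    intro i j
    have : (fun z : W M i => F i j z.1) = fun z : W M i =>
        (walk (tau n M j) (sec i ⟨pt z.1, z.2.1⟩) (z.1 j0) (M + 1)) ⬝ᵥ (z.1 j : VV m) := by
      funext z
      simp only [F]
      rw [dif_pos z.2]
    rw [this]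
    apply Continuous.dotProduct
    · apply continuous_walk
      · exact (hg i).comp (Continuous.subtype_mk continuous_subtype_val (fun z => z.2.1))
      · exact continuous_subtype_val.comp ((continuous_apply j0).comp continuous_subtype_val)
    · exact continuous_subtype_val.comp ((continuous_apply j).comp continuous_subtype_val)
  let c : KK m n → Set (KK m n) := fun v =>
    Subtype.val '' {z : W M (iv v) | ∀ j, 0 < F (iv v) j z.1 * F (iv v) j v}
  have hco : ∀ v, IsOpen (c v) := by
    intro v
    apply (hWo M (iv v)).isOpenMap_subtype_val
    simp only [Set.ofPred_forall]
    apply isOpen_iInter_of_finite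
    intro j
    exact isOpen_lt continuous_const ((hcont _ j).mul continuous_const)
  obtain ⟨ε, hε, hleb⟩ := lebesgue_number_lemma_of_metric isCompact_univ hco (by
    intro v _
    refine Set.mem_iUnion.2 ⟨v, ⟨v, hiv v⟩, fun j => ?_, rfl⟩
    exact mul_self_pos.2 (hF0 _ _ _))
  refine ⟨fun i j v => bit (F i j v), ε, hε, ?_, ?_⟩
  · intro i j hj v l
    simp only [hFng i j hj]
    split_ifs
    · exact bit_neg (hF0 _ _ _)
    · simp
  · intro x
    obtain ⟨v, hv⟩ := hleb x (Set.mem_univ x)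
    have key : ∀ u, dist u x < ε → ∀ j, bit (F (iv v) j u) = bit (F (iv v) j v) := by
      intro u hu j
      obtain ⟨z, hz, rfl⟩ := hv (Metric.mem_ball.2 hu)
      exact bit_eq (hz j)
    refine ⟨iv v, fun u hu j => ?_⟩
    exact (key u hu j).trans (key x (by simpa using hε) j).symm

end Topo
section Lower
variable {m : ℕ}

/-- rescaled grid point -/
noncomputable def gv {n : ℕ} (N : ℤ) (p : Fin n × Fin (m + 1) → ℤ) (j : Fin n) : VV m :=
  fun i => (p (j, i) : ℝ) / N

lemma gv_norm {n : ℕ} {N : ℤ} (hN0 : 0 < N) {p : Fin n × Fin (m + 1) → ℤ} (h : p ∈ YY N)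
    (j : Fin n) : ‖gv N p j‖ = 1 := by
  have hN : (0 : ℝ) < N := by exact_mod_cast hN0
  have e : ∀ i, ‖gv N p j i‖ = (|p (j, i)| : ℤ) / (N : ℝ) := by
    intro i
    simp only [gv, Real.norm_eq_abs, abs_div, abs_of_pos hN]
    push_cast; rfl
  apply le_antisymm
  · rw [pi_norm_le_iff_of_nonneg zero_le_one]
    intro i
    rw [e, div_le_one hN]
    exact_mod_cast (h j).1 i
  · obtain ⟨i, hi⟩ := (h j).2
    have := norm_le_pi_norm (gv N p j) i
    rwa [e, hi, div_self hN.ne'] at this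

lemma one_norm_vv : ‖(fun _ => 1 : VV m)‖ = 1 := by
  rw [pi_norm_const]; simp

open Classical in
/-- grid point as a tuple of unit vectors -/
noncomputable def gK {n : ℕ} (N : ℤ) (p : Fin n × Fin (m + 1) → ℤ) : KK m n := fun j =>
  if h : ‖gv N p j‖ = 1 then ⟨gv N p j, by simpa using h⟩
    else ⟨fun _ => 1, by simpa using one_norm_vv (m := m)⟩

lemma gK_val {n : ℕ} {N : ℤ} (hN0 : 0 < N) {p : Fin n × Fin (m + 1) → ℤ} (h : p ∈ YY N)
    (j : Fin n) : (gK N p j : VV m) = gv N p j := by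
  unfold gK
  rw [dif_pos (gv_norm hN0 h j)]

lemma gK_flp {n : ℕ} {N : ℤ} (hN0 : 0 < N) {p : Fin n × Fin (m + 1) → ℤ} (h : p ∈ YY N)
    (l : Fin n) : gK N (flp l p) = ng l (gK N p) := by
  funext j
  apply Subtype.ext
  rw [gK_val hN0 (YY_flp h)]
  by_cases hj : j = l
  · subst hj
    simp only [ng, Function.update_self]
    rw [show ((-(gK N p j) : Metric.sphere (0 : VV m) 1) : VV m) = - (gK N p j : VV m) from rfl,
      gK_val hN0 h]
    funext i
    simp [gv, flp, neg_div]
  · simp only [ng, Function.update_of_ne hj]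
    rw [gK_val hN0 h]
    funext i
    simp [gv, flp, hj]

lemma gK_dist {n : ℕ} {N : ℤ} (hN0 : 0 < N) (hN : Even N) {q p : Fin n × Fin (m + 1) → ℤ}
    (h : p ∈ YY N) (hq : FaceLE q p) : dist (gK N q) (gK N p) ≤ 1 / (N : ℝ) := by
  have hNr : (0 : ℝ) < N := by exact_mod_cast hN0
  rw [dist_pi_le_iff (by positivity)]
  intro j
  rw [Subtype.dist_eq, gK_val hN0 h, gK_val hN0 (YY_face hN h hq),
    dist_pi_le_iff (by positivity)]
  intro i
  simp only [gv, Real.dist_eq]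
  rw [← sub_div, abs_div, abs_of_pos hNr]
  have h1 : |q (j, i) - p (j, i)| ≤ 1 := by
    rcases hq (j, i) with e | e
    · rw [e]; simp
    · exact e.2
  have h2 : |(q (j, i) : ℝ) - p (j, i)| ≤ 1 := by exact_mod_cast h1
  gcongr

/-- the list of block labels -/
noncomputable def JL {n : ℕ} (t : ℕ) (j0 b : Fin n) : List (Fin n) :=
  List.replicate (2 ^ t - 1) b ++ (Finset.univ.erase j0).toList.flatMap
    (fun j => List.replicate (2 ^ t) j)

lemma JL_length {n : ℕ} (t : ℕ) (j0 b : Fin n) : (JL t j0 b).length + 1 = n * 2 ^ t := by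
  have hn : 0 < n := j0.pos
  simp only [JL, List.length_append, List.length_replicate, List.length_flatMap, List.map_const',
    List.sum_replicate, Finset.length_toList, Finset.card_erase_of_mem (Finset.mem_univ j0),
    Finset.card_univ, Fintype.card_fin, smul_eq_mul]
  obtain ⟨n', rfl⟩ := Nat.exists_eq_succ_of_ne_zero hn.ne'
  have : 0 < 2 ^ t := by positivity
  rw [Nat.succ_sub_one, Nat.succ_mul]
  omega

lemma JL_ne {n : ℕ} (t : ℕ) (j0 b : Fin n) (hb : b ≠ j0) : ∀ j ∈ JL t j0 b, j ≠ j0 := by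
  intro j hj
  simp only [JL, List.mem_append, List.mem_replicate, List.mem_flatMap, Finset.mem_toList,
    Finset.mem_erase] at hj
  rcases hj with ⟨_, rfl⟩ | ⟨a, ha, _, rfl⟩
  · exact hb
  · exact ha.1

/-- character -/
def chi {n : ℕ} (j0 j : Fin n) : Fin n → ZMod 2 := fun l => if l = j0 ∨ l = j then 1 else 0

open MvPolynomial in
lemma linP_chi {n : ℕ} (j0 j : Fin n) (h : j ≠ j0) : linP (chi j0 j) = X j0 + X j := by
  unfold linP chi
  have : ∀ l : Fin n, (C (if l = j0 ∨ l = j then (1 : ZMod 2) else 0) * X l :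
      MvPolynomial (Fin n) (ZMod 2)) = (if l = j0 then X l else 0) + (if l = j then X l else 0) := by
    intro l
    by_cases h1 : l = j0
    · have h2 : l ≠ j := fun e => h (e.symm.trans h1)
      have h3 : j0 ≠ j := h.symm
      simp [h1, h3]
    · by_cases h2 : l = j
      · simp [h2, h]
      · simp [h1, h2]
  rw [Finset.sum_congr rfl (fun l _ => this l), Finset.sum_add_distrib]
  simp

open MvPolynomial in
lemma JL_prod {n : ℕ} (t : ℕ) (j0 b : Fin n) (hb : b ≠ j0) :
    ((JL t j0 b).map (fun j => linP (chi j0 j))).prod =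
      (X j0 + X b) ^ (2 ^ t - 1) * ∏ j ∈ Finset.univ.erase j0, (X j0 + X j) ^ (2 ^ t) := by
  rw [List.map_congr_left (fun j hj => linP_chi j0 j (JL_ne t j0 b hb j hj))]
  simp only [JL, List.map_append, List.prod_append, List.map_replicate, List.prod_replicate,
    List.map_flatMap]
  congr 1
  rw [← Finset.prod_map_toList]
  generalize (Finset.univ.erase j0).toList = l
  induction l with
  | nil => simp
  | cons a l ih => simp [ih]

theorem lower_bound {n r t : ℕ} (hm : m = 2 ^ t) (hn : 2 ≤ n)
    (hr : 0 < r) (U : Fin r → Set (Fin n → PP m)) (hU : ∀ i, IsOpen (U i))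
    (hc : (⋃ i, U i) = Set.univ)
    (hs : ∀ i, ∃ sec : C(U i, C(I, PP m)), ∀ u : U i, tcPi (PP m) n (sec u) = (u : Fin n → PP m)) :
    n * 2 ^ t ≤ r := by
  by_contra hlt
  let j0 : Fin n := ⟨0, by omega⟩
  let b : Fin n := ⟨1, by omega⟩
  have hb : b ≠ j0 := by simp [b, j0]
  obtain ⟨h, ε, hε, heq, hloc⟩ := topo hn U hU hc hs j0 rfl
  obtain ⟨N', hN'⟩ := exists_nat_one_div_lt hε
  obtain ⟨N, hNe, hN0, hNε⟩ : ∃ N : ℤ, Even N ∧ 0 < N ∧ 1 / (N : ℝ) < ε := by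
    refine ⟨2 * (N' + 1), even_two_mul _, by positivity, lt_of_le_of_lt ?_ hN'⟩
    push_cast
    apply one_div_le_one_div_of_le (by positivity)
    have : (0 : ℝ) ≤ N' := by positivity
    linarith
  have hlen := JL_length t j0 b
  let idx : ℕ → Fin r := fun s => if hs : s < r then ⟨s, hs⟩ else ⟨0, hr⟩
  let f : Fin (JL t j0 b).length → (((Fin n × Fin (m + 1)) → ℤ) → ZMod 2) × (Fin n → ZMod 2) :=
    fun s => (fun p => h (idx s) ((JL t j0 b).get s) (gK N p), chi j0 ((JL t j0 b).get s))
  let L := List.ofFn f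
  have hL : ∀ a ∈ L, EqV N a := by
    intro a ha
    obtain ⟨s, rfl⟩ := (List.mem_ofFn' f a).1 ha
    intro p hp l
    simp only [f]
    rw [gK_flp hN0 hp, heq _ _ (JL_ne t j0 b hb _ (List.get_mem _ _))]
    rfl
  let k : Fin n →₀ ℕ := Finsupp.single j0 (2 ^ t - 1) +
    ∑ j ∈ Finset.univ.erase j0, Finsupp.single j (2 ^ t)
  have hkj : ∀ j, k j = if j = j0 then 2 ^ t - 1 else 2 ^ t := by
    intro j
    simp only [k, Finsupp.add_apply, Finsupp.finsetSum_apply, Finsupp.single_apply]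
    rw [Finset.sum_ite_eq']
    by_cases e : j = j0
    · simp [e]
    · simp [e, Ne.symm e]
  have hk : ∀ j, k j ≤ m := by
    intro j
    rw [hkj, hm]; split_ifs
    · exact Nat.sub_le _ _
    · exact le_rfl
  have hd : k.degree = L.length := by
    have h1 : k.degree = (2 ^ t - 1) + (n - 1) * 2 ^ t := by
      simp only [k, map_add, map_sum, Finsupp.degree_single]
      rw [Finset.sum_const, Finset.card_erase_of_mem (Finset.mem_univ j0), Finset.card_univ,
        Fintype.card_fin, smul_eq_mul]
    rw [h1, List.length_ofFn]
    have : 0 < 2 ^ t := by positivity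
    obtain ⟨n', rfl⟩ := Nat.exists_eq_succ_of_ne_zero (show n ≠ 0 by omega)
    rw [Nat.succ_mul] at hlen
    rw [Nat.succ_sub_one]
    omega
  have hmain := main_count hNe hN0 L hL k hk hd
  have hR : (L.map (fun a => linP a.2)).prod =
      ((JL t j0 b).map (fun j => linP (chi j0 j))).prod := by
    congr 1
    simp only [L, List.map_ofFn]
    conv_rhs => rw [← List.ofFn_get (JL t j0 b), List.map_ofFn]
    rfl
  rw [hR, JL_prod t j0 b hb, coeff_prod_aux t j0 b hb.symm _ (by simp)] at hmain
  have hz : ∀ p : Fin n × Fin (m + 1) → ℤ, cP N k p * Bw (L.map Prod.fst) p = 0 := by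
    intro p
    by_cases hp : cP N k p = 0
    · rw [hp, zero_mul]
    have hY := cP_support hNe hN0 hk hp
    obtain ⟨i, hi⟩ := hloc (gK N p)
    have hil : (i : ℕ) < (JL t j0 b).length := by have := i.2; omega
    rw [Bw_eq_zero, mul_zero]
    refine ⟨(f ⟨i, hil⟩).1, ?_, ?_⟩
    · apply List.mem_map_of_mem
      exact (List.mem_ofFn' f _).2 ⟨_, rfl⟩
    · intro q hq
      have hidx : idx i = i := by simp [idx]
      simp only [f, hidx]
      exact hi _ (lt_of_le_of_lt (gK_dist hN0 hNe hY hq) hNε) _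
  rw [finsum_congr hz, finsum_zero] at hmain
  exact zero_ne_one hmain

end Lower
section Upper
variable {m : ℕ}

lemma Pm_diag_sum (x : PP m) : ∑ l, Pm x l l = 1 := by
  induction x using Projectivization.ind with
  | h v hv =>
    simp only [Pm_mk]
    rw [← Finset.sum_div]
    exact div_self (dot_self_pos hv).ne'

lemma mk_col (x : PP m) (i : Fin (m + 1)) (h : (fun b => Pm x b i) ≠ 0) :
    Projectivization.mk ℝ (fun b => Pm x b i) h = x := by
  induction x using Projectivization.ind with
  | h v hv =>
    rw [Projectivization.mk_eq_mk_iff']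
    refine ⟨v i / (v ⬝ᵥ v), ?_⟩
    funext b
    simp only [Pm_mk, Pi.smul_apply, smul_eq_mul]
    ring

/-- basic open sets -/
def NI {n : ℕ} (i : Fin n → Fin (m + 1)) : Set (Fin n → PP m) :=
  {x | ∃ c : ℝ, 0 < c ∧ ∀ j, (∀ l, l < i j → Pm (x j) l l < c) ∧ c < Pm (x j) (i j) (i j)}

lemma continuous_Pm_diag {n : ℕ} (j : Fin n) (l : Fin (m + 1)) :
    Continuous (fun x : Fin n → PP m => Pm (x j) l l) :=
  (continuous_Pm_apply l l).comp (continuous_apply j)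

lemma isOpen_NI {n : ℕ} (i : Fin n → Fin (m + 1)) : IsOpen (NI i : Set (Fin n → PP m)) := by
  rw [isOpen_iff_mem_nhds]
  rintro x ⟨c, hc, h⟩
  have h1 : ∀ᶠ y in nhds x, ∀ j, (∀ l, l < i j → Pm (y j) l l < c) ∧ c < Pm (y j) (i j) (i j) := by
    rw [Filter.eventually_all]
    intro j
    apply Filter.Eventually.and
    · rw [Filter.eventually_all]
      intro l
      by_cases hl : l < i j
      · have := (continuous_Pm_diag j l).continuousAt.eventually_lt (continuousAt_const (y := c))
          ((h j).1 l hl)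
        filter_upwards [this] with y hy _ using hy
      · exact Filter.Eventually.of_forall (fun y h' => absurd h' hl)
    · exact (continuousAt_const (y := c)).eventually_lt (continuous_Pm_diag j (i j)).continuousAt
        (h j).2
  filter_upwards [h1] with y hy
  exact ⟨c, hc, hy⟩

lemma NI_unique {n : ℕ} {i i' : Fin n → Fin (m + 1)} (hs : ∑ j, (i j : ℕ) = ∑ j, (i' j : ℕ))
    {x : Fin n → PP m} (h : x ∈ NI i) (h' : x ∈ NI i') : i = i' := by
  obtain ⟨c, hc, h⟩ := h
  obtain ⟨c', hc', h'⟩ := h'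
  wlog hcc : c ≤ c' generalizing i i' c c'
  · exact (this hs.symm c' hc' h' c hc h (le_of_not_ge hcc)).symm
  have hle : ∀ j, (i j : ℕ) ≤ i' j := by
    intro j
    by_contra hlt
    have := (h j).1 (i' j) (by rw [Fin.lt_def]; omega)
    have := (h' j).2
    linarith
  have := (Finset.sum_eq_sum_iff_of_le (fun j _ => hle j)).1 hs
  funext j
  exact Fin.ext (this j (Finset.mem_univ _))

lemma NI_cover {n : ℕ} (x : Fin n → PP m) : ∃ i : Fin n → Fin (m + 1), x ∈ NI i := by
  have hpos : (0 : ℝ) < 1 / ((m : ℝ) + 1) := by positivity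
  have hfin : (Set.range (fun z : Fin n × Fin (m + 1) => Pm (x z.1) z.2 z.2)).Finite :=
    Set.finite_range _
  obtain ⟨c, ⟨hc0, hc1⟩, hc⟩ := (Set.Ioo_infinite hpos).exists_notMem_finite hfin
  have key : ∀ j, ∃ i : Fin (m + 1), (∀ l, l < i → Pm (x j) l l < c) ∧ c < Pm (x j) i i := by
    intro j
    have hne : {l : Fin (m + 1) | c < Pm (x j) l l}.Nonempty := by
      by_contra hemp
      have h1 : ∀ l, Pm (x j) l l ≤ c := by
        intro l
        by_contra h2
        exact hemp ⟨l, lt_of_not_ge h2⟩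
      have h2 := Finset.sum_le_sum (fun l (_ : l ∈ Finset.univ) => h1 l)
      rw [Pm_diag_sum] at h2
      simp only [Finset.sum_const, Finset.card_univ, Fintype.card_fin, nsmul_eq_mul] at h2
      push_cast at h2
      rw [lt_div_iff₀ (by positivity)] at hc1
      linarith
    obtain ⟨i, hi, hmin⟩ := WellFounded.has_min (wellFounded_lt (α := Fin (m + 1))) _ hne
    refine ⟨i, fun l hl => ?_, hi⟩
    have h1 : ¬ c < Pm (x j) l l := fun h => hmin l h hl
    exact lt_of_le_of_ne (not_lt.1 h1) (fun e => hc ⟨(j, l), e⟩)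
  choose i hi using key
  exact ⟨i, c, hc0, hi⟩

/-- narrow tent -/
noncomputable def tb (r : ℝ) : ℝ := max 0 (1 - 2 * |r|)
/-- wide tent -/
noncomputable def tw (r : ℝ) : ℝ := max 0 (1 - |r|)

lemma tb_nonneg (r : ℝ) : 0 ≤ tb r := le_max_left _ _
lemma tb_le_tw (r : ℝ) : tb r ≤ tw r :=
  max_le_max le_rfl (by have := abs_nonneg r; linarith)
lemma tb_zero {r : ℝ} (h : 1 / 2 ≤ |r|) : tb r = 0 := max_eq_left (by linarith)
lemma tw_zero {r : ℝ} (h : 1 ≤ |r|) : tw r = 0 := max_eq_left (by linarith)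
lemma tw_pos {r : ℝ} (h : |r| ≤ 1 / 2) : 0 < tw r := lt_max_of_lt_right (by linarith)

/-- the moving vector -/
noncomputable def vF {n : ℕ} (i : Fin n → Fin (m + 1)) (x : Fin n → PP m) (t : ℝ) : VV m :=
  fun b => ∑ j : Fin n, (tb (t * ((n : ℝ) - 1) - (j : ℕ)) * Pm (x j) b (i j) +
    (tw (t * ((n : ℝ) - 1) - (j : ℕ)) - tb (t * ((n : ℝ) - 1) - (j : ℕ))) * if b = i j then 1 else 0)

lemma continuous_vF {n : ℕ} (i : Fin n → Fin (m + 1)) :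
    Continuous (fun z : (Fin n → PP m) × ℝ => vF i z.1 z.2) := by
  unfold vF tb tw
  refine continuous_pi (fun b => continuous_finsetSum _ (fun j _ => ?_))
  apply Continuous.add
  · apply Continuous.mul
    · fun_prop
    · exact (continuous_Pm_apply b (i j)).comp ((continuous_apply j).comp continuous_fst)
  · apply Continuous.mul
    · fun_prop
    · exact continuous_const

lemma vF_ne {n : ℕ} (hn : 2 ≤ n) {i : Fin n → Fin (m + 1)} {x : Fin n → PP m} (hx : x ∈ NI i)
    {t : ℝ} (h0 : 0 ≤ t) (h1 : t ≤ 1) : vF i x t ≠ 0 := by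
  obtain ⟨c, hc, hx⟩ := hx
  have hn1 : (0 : ℝ) ≤ (n : ℝ) - 1 := by
    have : (2 : ℝ) ≤ n := by exact_mod_cast hn
    linarith
  set τ := t * ((n : ℝ) - 1) with hτ
  have hτ0 : 0 ≤ τ := mul_nonneg h0 hn1
  have hτ1 : τ ≤ (n : ℝ) - 1 := by nlinarith
  have hf1 := Nat.floor_le (show 0 ≤ τ + 1 / 2 by linarith)
  have hf2 := Nat.lt_floor_add_one (τ + 1 / 2)
  have hf3 : ⌊τ + 1 / 2⌋₊ < n := by
    have : (⌊τ + 1 / 2⌋₊ : ℝ) < n := by linarith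
    exact_mod_cast this
  let j : Fin n := ⟨⌊τ + 1 / 2⌋₊, hf3⟩
  have hj : |τ - (j : ℕ)| ≤ 1 / 2 := by
    rw [abs_le]; simp only [j]; constructor <;> linarith
  have hj' : ∀ j' : Fin n, j' ≠ j → 1 / 2 ≤ |τ - (j' : ℕ)| := by
    intro j' hne
    have h2 : ((j' : ℕ) : ℝ) + 1 ≤ (j : ℕ) ∨ ((j : ℕ) : ℝ) + 1 ≤ (j' : ℕ) := by
      have : (j' : ℕ) ≠ j := fun e => hne (Fin.ext e)
      rcases lt_or_gt_of_ne this with h | h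
      · left; exact_mod_cast h
      · right; exact_mod_cast h
    rw [abs_le] at hj
    rw [le_abs]
    rcases h2 with h | h
    · left; linarith
    · right; linarith
  intro h
  have h3 := congrFun h (i j)
  simp only [vF, Pi.zero_apply] at h3
  apply absurd h3
  apply ne_of_gt
  apply Finset.sum_pos'
  · intro j' _
    apply add_nonneg
    · by_cases e : j' = j
      · rw [e]
        exact mul_nonneg (tb_nonneg _) (hc.le.trans (hx j).2.le)
      · rw [tb_zero (hj' j' e), zero_mul]
    · apply mul_nonneg
      · exact sub_nonneg.2 (tb_le_tw _)
      · split_ifs <;> norm_num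
  · refine ⟨j, Finset.mem_univ _, ?_⟩
    rw [if_pos rfl, mul_one]
    have p1 := tw_pos hj
    have p2 := tb_nonneg (τ - (j : ℕ))
    have p3 := tb_le_tw (τ - (j : ℕ))
    have p4 : 0 < Pm (x j) (i j) (i j) := hc.trans (hx j).2
    rcases p2.eq_or_lt with e | e
    · rw [← e]; linarith
    · have := mul_pos e p4
      linarith

lemma vF_eval {n : ℕ} (hn : 2 ≤ n) (i : Fin n → Fin (m + 1)) (x : Fin n → PP m) (j : Fin n) :
    vF i x ((j : ℝ) / ((n : ℝ) - 1)) = fun b => Pm (x j) b (i j) := by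
  have hn1 : (n : ℝ) - 1 ≠ 0 := by
    have : (2 : ℝ) ≤ n := by exact_mod_cast hn
    linarith
  funext b
  simp only [vF, div_mul_cancel₀ _ hn1]
  rw [Finset.sum_eq_single j]
  · simp [tb, tw]
  · intro j' _ hne
    have h2 : 1 ≤ |((j : ℕ) : ℝ) - (j' : ℕ)| := by
      have h3 : ((j : ℕ) : ℤ) - (j' : ℕ) ≠ 0 := by
        intro e
        exact hne (Fin.ext (by omega))
      have := Int.one_le_abs h3
      exact_mod_cast this
    rw [tb_zero (by linarith), tw_zero h2]
    simp
  · intro h; exact absurd (Finset.mem_univ _) h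

/-- the open sets of the cover -/
def US (m n s : ℕ) : Set (Fin n → PP m) :=
  ⋃ i : Fin n → Fin (m + 1), ⋃ _ : ∑ j, (i j : ℕ) = s, NI i

lemma mem_US {n s : ℕ} {x : Fin n → PP m} :
    x ∈ US m n s ↔ ∃ i : Fin n → Fin (m + 1), ∑ j, (i j : ℕ) = s ∧ x ∈ NI i := by
  simp [US]

lemma US_sec {n : ℕ} (hn : 2 ≤ n) (s : ℕ) : ∃ sec : C(US m n s, C(I, PP m)),
    ∀ u : US m n s, tcPi (PP m) n (sec u) = (u : Fin n → PP m) := by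
  have key : ∀ u : US m n s, ∃ i : Fin n → Fin (m + 1), ∑ j, (i j : ℕ) = s ∧
    (u : Fin n → PP m) ∈ NI i := fun u => mem_US.1 u.2
  choose i hi1 hi2 using key
  have hlc : IsLocallyConstant i := by
    rw [IsLocallyConstant.iff_exists_open]
    intro u
    refine ⟨Subtype.val ⁻¹' NI (i u), (isOpen_NI _).preimage continuous_subtype_val, hi2 u, ?_⟩
    intro w hw
    exact NI_unique ((hi1 w).trans (hi1 u).symm) (hi2 w) hw
  have hv : Continuous (fun z : US m n s × I => vF (i z.1) z.1 (z.2 : ℝ)) := by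
    have h1 : Continuous (fun z : (Fin n → Fin (m + 1)) × ((Fin n → PP m) × ℝ) =>
        vF z.1 z.2.1 z.2.2) := by
      rw [continuous_prod_of_discrete_left]
      exact fun a => continuous_vF a
    exact h1.comp (f := fun z : US m n s × I => (i z.1, ((z.1 : Fin n → PP m), (z.2 : ℝ))))
      ((hlc.continuous.comp continuous_fst).prodMk
        ((continuous_subtype_val.comp continuous_fst).prodMk
          (continuous_subtype_val.comp continuous_snd)))
  have hne : ∀ z : US m n s × I, vF (i z.1) z.1 (z.2 : ℝ) ≠ 0 :=
    fun z => vF_ne hn (hi2 z.1) z.2.2.1 z.2.2.2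
  let H : C(US m n s × I, PP m) := ⟨fun z => Projectivization.mk ℝ _ (hne z),
    continuous_mk.comp (f := fun z => (⟨_, hne z⟩ : {v : VV m // v ≠ 0}))
      (Continuous.subtype_mk hv hne)⟩
  refine ⟨H.curry, fun u => ?_⟩
  funext j
  have hj : ((j : ℝ) / ((n : ℝ) - 1)) ∈ Set.Icc (0 : ℝ) 1 := by
    have h2 : (2 : ℝ) ≤ n := by exact_mod_cast hn
    have h3 : ((j : ℕ) : ℝ) + 1 ≤ n := by exact_mod_cast j.2
    refine ⟨div_nonneg (by positivity) (by linarith), ?_⟩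
    rw [div_le_one (by linarith)]
    linarith
  simp only [tcPi]
  rw [Set.projIcc_of_mem zero_le_one hj]
  have e := vF_eval hn (i u) u j
  have h4 : (fun b => Pm ((u : Fin n → PP m) j) b (i u j)) ≠ 0 := by
    rw [← e]; exact hne (u, ⟨_, hj⟩)
  rw [← mk_col ((u : Fin n → PP m) j) (i u j) h4]
  change Projectivization.mk ℝ (vF (i u) u ((j : ℝ) / ((n : ℝ) - 1))) _ = _
  simp only [e]

lemma upper_mem {n : ℕ} (hn : 2 ≤ n) : (n * m + 1) ∈ {k | 0 < k ∧
    ∃ U : Fin k → Set (Fin n → PP m),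
    (∀ i, IsOpen (U i)) ∧ (⋃ i, U i) = Set.univ ∧
    ∀ i, ∃ sec : C(U i, C(I, PP m)), ∀ u : U i, tcPi (PP m) n (sec u) = (u : Fin n → PP m)} := by
  refine ⟨Nat.succ_pos _, fun s => US m n s, fun s => ?_, ?_, fun s => US_sec hn s⟩
  · exact isOpen_iUnion (fun i => isOpen_iUnion (fun _ => isOpen_NI i))
  · rw [Set.eq_univ_iff_forall]
    intro x
    obtain ⟨i, hi⟩ := NI_cover x
    have : ∑ j, (i j : ℕ) ≤ n * m := by
      have := Finset.sum_le_sum (fun j (_ : j ∈ Finset.univ) => Nat.lt_succ_iff.1 (i j).2)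
      simpa using this
    exact Set.mem_iUnion.2 ⟨⟨∑ j, (i j : ℕ), Nat.lt_succ_of_le this⟩, mem_US.2 ⟨i, rfl, hi⟩⟩

end Upper

/-- For `m = 2^t` with `t` a positive integer and `n ≥ 2`:
`n·2^t ≤ TC_n(ℝP^m) ≤ n·2^t + 1`. -/
theorem higherTC_realProj_two_pow (m t n : ℕ) (ht : 0 < t) (hm : m = 2 ^ t) (hn : 2 ≤ n) :
    n * 2 ^ t ≤ higherTC (Projectivization ℝ (Fin (m + 1) → ℝ)) n ∧
    higherTC (Projectivization ℝ (Fin (m + 1) → ℝ)) n ≤ n * 2 ^ t + 1 := by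
  have hup := upper_mem (m := m) hn
  constructor
  · apply le_csInf ⟨_, hup⟩
    rintro r ⟨hr, U, hU, hc, hs⟩
    exact lower_bound hm hn hr U hU hc hs
  · have := Nat.sInf_le hup
    rwa [hm] at this ⊢
end

section
/- Let t be a positive integer, let m ≥ 2^t be an integer, and let n ≥ 2 be an integer. Then TC_n(ℝP^m) ≥ n·2^t, where ℝP^m is the m-dimensional real projective space. -/
open scoped unitInterval

noncomputable section HTCmaterial

open Function Finset

namespace HTC

/-- one factor coboundary in direction `x` -/
def dl (x : ℕ) (β : (ℕ → ℤ) → ZMod 2) (v : ℕ → ℤ) : ZMod 2 :=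
  if Odd (v x) then β (update v x (v x + 1)) + β (update v x (v x - 1)) else 0

def dlt (d : ℕ) (β : (ℕ → ℤ) → ZMod 2) (v : ℕ → ℤ) : ZMod 2 := ∑ x ∈ range d, dl x β v

def cubeF (M : ℕ) : ℕ → ((ℕ → ℤ) → ZMod 2) → ZMod 2
  | 0, β => β 0
  | d + 1, β => ∑ p ∈ range M, (cubeF M d (fun v => β (update v d (2 * p + 1)))
      + cubeF M d (fun v => β (update v d (-(2 * p + 1)))))

def bdF (M : ℕ) : ℕ → ((ℕ → ℤ) → ZMod 2) → ZMod 2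
  | 0, _ => 0
  | d + 1, β => cubeF M d (fun v => β (update v d (2 * M))) +
      cubeF M d (fun v => β (update v d (-(2 * M)))) +
      ∑ p ∈ range M, (bdF M d (fun v => β (update v d (2 * p + 1)))
      + bdF M d (fun v => β (update v d (-(2 * p + 1)))))

def hF (M d : ℕ) (β : (ℕ → ℤ) → ZMod 2) : ZMod 2 :=
  cubeF M d (fun v => β (update v d (2 * M))) +
    ∑ p ∈ range M, bdF M d (fun v => β (update v d (2 * p + 1)))

def Rep (P : (ℕ → ℤ) → Prop) (Φ : ((ℕ → ℤ) → ZMod 2) → ZMod 2) : Prop :=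
  ∃ l : List (ℕ → ℤ), (∀ v ∈ l, P v) ∧ ∀ β, Φ β = (l.map β).sum

lemma Rep.zero (P) : Rep P (fun _ => 0) := ⟨[], by simp, by simp⟩

lemma Rep.add {P Φ Ψ} (h : Rep P Φ) (h' : Rep P Ψ) : Rep P (fun β => Φ β + Ψ β) := by
  obtain ⟨l, hl, h⟩ := h
  obtain ⟨l', hl', h'⟩ := h'
  refine ⟨l ++ l', ?_, ?_⟩
  · intro v hv
    rcases List.mem_append.1 hv with hv | hv
    · exact hl v hv
    · exact hl' v hv
  · intro β; simp [h, h']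

lemma Rep.sum {P} {Φ : ℕ → ((ℕ → ℤ) → ZMod 2) → ZMod 2} (M : ℕ) (h : ∀ p < M, Rep P (Φ p)) :
    Rep P (fun β => ∑ p ∈ range M, Φ p β) := by
  induction M with
  | zero => simpa using Rep.zero P
  | succ M ih =>
    simp only [sum_range_succ]
    exact (ih fun p hp => h p (by omega)).add (h M (by omega))

lemma Rep.comp {P Q Φ} (h : Rep P Φ) (f : (ℕ → ℤ) → (ℕ → ℤ)) (hf : ∀ v, P v → Q (f v)) :
    Rep Q (fun β => Φ (fun v => β (f v))) := by
  obtain ⟨l, hl, h⟩ := h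
  refine ⟨l.map f, ?_, ?_⟩
  · intro v hv
    obtain ⟨w, hw, rfl⟩ := List.mem_map.1 hv
    exact hf _ (hl w hw)
  · intro β; simp [h, Function.comp_def]

lemma Rep.mono {P Q Φ} (h : Rep P Φ) (hf : ∀ v, P v → Q v) : Rep Q Φ := h.comp id hf

lemma Rep.map_add {P Φ} (h : Rep P Φ) (β γ) : Φ (fun v => β v + γ v) = Φ β + Φ γ := by
  obtain ⟨l, hl, h⟩ := h
  simp only [h]
  exact List.sum_map_add

lemma Rep.congr {P Φ} (h : Rep P Φ) {β γ} (hb : ∀ v, P v → β v = γ v) : Φ β = Φ γ := by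
  obtain ⟨l, hl, h⟩ := h
  simp only [h]
  congr 1
  exact List.map_congr_left fun v hv => hb v (hl v hv)

lemma Rep.finset {P Φ} (h : Rep P Φ) : ∃ H : Finset (ℕ → ℤ), (∀ v ∈ H, P v) ∧
    ∀ β, Φ β = ∑ v ∈ H, β v := by
  classical
  obtain ⟨l, hl, h⟩ := h
  refine ⟨l.toFinset.filter (fun v => Odd (l.count v)), ?_, ?_⟩
  · intro v hv
    exact hl v (by simpa using (mem_filter.1 hv).1)
  · intro β
    rw [h, Finset.sum_list_map_count, sum_filter]
    refine sum_congr rfl fun v _ => ?_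
    split_ifs with h1
    · rw [nsmul_eq_mul, (ZMod.natCast_eq_one_iff_odd).2 h1, one_mul]
    · rw [nsmul_eq_mul, (ZMod.natCast_eq_zero_iff_even).2 (Nat.not_odd_iff_even.1 h1), zero_mul]

def PC (M d : ℕ) (v : ℕ → ℤ) : Prop := (∀ a, d ≤ a → v a = 0) ∧ ∀ a, |v a| ≤ 2 * M
def PB (M d : ℕ) (v : ℕ → ℤ) : Prop := PC M d v ∧ ∃ a, a < d ∧ |v a| = 2 * M

lemma PC.update {M d : ℕ} {v} (h : PC M d v) (z : ℤ) (hz : |z| ≤ 2 * M) :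
    PC M (d + 1) (update v d z) := by
  refine ⟨fun a ha => ?_, fun a => ?_⟩
  · rw [update_of_ne (by omega)]; exact h.1 a (by omega)
  · by_cases hd : a = d
    · subst hd; simpa using hz
    · rw [update_of_ne hd]; exact h.2 a

lemma PB.update {M d : ℕ} {v} (h : PB M d v) (z : ℤ) (hz : |z| ≤ 2 * M) :
    PB M (d + 1) (update v d z) := by
  refine ⟨h.1.update z hz, ?_⟩
  obtain ⟨a, ha, h⟩ := h.2
  exact ⟨a, by omega, by rw [update_of_ne (by omega)]; exact h⟩

lemma PC.update' {M d : ℕ} {v} (h : PC M d v) (z : ℤ) (hz : |z| = 2 * M) :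
    PB M (d + 1) (Function.update v d z) :=
  ⟨h.update z hz.le, d, by omega, by simpa using hz⟩

lemma abs1 {M p : ℕ} (h : p < M) : |(2 * p + 1 : ℤ)| ≤ 2 * M := by rw [abs_le]; omega
lemma abs2 {M p : ℕ} (h : p < M) : |(-(2 * p + 1) : ℤ)| ≤ 2 * M := by rw [abs_le]; omega

lemma cubeF_rep (M d : ℕ) : Rep (PC M d) (cubeF M d) := by
  induction d with
  | zero => exact ⟨[0], by simp [PC], by simp [cubeF]⟩
  | succ d ih =>
    refine Rep.sum M fun p hp => ?_
    exact (ih.comp (fun v => update v d _) fun v hv => hv.update _ (abs1 hp)).add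
      (ih.comp (fun v => update v d _) fun v hv => hv.update _ (abs2 hp))

lemma bdF_rep (M d : ℕ) : Rep (PB M d) (bdF M d) := by
  induction d with
  | zero => exact Rep.zero _
  | succ d ih =>
    refine Rep.add (Rep.add ?_ ?_) (Rep.sum M fun p hp => ?_)
    · exact (cubeF_rep M d).comp (fun v => update v d _) fun v hv => hv.update' _ (by simp)
    · exact (cubeF_rep M d).comp (fun v => update v d _) fun v hv => hv.update' _ (by simp)
    · exact (ih.comp (fun v => update v d _) fun v hv => hv.update _ (abs1 hp)).add
        (ih.comp (fun v => update v d _) fun v hv => hv.update _ (abs2 hp))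

lemma hF_rep (M d : ℕ) : Rep (PB M (d + 1)) (hF M d) := by
  refine Rep.add ?_ (Rep.sum M fun p hp => ?_)
  · exact (cubeF_rep M d).comp (fun v => update v d _) fun v hv => hv.update' _ (by simp)
  · exact ((bdF_rep M d).comp (fun v => update v d _) fun v hv => hv.update _ (abs1 hp))

lemma dl_update_ne {x d : ℕ} (h : x ≠ d) (β) (v : ℕ → ℤ) (z : ℤ) :
    dl x β (update v d z) = dl x (fun w => β (update w d z)) v := by
  unfold dl
  rw [update_of_ne h, update_comm h.symm, update_comm h.symm]

lemma dlt_succ_odd (d : ℕ) (β) (v : ℕ → ℤ) (z : ℤ) (hz : Odd z) :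
    dlt (d + 1) β (update v d z) = dlt d (fun w => β (update w d z)) v +
      (β (update v d (z + 1)) + β (update v d (z - 1))) := by
  unfold dlt
  rw [sum_range_succ]
  congr 1
  · refine sum_congr rfl fun x hx => dl_update_ne (by have := mem_range.1 hx; omega) _ _ _
  · simp [dl, hz]

lemma dlt_succ_even (d : ℕ) (β) (v : ℕ → ℤ) (z : ℤ) (hz : ¬ Odd z) :
    dlt (d + 1) β (update v d z) = dlt d (fun w => β (update w d z)) v := by
  unfold dlt
  rw [sum_range_succ]
  rw [sum_congr rfl fun x hx => dl_update_ne (by have := mem_range.1 hx; omega) _ _ _]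
  simp [dl, hz]

lemma tele (M : ℕ) (g : ℤ → ZMod 2) :
    ∑ p ∈ range M, (g (2 * p + 1 + 1) + g (2 * p + 1 - 1)) = g (2 * M) + g 0 := by
  induction M with
  | zero => simp [CharTwo.add_self_eq_zero]
  | succ M ih =>
    rw [sum_range_succ, ih]
    have e1 : (2 * (M : ℤ) + 1 + 1) = 2 * ((M + 1 : ℕ) : ℤ) := by push_cast; ring
    have e2 : (2 * (M : ℤ) + 1 - 1) = 2 * M := by ring
    rw [e1, e2]
    linear_combination CharTwo.add_self_eq_zero (g (2 * M))

lemma tele' (M : ℕ) (g : ℤ → ZMod 2) :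
    ∑ p ∈ range M, (g (-(2 * p + 1) + 1) + g (-(2 * p + 1) - 1)) = g (-(2 * M)) + g 0 := by
  rw [← neg_zero]
  rw [neg_zero]
  have := tele M (fun z => g (-z))
  simp only [neg_zero] at this
  rw [← this]
  refine sum_congr rfl fun p _ => ?_
  rw [add_comm]; congr 2 <;> ring_nf

lemma odd1 (p : ℕ) : Odd (2 * (p : ℤ) + 1) := ⟨p, rfl⟩
lemma odd2 (p : ℕ) : Odd (-(2 * (p : ℤ) + 1)) := (odd1 p).neg
lemma even1 (M : ℕ) : ¬ Odd (2 * (M : ℤ)) := by simp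
lemma even2 (M : ℕ) : ¬ Odd (-(2 * (M : ℤ))) := by simp

lemma cubeF_dlt (M d : ℕ) (β) : cubeF M d (dlt d β) = bdF M d β := by
  induction d generalizing β with
  | zero => simp [cubeF, bdF, dlt]
  | succ d ih =>
    have hA := (cubeF_rep M d).map_add
    simp only [cubeF, bdF, dlt_succ_odd _ _ _ _ (odd1 _), dlt_succ_odd _ _ _ _ (odd2 _)]
    simp only [hA, ih]
    have t1 := tele M (fun z => cubeF M d fun v => β (update v d z))
    have t2 := tele' M (fun z => cubeF M d fun v => β (update v d z))
    simp only [sum_add_distrib] at t1 t2 ⊢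
    linear_combination t1 + t2 +
      CharTwo.add_self_eq_zero (cubeF M d fun v => β (update v d 0))

lemma bdF_dlt (M d : ℕ) (β) : bdF M d (dlt d β) = 0 := by
  induction d generalizing β with
  | zero => simp [bdF]
  | succ d ih =>
    have hA := (bdF_rep M d).map_add
    simp only [bdF, dlt_succ_odd _ _ _ _ (odd1 _), dlt_succ_odd _ _ _ _ (odd2 _),
      dlt_succ_even _ _ _ _ (even1 _), dlt_succ_even _ _ _ _ (even2 _)]
    simp only [hA, ih, cubeF_dlt]
    have t1 := tele M (fun z => bdF M d fun v => β (update v d z))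
    have t2 := tele' M (fun z => bdF M d fun v => β (update v d z))
    simp only [sum_add_distrib, sum_const_zero] at t1 t2 ⊢
    linear_combination t1 + t2 +
      CharTwo.add_self_eq_zero (bdF M d fun v => β (update v d 0)) +
      CharTwo.add_self_eq_zero (bdF M d fun v => β (update v d (2 * M))) +
      CharTwo.add_self_eq_zero (bdF M d fun v => β (update v d (-(2 * M))))

lemma hF_dlt (M d : ℕ) (β) : hF M d (dlt (d + 1) β) = bdF M d β := by
  have hA := (bdF_rep M d).map_add
  simp only [hF, dlt_succ_odd _ _ _ _ (odd1 _), dlt_succ_even _ _ _ _ (even1 _)]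
  simp only [hA, bdF_dlt, cubeF_dlt]
  have t1 := tele M (fun z => bdF M d fun v => β (update v d z))
  have e : bdF M d β = bdF M d fun v => β (update v d 0) := by
    refine (bdF_rep M d).congr fun v hv => ?_
    rw [← hv.1.1 d le_rfl, update_eq_self]
  simp only [sum_add_distrib, sum_const_zero] at t1 ⊢
  rw [e]
  linear_combination t1 + 
      CharTwo.add_self_eq_zero (bdF M d fun v => β (update v d (2 * M)))

lemma neg_update (v : ℕ → ℤ) (d : ℕ) (z : ℤ) : -(update v d z) = update (-v) d (-z) := by
  ext a; by_cases h : a = d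
  · subst h; simp
  · simp [update_of_ne h]

lemma cubeF_neg (M d : ℕ) (β) : cubeF M d (fun v => β (-v)) = cubeF M d β := by
  induction d generalizing β with
  | zero => simp [cubeF]
  | succ d ih =>
    simp only [cubeF, neg_update, neg_neg]
    refine sum_congr rfl fun p _ => ?_
    rw [ih (fun v => β (update v d _)), ih (fun v => β (update v d _)), add_comm]

lemma bdF_neg (M d : ℕ) (β) : bdF M d (fun v => β (-v)) = bdF M d β := by
  induction d generalizing β with
  | zero => simp [bdF]
  | succ d ih =>
    simp only [bdF, neg_update, neg_neg]
    congr 1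
    · rw [cubeF_neg M d (fun v => β (update v d _)), cubeF_neg M d (fun v => β (update v d _)),
        add_comm]
    refine sum_congr rfl fun p _ => ?_
    rw [ih (fun v => β (update v d _)), ih (fun v => β (update v d _)), add_comm]

lemma bdF_succ (M d : ℕ) (β) : bdF M (d + 1) β = hF M d β + hF M d (fun v => β (-v)) := by
  simp only [bdF, hF, neg_update]
  rw [cubeF_neg M d (fun v => β (update v d _)), 
    sum_congr rfl fun p _ => bdF_neg M d (fun v => β (update v d _))]
  rw [sum_add_distrib]; ring

/-- The half-sphere chains. -/
lemma exists_half (M m : ℕ) : ∃ H : ℕ → Finset (ℕ → ℤ),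
    (∀ d, ∀ v ∈ H d, PB M (d + 1) v) ∧
    (∀ d, d < m → ∀ β, ∑ v ∈ H (d + 1), dlt (m + 1) β v = ∑ v ∈ H d, (β v + β (-v))) ∧
    (∀ β, ∑ v ∈ H 0, dlt (m + 1) β v = 0) ∧ ((H 0).card : ZMod 2) = 1 := by
  choose H hH hs using fun d => (hF_rep M d).finset
  have key : ∀ d, d ≤ m → ∀ β, ∀ v ∈ H d, dlt (m + 1) β v = dlt (d + 1) β v := by
    intro d hd β v hv
    unfold dlt
    symm
    refine sum_subset (fun x hx => ?_) fun x _ hx => ?_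
    · simp only [mem_range] at *; omega
    · have : v x = 0 := (hH d v hv).1.1 x (by simp only [mem_range] at hx; omega)
      simp [dl, this]
  refine ⟨H, hH, fun d hd β => ?_, fun β => ?_, ?_⟩
  · rw [sum_congr rfl (key (d + 1) hd β), ← hs, hF_dlt, bdF_succ, hs, hs, sum_add_distrib]
  · rw [sum_congr rfl (key 0 (Nat.zero_le _) β), ← hs, hF_dlt]; rfl
  · have := hs 0 (fun _ => 1)
    simpa [hF, bdF, cubeF] using this.symm

end HTC
namespace HTC

abbrev Cell (n : ℕ) := Fin n → ℕ → ℤ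

def D {n : ℕ} (m : ℕ) (b : Cell n → ZMod 2) (v : Cell n) : ZMod 2 :=
  ∑ i, dlt (m + 1) (fun w => b (update v i w)) (v i)

def dx {n : ℕ} (y : Fin n × ℕ) (b : Cell n → ZMod 2) (v : Cell n) : ZMod 2 :=
  dl y.2 (fun w => b (update v y.1 w)) (v y.1)

def setc {n : ℕ} (y : Fin n × ℕ) (v : Cell n) (z : ℤ) : Cell n :=
  update v y.1 (update (v y.1) y.2 z)

lemma setc_self {n : ℕ} (y : Fin n × ℕ) (v : Cell n) (z : ℤ) : setc y v z y.1 y.2 = z := by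
  simp [setc]

lemma setc_ne {n : ℕ} {y y' : Fin n × ℕ} (h : y' ≠ y) (v : Cell n) (z : ℤ) :
    setc y v z y'.1 y'.2 = v y'.1 y'.2 := by
  obtain ⟨i, x⟩ := y
  obtain ⟨i', x'⟩ := y'
  simp only [setc]
  by_cases hi : i' = i
  · subst hi
    have : x' ≠ x := fun e => h (by rw [e])
    simp [update_of_ne this]
  · rw [update_of_ne hi]

lemma setc_comm {n : ℕ} {y y' : Fin n × ℕ} (h : y' ≠ y) (v : Cell n) (z z' : ℤ) :
    setc y (setc y' v z') z = setc y' (setc y v z) z' := by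
  ext i x
  by_cases h1 : (i, x) = y
  · subst h1
    have := setc_ne h.symm (setc (i, x) v z) z'
    simp only at this
    rw [this]
    rw [setc_self (i, x), setc_self (i, x)]
  · have e := setc_ne h1 (setc y' v z') z
    simp only at e
    rw [e]
    by_cases h2 : (i, x) = y'
    · subst h2
      rw [setc_self (i, x), setc_self (i, x)]
    · have e1 := setc_ne h2 v z'
      have e2 := setc_ne h2 (setc y v z) z'
      have e3 := setc_ne h1 v z
      simp only at e1 e2 e3
      rw [e1, e2, e3]

lemma dx_eq {n : ℕ} (y : Fin n × ℕ) (b : Cell n → ZMod 2) (v : Cell n) :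
    dx y b v = if Odd (v y.1 y.2) then b (setc y v (v y.1 y.2 + 1)) + b (setc y v (v y.1 y.2 - 1))
      else 0 := rfl

lemma D_eq {n : ℕ} (m : ℕ) (b : Cell n → ZMod 2) (v : Cell n) :
    D m b v = ∑ y ∈ (univ : Finset (Fin n)) ×ˢ range (m + 1), dx y b v := by
  rw [sum_product]; rfl

lemma dx_dx {n : ℕ} (y : Fin n × ℕ) (b : Cell n → ZMod 2) (v : Cell n) : dx y (dx y b) v = 0 := by
  rw [dx_eq]
  split_ifs with h
  · have h1 : ¬ Odd (v y.1 y.2 + 1) := by rw [Int.not_odd_iff_even]; exact h.add_one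
    have h2 : ¬ Odd (v y.1 y.2 - 1) := by rw [Int.not_odd_iff_even]; exact h.sub_odd odd_one
    rw [dx_eq, dx_eq, setc_self, setc_self, if_neg h1, if_neg h2, add_zero]
  · rfl

lemma dx_comm {n : ℕ} {y y' : Fin n × ℕ} (h : y' ≠ y) (b : Cell n → ZMod 2) (v : Cell n) :
    dx y (dx y' b) v = dx y' (dx y b) v := by
  simp only [dx_eq, setc_ne h, setc_ne h.symm, setc_comm h]
  split_ifs <;> ring

lemma dx_sum {n : ℕ} (y : Fin n × ℕ) (s : Finset (Fin n × ℕ)) (b : Fin n × ℕ → Cell n → ZMod 2)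
    (v : Cell n) : dx y (fun u => ∑ y' ∈ s, b y' u) v = ∑ y' ∈ s, dx y (b y') v := by
  simp only [dx_eq]
  split_ifs
  · rw [sum_add_distrib]
  · simp

lemma D_D {n : ℕ} (m : ℕ) (b : Cell n → ZMod 2) (v : Cell n) : D m (D m b) v = 0 := by
  classical
  have e : D m b = fun u => ∑ y ∈ (univ : Finset (Fin n)) ×ˢ range (m + 1), dx y b u := by
    funext u; exact D_eq m b u
  rw [D_eq, e]
  simp only [dx_sum]
  rw [← sum_product']
  refine sum_involution (fun p _ => (p.2, p.1)) ?_ ?_ ?_ ?_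
  · rintro ⟨y, y'⟩ _
    by_cases h : y' = y
    · subst h; simp only [dx_dx, add_zero]
    · simp only; rw [dx_comm h]; exact CharTwo.add_self_eq_zero _
  · rintro ⟨y, y'⟩ _ hne heq
    simp only [Prod.mk.injEq] at heq
    apply hne
    simp only
    rw [heq.1, dx_dx]
  · rintro ⟨y, y'⟩ h
    simp only [mem_product] at h ⊢
    exact ⟨h.2, h.1⟩
  · rintro ⟨y, y'⟩ _; rfl

def W {n : ℕ} (m : ℕ) (eps : ℕ → Cell n → ZMod 2) : ℕ → Cell n → ZMod 2
  | 0 => fun _ => 1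
  | j + 1 => D m (fun u => W m eps j u * eps j u)

lemma dx_const {n : ℕ} (y : Fin n × ℕ) (c : ZMod 2) (v : Cell n) : dx y (fun _ => c) v = 0 := by
  rw [dx_eq]; split_ifs
  · exact CharTwo.add_self_eq_zero _
  · rfl

lemma D_W {n : ℕ} (m : ℕ) (eps : ℕ → Cell n → ZMod 2) (j : ℕ) (v : Cell n) :
    D m (W m eps j) v = 0 := by
  cases j with
  | zero => 
    rw [D_eq]
    exact sum_eq_zero fun y _ => dx_const y 1 v
  | succ j => exact D_D _ _ _

/-- faces -/
def Fc {n : ℕ} (v u : Cell n) : Prop :=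
  ∀ i x, u i x = v i x ∨ (¬ Odd (u i x) ∧ |u i x - v i x| ≤ 1)

lemma Fc.refl {n : ℕ} (v : Cell n) : Fc v v := fun _ _ => Or.inl rfl

lemma Fc.step {n : ℕ} {v u : Cell n} (h : Fc v u) (y : Fin n × ℕ) (ho : Odd (u y.1 y.2)) (z : ℤ)
    (hz : z = u y.1 y.2 + 1 ∨ z = u y.1 y.2 - 1) : Fc v (setc y u z) := by
  intro i x
  by_cases hy : (i, x) = y
  · subst hy
    right
    rw [setc_self (i, x)]
    have e : u i x = v i x := by
      rcases h i x with h | h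
      · exact h
      · exact absurd ho h.1
    simp only at ho hz
    constructor
    · rw [Int.not_odd_iff_even]
      rcases hz with rfl | rfl
      · exact ho.add_one
      · exact ho.sub_odd odd_one
    · rw [abs_le]; omega
  · have e1 := setc_ne hy u z
    simp only at e1
    rw [e1]; exact h i x

lemma D_congr {n : ℕ} (m : ℕ) {b b' : Cell n → ZMod 2} {v u : Cell n} (h : Fc v u)
    (hb : ∀ w, Fc v w → b w = b' w) : D m b u = D m b' u := by
  rw [D_eq, D_eq]
  refine sum_congr rfl fun y _ => ?_
  rw [dx_eq, dx_eq]
  split_ifs with ho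
  · rw [hb _ (h.step y ho _ (Or.inl rfl)), hb _ (h.step y ho _ (Or.inr rfl))]
  · rfl

lemma D_mul_const {n : ℕ} (m : ℕ) (b : Cell n → ZMod 2) (c : ZMod 2) (v : Cell n) :
    D m (fun u => b u * c) v = D m b v * c := by
  rw [D_eq, D_eq, sum_mul]
  refine sum_congr rfl fun y _ => ?_
  rw [dx_eq, dx_eq]
  split_ifs <;> ring

lemma D_add {n : ℕ} (m : ℕ) (b b' : Cell n → ZMod 2) (v : Cell n) :
    D m (fun u => b u + b' u) v = D m b v + D m b' v := by
  rw [D_eq, D_eq, D_eq, ← sum_add_distrib]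
  refine sum_congr rfl fun y _ => ?_
  rw [dx_eq, dx_eq, dx_eq]
  split_ifs <;> ring

lemma W_vanish {n : ℕ} (m : ℕ) (eps : ℕ → Cell n → ZMod 2) (j : ℕ) (v : Cell n) (c : ZMod 2)
    (hc : ∀ u, Fc v u → eps j u = c) (k : ℕ) : ∀ u, Fc v u → W m eps (j + 1 + k) u = 0 := by
  induction k with
  | zero =>
    intro u hu
    have : D m (fun u => W m eps j u * eps j u) u = D m (fun u => W m eps j u * c) u :=
      D_congr m hu fun w hw => by rw [hc w hw]
    change D m (fun u => W m eps j u * eps j u) u = 0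
    rw [this, D_mul_const, D_W, zero_mul]
  | succ k ih =>
    intro u hu
    change D m (fun u => W m eps (j + 1 + k) u * eps (j + 1 + k) u) u = 0
    have : D m (fun u => W m eps (j + 1 + k) u * eps (j + 1 + k) u) u = D m (fun u => (1 : ZMod 2) * 0) u :=
      D_congr m hu fun w hw => by rw [ih w hw]; simp
    rw [this, D_mul_const, mul_zero]

def Valid {n : ℕ} (M : ℕ) (v : Cell n) : Prop := ∀ i, ∃ a, |v i a| = 2 * M

lemma Valid.face {n M : ℕ} {u : Cell n} (h : Valid M u) (y : Fin n × ℕ) (ho : Odd (u y.1 y.2))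
    (z : ℤ) : Valid M (setc y u z) := by
  intro i
  obtain ⟨a, ha⟩ := h i
  refine ⟨a, ?_⟩
  have hy : (i, a) ≠ y := by
    rintro rfl
    simp only at ho
    rw [← Int.natAbs_odd] at ho
    rw [Int.abs_eq_natAbs] at ha
    rw [← Nat.not_even_iff_odd] at ho
    exact ho ⟨M, by omega⟩
  have e1 := setc_ne hy u z
  simp only at e1
  rw [e1, ha]

def negc {n : ℕ} (i : Fin n) (v : Cell n) : Cell n := update v i (-(v i))

lemma Valid.neg {n M : ℕ} {v : Cell n} (h : Valid M v) (i : Fin n) : Valid M (negc i v) := by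
  intro i'
  obtain ⟨a, ha⟩ := h i'
  refine ⟨a, ?_⟩
  by_cases hi : i' = i
  · subst hi; simp [negc, ha]
  · simp [negc, update_of_ne hi, ha]

lemma negc_setc {n : ℕ} (i : Fin n) (y : Fin n × ℕ) (v : Cell n) (z : ℤ) :
    negc i (setc y v z) = setc y (negc i v) (if y.1 = i then -z else z) := by
  obtain ⟨i', x⟩ := y
  simp only [negc, setc]
  by_cases h : i' = i
  · subst h
    simp [neg_update]
  · rw [if_neg h, update_of_ne h, update_of_ne (Ne.symm h), update_comm h]

lemma D_neg {n : ℕ} (m : ℕ) (b : Cell n → ZMod 2) (i : Fin n) (v : Cell n) :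
    D m b (negc i v) = D m (fun u => b (negc i u)) v := by
  rw [D_eq, D_eq]
  refine sum_congr rfl fun y _ => ?_
  rw [dx_eq, dx_eq, negc_setc, negc_setc]
  by_cases h : y.1 = i
  · have e : negc i v y.1 y.2 = - v y.1 y.2 := by subst h; simp [negc]
    rw [e, if_pos h, if_pos h]
    simp only [odd_neg]
    split_ifs
    · rw [add_comm]; congr 3 <;> ring
    · rfl
  · have e : negc i v y.1 y.2 = v y.1 y.2 := by simp [negc, update_of_ne h]
    rw [e, if_neg h, if_neg h]

lemma D_congr' {n : ℕ} (m M : ℕ) {b b' : Cell n → ZMod 2} {u : Cell n} (h : Valid M u)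
    (hb : ∀ w, Valid M w → b w = b' w) : D m b u = D m b' u := by
  rw [D_eq, D_eq]
  refine sum_congr rfl fun y _ => ?_
  rw [dx_eq, dx_eq]
  split_ifs with ho
  · rw [hb _ (h.face y ho _), hb _ (h.face y ho _)]
  · rfl

lemma W_neg {n : ℕ} (m M : ℕ) (eps : ℕ → Cell n → ZMod 2) (chi : ℕ → Fin n → ZMod 2)
    (heq : ∀ j i v, Valid M v → eps j (negc i v) = eps j v + chi j i) (j : ℕ) (i : Fin n) :
    ∀ v, Valid M v → W m eps j (negc i v) = W m eps j v := by
  induction j with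
  | zero => intro v _; rfl
  | succ j ih =>
    intro v hv
    change D m _ _ = D m _ _
    rw [D_neg]
    rw [D_congr' m M (b' := fun u => W m eps j u * eps j u + W m eps j u * chi j i) hv]
    · rw [D_add, D_mul_const, D_W, zero_mul, add_zero]
    · intro w hw
      rw [ih w hw, heq j i w hw, mul_add]

lemma sum_pi_split {n : ℕ} (s : Fin n → Finset (ℕ → ℤ)) (i : Fin n) (f : Cell n → ZMod 2) :
    ∑ v ∈ Fintype.piFinset s, f v =
      ∑ w ∈ Fintype.piFinset (update s i {0}), ∑ x ∈ s i, f (update w i x) := by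
  rw [← sum_product' (f := fun w x => f (update w i x))]
  refine sum_nbij' (fun v => (update v i 0, v i)) (fun p => update p.1 i p.2) ?_ ?_ ?_ ?_ ?_
  · intro v hv
    rw [Fintype.mem_piFinset] at hv
    rw [mem_product, Fintype.mem_piFinset]
    refine ⟨fun a => ?_, hv i⟩
    by_cases h : a = i
    · subst h; simp
    · simp [update_of_ne h, hv a]
  · rintro ⟨w, x⟩ h
    rw [mem_product, Fintype.mem_piFinset] at h
    rw [Fintype.mem_piFinset]
    intro a
    by_cases ha : a = i
    · subst ha; simpa using h.2
    · have := h.1 a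
      rw [update_of_ne ha] at this
      simpa [update_of_ne ha] using this
  · intro v _; simp
  · rintro ⟨w, x⟩ h
    rw [mem_product, Fintype.mem_piFinset] at h
    have := h.1 i
    simp only [update_self, mem_singleton] at this
    simp [← this]
  · intro v _; simp

def T {n : ℕ} (m : ℕ) (H : ℕ → Finset (ℕ → ℤ)) (eps : ℕ → Cell n → ZMod 2) (d : Fin n → ℕ) (N : ℕ) :
    ZMod 2 := ∑ v ∈ Fintype.piFinset (fun i => H (d i)), W m eps N v

lemma T_step {n : ℕ} (m M : ℕ) (H : ℕ → Finset (ℕ → ℤ)) (eps : ℕ → Cell n → ZMod 2)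
    (chi : ℕ → Fin n → ZMod 2)
    (h1 : ∀ d, ∀ v ∈ H d, PB M (d + 1) v) 
    (h2 : ∀ d, d < m → ∀ β, ∑ v ∈ H (d + 1), dlt (m + 1) β v = ∑ v ∈ H d, (β v + β (-v)))
    (h3 : ∀ β, ∑ v ∈ H 0, dlt (m + 1) β v = 0)
    (heq : ∀ j i v, Valid M v → eps j (negc i v) = eps j v + chi j i)
    (d : Fin n → ℕ) (hd : ∀ i, d i ≤ m) (N : ℕ) :
    T m H eps d (N + 1) = ∑ i, if d i = 0 then 0 else chi N i * T m H eps (update d i (d i - 1)) N := by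
  unfold T
  change ∑ v ∈ _, D m (fun u => W m eps N u * eps N u) v = _
  unfold D
  rw [sum_comm]
  refine sum_congr rfl fun i _ => ?_
  rw [sum_pi_split _ i]
  simp only [update_idem, update_self]
  split_ifs with h0
  · rw [h0]
    refine sum_eq_zero fun w _ => h3 (fun x => W m eps N (update w i x) * eps N (update w i x)) 
  · obtain ⟨e, he⟩ := Nat.exists_eq_succ_of_ne_zero h0
    have hem : e < m := by have := hd i; omega
    rw [he]
    simp only [Nat.succ_eq_add_one, Nat.add_sub_cancel]
    rw [sum_congr rfl fun w _ => h2 e hem (fun x => W m eps N (update w i x) * eps N (update w i x))]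
    rw [mul_sum, sum_pi_split (fun a => H (update d i e a)) i]
    have hs : (update (fun a => H (update d i e a)) i {0}) = update (fun a => H (d a)) i {0} := by
      funext a
      by_cases ha : a = i
      · subst ha; simp
      · simp [update_of_ne ha]
    rw [hs]
    simp only [update_self]
    refine sum_congr rfl fun w hw => sum_congr rfl fun x hx => ?_
    have hv : Valid M (update w i x) := by
      intro a
      by_cases ha : a = i
      · subst ha
        obtain ⟨c, _, hc⟩ := (h1 e x hx).2
        exact ⟨c, by simpa using hc⟩
      · rw [Fintype.mem_piFinset] at hw
        have := hw a
        rw [update_of_ne ha] at this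
        obtain ⟨c, _, hc⟩ := (h1 _ _ this).2
        exact ⟨c, by simpa [update_of_ne ha] using hc⟩
    have hn : update w i (-x) = negc i (update w i x) := by simp [negc]
    rw [hn, W_neg m M eps chi heq N i _ hv, heq N i _ hv]
    linear_combination CharTwo.add_self_eq_zero (W m eps N (update w i x) * eps N (update w i x))

lemma T_zero {n : ℕ} (m : ℕ) (H : ℕ → Finset (ℕ → ℤ)) (eps : ℕ → Cell n → ZMod 2)
    (h4 : ((H 0).card : ZMod 2) = 1) : T m H eps (fun _ : Fin n => 0) 0 = 1 := by
  simp [T, W, h4, Fintype.card_piFinset]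

end HTC
namespace HTC

def idx (q j : ℕ) : ℕ := (j + 1 - q) / q

def cnt (q N i : ℕ) : ℕ := ((range N).filter (fun j => idx q j = i)).card

lemma cnt_succ (q N i : ℕ) : cnt q (N + 1) i = cnt q N i + if idx q N = i then 1 else 0 := by
  unfold cnt
  rw [range_add_one, filter_insert]
  split_ifs with h
  · rw [card_insert_of_notMem (by simp)]
  · rfl

lemma cnt_base (q i : ℕ) (hq : 0 < q) (hi : 0 < i) : cnt q (2 * q - 1) i = 0 := by
  unfold cnt
  rw [card_eq_zero, filter_eq_empty_iff]
  intro j hj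
  rw [mem_range] at hj
  unfold idx
  rw [Nat.div_eq_of_lt (by omega)]
  omega

lemma cnt_top (q n i : ℕ) (hq : 0 < q) (hi : i + 2 ≤ n) : cnt q (n * q - 1) i ≥ q ∧ (0 < i → cnt q (n * q - 1) i = q) := by
  have hmul : (i + 2) * q ≤ n * q := Nat.mul_le_mul_right _ hi
  have e1 : (i + 2) * q = i * q + 2 * q := by ring
  have hidx : ∀ j, q ≤ j + 1 → (idx q j = i ↔ i * q + q ≤ j + 1 ∧ j + 1 < i * q + 2 * q) := by
    intro j hj
    unfold idx
    rw [Nat.div_eq_iff hq]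
    omega
  have hsub : Ico (i * q + q - 1) (i * q + 2 * q - 1) ⊆ (range (n * q - 1)).filter (fun j => idx q j = i) := by
    intro j hj
    rw [mem_Ico] at hj
    rw [mem_filter, mem_range]
    refine ⟨by omega, ?_⟩
    rw [hidx j (by omega)]
    omega
  refine ⟨?_, fun hi0 => ?_⟩
  · have := card_le_card hsub
    rw [Nat.card_Ico] at this
    unfold cnt; omega
  · unfold cnt
    have : (range (n * q - 1)).filter (fun j => idx q j = i) = Ico (i * q + q - 1) (i * q + 2 * q - 1) := by
      refine Subset.antisymm (fun j hj => ?_) hsub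
      rw [mem_filter, mem_range] at hj
      rw [mem_Ico]
      have hj1 : q ≤ j + 1 := by
        by_contra hlt
        have : idx q j = 0 := by
          unfold idx; rw [Nat.div_eq_of_lt (by omega)]
        omega
      have := (hidx j hj1).1 hj.2
      omega
    rw [this, Nat.card_Ico]; omega

def chi (n q N : ℕ) (i : Fin n) : ZMod 2 :=
  if N = n * q - 1 then (if i.val + 1 = n then 1 else 0)
  else if i.val = idx q N ∨ i.val + 1 = n then 1 else 0

lemma idx_lt (n q N : ℕ) (hq : 0 < q) (hn : 2 ≤ n) (hN : N + 1 < n * q) : idx q N + 2 ≤ n := by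
  unfold idx
  obtain ⟨k, rfl⟩ := Nat.exists_eq_add_of_le hn
  have : (N + 1 - q) / q < 1 + k := by
    rw [Nat.div_lt_iff_lt_mul hq]
    have : (2 + k) * q = (1 + k) * q + q := by ring
    have : 0 < (1 + k) * q := by positivity
    omega
  omega

lemma sum_update {n : ℕ} (d : Fin n → ℕ) (i : Fin n) (h : d i ≠ 0) (N : ℕ) (hs : ∑ j, d j = N + 1) :
    ∑ j, update d i (d i - 1) j = N := by
  rw [← add_sum_erase univ _ (mem_univ i)] at hs ⊢
  rw [update_self]
  have : ∑ x ∈ univ.erase i, update d i (d i - 1) x = ∑ x ∈ univ.erase i, d x := 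
    sum_congr rfl fun x hx => by rw [update_of_ne (ne_of_mem_erase hx)]
  omega

section
variable {n q : ℕ} (Tf : (Fin n → ℕ) → ℕ → ZMod 2) 

lemma Tf_two (hq : 0 < q) (hn : 2 ≤ n) 
  (hstep : ∀ d : Fin n → ℕ, (∀ i, d i ≤ q) → ∀ N, Tf d (N + 1) =
    ∑ i, if d i = 0 then 0 else chi n q N i * Tf (update d i (d i - 1)) N)
    (d : Fin n → ℕ) (hd : ∀ i, d i ≤ q) (N : ℕ) (hN : N + 1 < n * q) (z l : Fin n)
    (hz : z.val = idx q N) (hl : l.val + 1 = n) :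
    Tf d (N + 1) = (if d z = 0 then 0 else Tf (update d z (d z - 1)) N) + 
      (if d l = 0 then 0 else Tf (update d l (d l - 1)) N) := by
  have hi := idx_lt n q N hq hn hN
  have hne : z ≠ l := by rintro rfl; omega
  rw [hstep d hd, ← add_sum_erase univ _ (mem_univ z), ← add_sum_erase (univ.erase z) _ (mem_erase.2 ⟨hne.symm, mem_univ l⟩)]
  rw [sum_eq_zero (s := (univ.erase z).erase l), add_zero]
  · have e1 : chi n q N z = 1 := by
      unfold chi; rw [if_neg (by omega), if_pos (Or.inl hz)]
    have e2 : chi n q N l = 1 := by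
      unfold chi; rw [if_neg (by omega), if_pos (Or.inr hl)]
    rw [e1, e2, one_mul, one_mul]
  · intro x hx
    rw [mem_erase, mem_erase] at hx
    have e1 : chi n q N x = 0 := by
      unfold chi
      rw [if_neg (by omega), if_neg]
      rintro (h | h)
      · exact hx.2.1 (Fin.ext (by omega))
      · exact hx.1 (Fin.ext (by omega))
    rw [e1, zero_mul, ite_self]

lemma upd_le {d : Fin n → ℕ} (hd : ∀ i, d i ≤ q) (j : Fin n) : ∀ i, update d j (d j - 1) i ≤ q := by
  intro i
  by_cases h : i = j
  · subst h; simp only [update_self]; have := hd i; omega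
  · rw [update_of_ne h]; exact hd i

lemma Tf_zero (hq : 0 < q) (hn : 2 ≤ n) 
  (hstep : ∀ d : Fin n → ℕ, (∀ i, d i ≤ q) → ∀ N, Tf d (N + 1) =
    ∑ i, if d i = 0 then 0 else chi n q N i * Tf (update d i (d i - 1)) N) (i : Fin n) (hi : i.val + 1 ≠ n)
    (N : ℕ) : ∀ (d : Fin n → ℕ) (_ : ∀ i, d i ≤ q) (_ : N < n * q) (_ : ∑ j, d j = N)
    (_ : cnt q N i < d i), Tf d N = 0 := by
  induction N with
  | zero =>
    intro d hd _ hs hc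
    have := Finset.sum_eq_zero_iff.1 hs i (mem_univ i)
    omega
  | succ N ih =>
    intro d hd hN hs hc
    have hx := idx_lt n q N hq hn hN
    rw [Tf_two Tf hq hn hstep d hd N hN ⟨idx q N, by omega⟩ ⟨n - 1, by omega⟩ rfl (by simp; omega)]
    rw [cnt_succ] at hc
    have key : ∀ x : Fin n, (x = i → idx q N = i) → (if d x = 0 then 0 else Tf (update d x (d x - 1)) N) = 0 := by
      intro x hxi
      split_ifs with h0
      · rfl
      · refine ih _ (upd_le hd x) (by omega) (sum_update d x h0 N hs) ?_
        by_cases h : i = x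
        · subst h
          rw [if_pos (hxi rfl)] at hc
          rw [update_self]; omega
        · rw [update_of_ne h]; omega
    rw [key, key, add_zero]
    · intro h; exfalso; apply hi; rw [← h]; simp; omega
    · intro h; rw [← h]

lemma Tf_pascal (hq : 0 < q) (hn : 2 ≤ n) 
  (hstep : ∀ d : Fin n → ℕ, (∀ i, d i ≤ q) → ∀ N, Tf d (N + 1) =
    ∑ i, if d i = 0 then 0 else chi n q N i * Tf (update d i (d i - 1)) N)
    (h0 : Tf (fun _ => 0) 0 = 1) (z l : Fin n) (hz : z.val = 0) (hl : l.val + 1 = n)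
    (N : ℕ) : ∀ (d : Fin n → ℕ) (_ : ∀ i, d i ≤ q) (_ : N < 2 * q) (_ : d z + d l = N)
    (_ : ∀ i, i ≠ z → i ≠ l → d i = 0), Tf d N = (N.choose (d z) : ZMod 2) := by
  have hzl : z ≠ l := by rintro rfl; omega
  induction N with
  | zero =>
    intro d hd _ hs hm
    have : d = fun _ => 0 := by
      funext i
      by_cases h1 : i = z
      · subst h1; omega
      by_cases h2 : i = l
      · subst h2; omega
      exact hm i h1 h2
    rw [this, h0]; simp
  | succ N ih =>
    intro d hd hN hs hm
    have h2q : 2 * q ≤ n * q := Nat.mul_le_mul_right _ hn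
    have hidx : idx q N = 0 := by unfold idx; exact Nat.div_eq_of_lt (by omega)
    rw [Tf_two Tf hq hn hstep d hd N (by omega) z l (by omega) hl]
    have ez : d z ≠ 0 → Tf (update d z (d z - 1)) N = (N.choose (d z - 1) : ZMod 2) := by
      intro hne
      rw [ih _ (upd_le hd z) (by omega) _ _, update_self]
      · rw [update_self, update_of_ne hzl.symm]; omega
      · intro i h1 h2; rw [update_of_ne h1]; exact hm i h1 h2
    have el : d l ≠ 0 → Tf (update d l (d l - 1)) N = (N.choose (d z) : ZMod 2) := by
      intro hne
      rw [ih _ (upd_le hd l) (by omega) _ _, update_of_ne hzl]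
      · rw [update_self, update_of_ne hzl]; omega
      · intro i h1 h2; rw [update_of_ne h2]; exact hm i h1 h2
    by_cases hz0 : d z = 0
    · rw [if_pos hz0, if_neg (by omega), el (by omega), hz0]; simp
    · rw [if_neg hz0, ez hz0]
      obtain ⟨a, ha⟩ := Nat.exists_eq_succ_of_ne_zero hz0
      by_cases hl0 : d l = 0
      · rw [if_pos hl0, ha]
        have : a = N := by omega
        subst this; simp
      · rw [if_neg hl0, el hl0, ha, Nat.choose_succ_succ]
        push_cast; simp

lemma Tf_mid (hq : 0 < q) (hn : 2 ≤ n) 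
  (hstep : ∀ d : Fin n → ℕ, (∀ i, d i ≤ q) → ∀ N, Tf d (N + 1) =
    ∑ i, if d i = 0 then 0 else chi n q N i * Tf (update d i (d i - 1)) N)
    (h0 : Tf (fun _ => 0) 0 = 1) (z l : Fin n) (hz : z.val = 0) (hl : l.val + 1 = n)
    (k : ℕ) : ∀ (d : Fin n → ℕ) (_ : ∀ i, d i ≤ q) (_ : 2 * q - 1 + k < n * q) (_ : ∑ j, d j = 2 * q - 1 + k)
    (_ : d z = q) (_ : d l = q - 1)
    (_ : ∀ i, i ≠ z → i ≠ l → d i = cnt q (2 * q - 1 + k) i), Tf d (2 * q - 1 + k) = ((2 * q - 1).choose q : ZMod 2) := by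
  have hzl : z ≠ l := by rintro rfl; omega
  induction k with
  | zero =>
    intro d hd hN hs h1 h2 hm
    rw [Tf_pascal Tf hq hn hstep h0 z l hz hl _ d hd (by omega) (by omega) _, h1]
    · rfl
    · intro i h3 h4
      rw [hm i h3 h4]
      exact cnt_base q i hq (by 
        rcases Nat.eq_zero_or_pos i.val with h | h
        · exact absurd (Fin.ext (by omega)) h3
        · exact h)
  | succ k ih =>
    intro d hd hN hs h1 h2 hm
    rw [← add_assoc] at *
    have hx := idx_lt n q (2 * q - 1 + k) hq hn hN
    have hpos : 0 < idx q (2 * q - 1 + k) := by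
      unfold idx
      exact Nat.div_pos (by omega) hq
    set x : Fin n := ⟨idx q (2 * q - 1 + k), by omega⟩ with hxdef
    have hxz : x ≠ z := by intro h; have := congrArg Fin.val h; simp only [hxdef] at this; omega
    have hxl : x ≠ l := by intro h; have := congrArg Fin.val h; simp only [hxdef] at this; omega
    rw [Tf_two Tf hq hn hstep d hd _ hN x l rfl hl]
    have hdx := hm x hxz hxl
    rw [cnt_succ, if_pos rfl] at hdx
    rw [if_neg (by omega), ih _ (upd_le hd x) (by omega) (sum_update d x (by omega) _ hs)]
    · rw [ite_eq_left_iff.2, add_zero]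
      intro hl0
      refine Tf_zero Tf hq hn hstep x (by simp only [hxdef]; omega) _ _ (upd_le hd l) (by omega) (sum_update d l hl0 _ hs) ?_
      rw [update_of_ne hxl]; omega
    · rw [update_of_ne hxz.symm, h1]
    · rw [update_of_ne hxl.symm, h2]
    · intro i h3 h4
      by_cases hix : i = x
      · subst hix; rw [update_self]; omega
      · rw [update_of_ne hix, hm i h3 h4, cnt_succ, if_neg, add_zero]
        intro h
        exact hix (Fin.ext (by simp only [hxdef]; omega))

lemma Tf_top (hq : 0 < q) (hn : 2 ≤ n) 
  (hstep : ∀ d : Fin n → ℕ, (∀ i, d i ≤ q) → ∀ N, Tf d (N + 1) =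
    ∑ i, if d i = 0 then 0 else chi n q N i * Tf (update d i (d i - 1)) N)
    (h0 : Tf (fun _ => 0) 0 = 1) : Tf (fun _ => q) (n * q) = ((2 * q - 1).choose q : ZMod 2) := by
  have h2q : 2 * q ≤ n * q := Nat.mul_le_mul_right _ hn
  obtain ⟨k, hk⟩ : ∃ k, n * q = 2 * q - 1 + k + 1 := ⟨n * q - 2 * q, by omega⟩
  have hd : ∀ i : Fin n, (fun _ => q) i ≤ q := fun _ => le_rfl
  set l : Fin n := ⟨n - 1, by omega⟩ with hldef
  have hl : l.val + 1 = n := by simp only [hldef]; omega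
  set z : Fin n := ⟨0, by omega⟩ with hzdef
  have hzl : z ≠ l := by intro h; have := congrArg Fin.val h; simp only [hldef, hzdef] at this; omega
  rw [hk, hstep _ hd, ← add_sum_erase univ _ (mem_univ l), sum_eq_zero, add_zero, if_neg (by omega)]
  · have e : chi n q (2 * q - 1 + k) l = 1 := by
      unfold chi; rw [if_pos (by omega), if_pos hl]
    rw [e, one_mul]
    refine Tf_mid Tf hq hn hstep h0 z l rfl hl k _ (upd_le hd l) (by omega) ?_ ?_ ?_ ?_
    · exact sum_update (fun _ => q) l (by omega) _ (by simp; omega)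
    · rw [update_of_ne hzl]
    · simp
    · intro i h1 h2
      rw [update_of_ne h2]
      have hik : 2 * q - 1 + k = n * q - 1 := by omega
      rw [hik]
      symm
      have hi0 : i.val ≠ 0 := fun h => h1 (Fin.ext (by simp only [hzdef]; omega))
      have hil : i.val ≠ n - 1 := fun h => h2 (Fin.ext (by simp only [hldef]; omega))
      have := i.isLt
      exact (cnt_top q n i hq (by omega)).2 (by omega)
  · intro x hx
    have e : chi n q (2 * q - 1 + k) x = 0 := by
      unfold chi; rw [if_pos (by omega), if_neg]
      intro h
      exact ne_of_mem_erase hx (Fin.ext (by omega))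
    rw [e, zero_mul, ite_self]

end

lemma choose_odd (t : ℕ) : ((2 * 2 ^ t - 1).choose (2 ^ t) : ZMod 2) = 1 := by
  have h := @Choose.choose_modEq_choose_mod_mul_choose_div_nat
  induction t with
  | zero => simp
  | succ t ih =>
    have h2 := h (n := 2 * 2 ^ (t + 1) - 1) (k := 2 ^ (t + 1)) (p := 2)
    have hp : 0 < 2 ^ t := by positivity
    have e1 : (2 * 2 ^ (t + 1) - 1) % 2 = 1 := by rw [pow_succ]; omega
    have e2 : (2 * 2 ^ (t + 1) - 1) / 2 = 2 * 2 ^ t - 1 := by rw [pow_succ]; omega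
    have e3 : 2 ^ (t + 1) % 2 = 0 := by rw [pow_succ]; omega
    have e4 : 2 ^ (t + 1) / 2 = 2 ^ t := by rw [pow_succ]; omega
    rw [e1, e2, e3, e4] at h2
    have h3 := (ZMod.natCast_eq_natCast_iff _ _ 2).2 h2
    rw [h3]; push_cast; rw [ih]; simp

/-- Combinatorial Borsuk--Ulam/Tucker type statement. -/
lemma combinatorial (m M t n : ℕ) (hm : 2 ^ t ≤ m) (hn : 2 ≤ n)
    (eps : ℕ → Cell n → ZMod 2)
    (heq : ∀ j i v, Valid M v → eps j (negc i v) = eps j v + chi n (2 ^ t) j i) :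
    ∃ v : Cell n, (∀ i, PB M (m + 1) (v i)) ∧
      ∀ j < n * 2 ^ t, ∃ u, Fc v u ∧ eps j u ≠ eps j v := by
  have hq : 0 < 2 ^ t := by positivity
  obtain ⟨H, h1, h2, h3, h4⟩ := exists_half M m
  have hT := Tf_top (T m H eps) hq hn
    (fun d hd N => T_step m M H eps (chi n (2 ^ t)) h1 h2 h3 heq d (fun i => (hd i).trans hm) N)
    (T_zero m H eps h4)
  rw [choose_odd] at hT
  obtain ⟨v, hv, hW⟩ := exists_ne_zero_of_sum_ne_zero (by rw [← T, hT]; exact one_ne_zero)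
  rw [Fintype.mem_piFinset] at hv
  refine ⟨v, fun i => ?_, fun j hj => ?_⟩
  · obtain ⟨⟨ha, hb⟩, c, hc, hd⟩ := h1 _ _ (hv i)
    exact ⟨⟨fun a h => ha a (by omega), hb⟩, c, by omega, hd⟩
  · by_contra hcon
    push Not at hcon
    obtain ⟨k, hk⟩ := Nat.exists_eq_add_of_le hj
    apply hW
    have := W_vanish m eps j v _ hcon k v (Fc.refl v)
    rw [hk]; exact this

end HTC
namespace HTC

open Set in
lemma bridge (m t n : ℕ) (hm : 2 ^ t ≤ m) (hn : 2 ≤ n)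
    (f : ℕ → (Fin n → Fin (m + 1) → ℝ) → ℝ) (O : ℕ → Set (Fin n → Fin (m + 1) → ℝ))
    (hO : ∀ j, IsOpen (O j)) (hf : ∀ j, ContinuousOn (f j) (O j)) (hne : ∀ j, ∀ x ∈ O j, f j x ≠ 0)
    (heq : ∀ j < n * 2 ^ t - 1, ∀ i x, f j (update x i (-(x i))) =
      if i.val = idx (2 ^ t) j ∨ i.val + 1 = n then - f j x else f j x)
    (hcov : ∀ x : Fin n → Fin (m + 1) → ℝ, (∀ i, ‖x i‖ = 1) → ∃ j < n * 2 ^ t - 1, x ∈ O j) : False := by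
  classical
  let Z : Set (Fin n → Fin (m + 1) → ℝ) := Set.univ.pi fun _ => Metric.sphere 0 1
  have hZ : IsCompact Z := isCompact_univ_pi fun _ => isCompact_sphere 0 1
  have hcovZ : Z ⊆ ⋃ j : {j // j < n * 2 ^ t - 1}, O j := by
    intro x hx
    obtain ⟨j, hj, h⟩ := hcov x (fun i => by simpa using hx i (Set.mem_univ i))
    exact Set.mem_iUnion.2 ⟨⟨j, hj⟩, h⟩
  obtain ⟨δ, hδ, hleb⟩ := lebesgue_number_lemma_of_metric hZ (fun j : {j // j < n * 2 ^ t - 1} => hO j) hcovZ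
  obtain ⟨M', hM'⟩ := exists_nat_one_div_lt hδ
  set M : ℕ := M' + 1 with hM
  have hMpos : (0 : ℝ) < 2 * M := by rw [hM]; positivity
  have hMδ : 1 / (2 * M : ℝ) < δ := by
    refine lt_of_le_of_lt ?_ hM'
    rw [hM]; push_cast
    apply one_div_le_one_div_of_le <;> linarith [(Nat.cast_nonneg M' : (0:ℝ) ≤ M')]
  let pos : Cell n → (Fin n → Fin (m + 1) → ℝ) := fun v i a => (v i a : ℝ) / (2 * M)
  have hposneg : ∀ i v, pos (negc i v) = update (pos v) i (-(pos v i)) := by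
    intro i v
    funext i' a
    by_cases h : i' = i
    · subst h; simp [pos, negc, neg_div]
    · simp [pos, negc, update_of_ne h]
  let sg : (ℕ → ℤ) → ZMod 2 := fun w => if 0 < toLex w then 0 else 1
  have hsg : ∀ w : ℕ → ℤ, w ≠ 0 → sg (-w) = sg w + 1 := by
    intro w hw
    have h1 : toLex w ≠ 0 := fun h => hw (by simpa using congrArg ofLex h)
    have h2 : toLex (-w) = - toLex w := rfl
    simp only [sg, h2]
    rcases lt_or_gt_of_ne h1 with h | h
    · have hp : 0 < - toLex w := neg_pos.2 h
      have hn' : ¬ 0 < toLex w := not_lt.2 h.le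
      simp only [hp, hn', if_true, if_false]; decide
    · have hp : ¬ 0 < - toLex w := not_lt.2 (neg_nonpos.2 (le_of_lt h))
      have hn' : 0 < toLex w := h
      simp only [hp, hn', if_true, if_false]; decide
  let df : ℕ → Cell n → ZMod 2 := fun j v => ∑ i, chi n (2 ^ t) j i * sg (v i)
  have hval : ∀ v : Cell n, Valid M v → ∀ i, v i ≠ 0 := by
    intro v hv i h
    obtain ⟨a, ha⟩ := hv i
    rw [h] at ha
    simp only [Pi.zero_apply, abs_zero] at ha
    omega
  have hdf : ∀ j i v, Valid M v → df j (negc i v) = df j v + chi n (2 ^ t) j i := by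
    intro j i v hv
    simp only [df]
    rw [← add_sum_erase univ _ (mem_univ i), ← add_sum_erase univ (fun i => chi n (2 ^ t) j i * sg (v i)) (mem_univ i)]
    have e : negc i v i = - v i := by simp [negc]
    rw [e, hsg _ (hval v hv i)]
    rw [Finset.sum_congr rfl (g := fun i => chi n (2 ^ t) j i * sg (v i))]
    · ring
    · intro x hx
      simp [negc, update_of_ne (ne_of_mem_erase hx)]
  let eps : ℕ → Cell n → ZMod 2 := fun j v => if j < n * 2 ^ t - 1 then
      (if 0 < f j (pos v) then 0 else if f j (pos v) < 0 then 1 else df j v) else df j v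
  have heps : ∀ j i v, Valid M v → eps j (negc i v) = eps j v + chi n (2 ^ t) j i := by
    intro j i v hv
    simp only [eps]
    by_cases hj : j < n * 2 ^ t - 1
    · rw [if_pos hj, if_pos hj]
      rw [hposneg, heq j hj i (pos v), hdf j i v hv]
      have hchi : chi n (2 ^ t) j i = if i.val = idx (2 ^ t) j ∨ i.val + 1 = n then 1 else 0 := by
        unfold chi
        rw [if_neg (by omega)]
      rw [hchi]
      have h11 : (1 : ZMod 2) + 1 = 0 := by decide
      by_cases hc : i.val = idx (2 ^ t) j ∨ i.val + 1 = n
      · simp only [if_pos hc]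
        rcases lt_trichotomy (f j (pos v)) 0 with h | h | h
        · have a1 : 0 < - f j (pos v) := neg_pos.2 h
          have a2 : ¬ 0 < f j (pos v) := not_lt.2 h.le
          rw [if_pos a1, if_neg a2, if_pos h, h11]
        · simp [h]
        · have a1 : ¬ 0 < - f j (pos v) := not_lt.2 (neg_nonpos.2 h.le)
          have a2 : - f j (pos v) < 0 := neg_neg_of_pos h
          rw [if_neg a1, if_pos a2, if_pos h, zero_add]
      · simp only [if_neg hc, add_zero]
    · rw [if_neg hj, if_neg hj]
      exact hdf j i v hv
  obtain ⟨v, hv, hjv⟩ := combinatorial m M t n hm hn eps heps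
  have hvZ : pos v ∈ Z := by
    intro i _
    rw [mem_sphere_zero_iff_norm]
    obtain ⟨⟨h1, h2⟩, a, ha, h3⟩ := hv i
    have hn : ∀ b, ‖pos v i b‖ = (|v i b| : ℤ) / (2 * M) := by
      intro b
      simp only [pos, Real.norm_eq_abs, abs_div, abs_of_pos hMpos, Int.cast_abs]
    apply le_antisymm
    · rw [pi_norm_le_iff_of_nonneg zero_le_one]
      intro b
      rw [hn, div_le_one hMpos]
      exact_mod_cast h2 b
    · have := norm_le_pi_norm (pos v i) ⟨a, ha⟩
      rw [hn] at this
      simp only [h3] at this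
      push_cast at this
      rwa [div_self hMpos.ne'] at this
  obtain ⟨⟨j, hj⟩, hball⟩ := hleb _ hvZ
  obtain ⟨u, hu, hne'⟩ := hjv j (by omega)
  apply hne'
  have hub : pos u ∈ Metric.ball (pos v) δ := by
    rw [Metric.mem_ball]
    refine lt_of_le_of_lt ?_ hMδ
    rw [dist_pi_le_iff (by positivity)]
    intro i
    rw [dist_pi_le_iff (by positivity)]
    intro a
    have h1 : |u i a - v i a| ≤ 1 := by
      rcases hu i a with h | h
      · rw [h]; simp
      · exact h.2
    rw [Real.dist_eq]
    simp only [pos]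
    rw [← sub_div, abs_div, abs_of_pos hMpos]
    apply div_le_div_of_nonneg_right _ hMpos.le
    exact_mod_cast h1
  have hvb : pos v ∈ Metric.ball (pos v) δ := Metric.mem_ball_self hδ
  have hcon : IsPreconnected (Metric.ball (pos v) δ) := (convex_ball _ _).isPreconnected
  have hcf : ContinuousOn (f j) (Metric.ball (pos v) δ) := (hf j).mono hball
  have key : ∀ x ∈ Metric.ball (pos v) δ, ∀ y ∈ Metric.ball (pos v) δ, f j x < 0 → 0 < f j y → False := by
    intro x hx y hy h1 h2
    obtain ⟨w, hw, hw0⟩ := hcon.intermediate_value hx hy hcf ⟨h1.le, h2.le⟩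
    exact hne j w (hball hw) hw0
  simp only [eps, if_pos hj]
  rcases lt_or_gt_of_ne (hne j _ (hball hub)) with h1 | h1 <;>
  rcases lt_or_gt_of_ne (hne j _ (hball hvb)) with h2 | h2
  · rw [if_neg (not_lt.2 h1.le), if_neg (not_lt.2 h2.le), if_pos h1, if_pos h2]
  · exact (key _ hub _ hvb h1 h2).elim
  · exact (key _ hvb _ hub h2 h1).elim
  · simp [h1, h2]

end HTC
namespace HTC

open Matrix

abbrev RP (m : ℕ) := Projectivization ℝ (Fin (m + 1) → ℝ)

lemma dot_pos {m : ℕ} {x : Fin (m + 1) → ℝ} (hx : x ≠ 0) : 0 < x ⬝ᵥ x := by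
  have := dotProduct_star_self_pos_iff.2 hx
  simpa using this

/-- the matrix of the orthogonal projection on the line spanned by `x` -/
def PMv {m : ℕ} (x : Fin (m + 1) → ℝ) : Matrix (Fin (m + 1)) (Fin (m + 1)) ℝ :=
  fun a b => x a * x b / (x ⬝ᵥ x)

def PM {m : ℕ} (p : RP m) : Matrix (Fin (m + 1)) (Fin (m + 1)) ℝ := PMv p.rep

lemma PMv_smul {m : ℕ} (x : Fin (m + 1) → ℝ) (c : ℝ) (hc : c ≠ 0) : PMv (c • x) = PMv x := by
  funext a b
  simp only [PMv, Pi.smul_apply, smul_eq_mul, smul_dotProduct, dotProduct_smul]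
  rw [show c * x a * (c * x b) = (c * c) * (x a * x b) by ring, ← mul_assoc c c,
    mul_div_mul_left _ _ (mul_ne_zero hc hc)]

lemma PM_mk {m : ℕ} (x : Fin (m + 1) → ℝ) (hx : x ≠ 0) : PM (Projectivization.mk ℝ x hx) = PMv x := by
  obtain ⟨c, hc⟩ := Projectivization.exists_smul_eq_mk_rep ℝ x hx
  rw [PM, ← hc]
  exact PMv_smul x c c.ne_zero

lemma PMv_mulVec {m : ℕ} (x y : Fin (m + 1) → ℝ) : PMv x *ᵥ y = ((x ⬝ᵥ y) / (x ⬝ᵥ x)) • x := by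
  funext a
  simp only [mulVec, dotProduct, PMv, Pi.smul_apply, smul_eq_mul]
  rw [Finset.sum_div, Finset.sum_mul]
  apply Finset.sum_congr rfl
  intro b _
  ring

lemma continuous_mk' {m : ℕ} : Continuous (fun v : {v : Fin (m + 1) → ℝ // v ≠ 0} => (Projectivization.mk' ℝ v : RP m)) :=
  continuous_quotient_mk'

lemma continuous_PM {m : ℕ} : Continuous (PM : RP m → _) := by
  have hq : Topology.IsQuotientMap (fun v : {v : Fin (m + 1) → ℝ // v ≠ 0} => (Projectivization.mk' ℝ v : RP m)) :=
    isQuotientMap_quotient_mk'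
  rw [hq.continuous_iff]
  have : (PM ∘ fun v : {v : Fin (m + 1) → ℝ // v ≠ 0} => (Projectivization.mk' ℝ v : RP m)) = fun v => PMv v.1 := by
    funext v
    exact PM_mk v.1 v.2
  rw [this]
  refine continuous_pi fun a => continuous_pi fun b => ?_
  simp only [PMv, dotProduct]
  have hc : ∀ a, Continuous fun v : {v : Fin (m + 1) → ℝ // v ≠ 0} => v.1 a :=
    fun a => (continuous_apply a).comp continuous_subtype_val
  exact Continuous.div ((hc a).mul (hc b)) (continuous_finsetSum _ fun i _ => (hc i).mul (hc i))
    fun v => (dot_pos v.2).ne'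

def TT {m : ℕ} (p q : RP m) : ℝ := ∑ a, ∑ b, PM p a b * PM q a b

lemma TT_eq {m : ℕ} (p q : RP m) : TT p q = (p.rep ⬝ᵥ q.rep) ^ 2 / ((p.rep ⬝ᵥ p.rep) * (q.rep ⬝ᵥ q.rep)) := by
  simp only [TT, PM, PMv]
  have e : (p.rep ⬝ᵥ q.rep) ^ 2 = ∑ a, ∑ b, (p.rep a * q.rep a) * (p.rep b * q.rep b) := by
    rw [sq, ← Finset.sum_mul_sum]
    rfl
  rw [e, Finset.sum_div]
  · refine Finset.sum_congr rfl fun a _ => ?_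
    rw [Finset.sum_div]
    refine Finset.sum_congr rfl fun b _ => ?_
    rw [div_mul_div_comm]
    congr 1; ring

lemma TT_self {m : ℕ} (p : RP m) : TT p p = 1 := by
  have := (dot_pos p.rep_nonzero).ne'
  rw [TT_eq, sq, div_self (mul_ne_zero this this)]

lemma TT_ne {m : ℕ} {p q : RP m} (h : TT p q ≠ 0) : p.rep ⬝ᵥ q.rep ≠ 0 := by
  intro h0
  rw [TT_eq, h0] at h
  simp at h

lemma continuous_T {m : ℕ} : Continuous (fun p : RP m × RP m => TT p.1 p.2) := by
  unfold TT
  have h := continuous_PM (m := m)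
  refine continuous_finsetSum _ fun a _ => continuous_finsetSum _ fun b _ => ?_
  have h2 : Continuous fun p : RP m => PM p a b := (continuous_apply b).comp ((continuous_apply a).comp h)
  exact (h2.comp continuous_fst).mul (h2.comp continuous_snd)

attribute [irreducible] TT

lemma continuousOn_T {m : ℕ} {X : Type*} [TopologicalSpace X] {f g : X → RP m} {S : Set X}
    (hf : ContinuousOn f S) (hg : ContinuousOn g S) : ContinuousOn (fun x => TT (f x) (g x)) S := by
  have h := (hf.prodMk hg)
  exact Continuous.comp_continuousOn (g := fun p : RP m × RP m => TT p.1 p.2) continuous_T h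

/-- the class of a vector -/
def pt {m : ℕ} (v : Fin (m + 1) → ℝ) : RP m :=
  open Classical in
  if h : v ≠ 0 then Projectivization.mk ℝ v h
  else Projectivization.mk ℝ (fun _ => 1) (fun h => one_ne_zero (congrFun h 0))

lemma pt_of_ne {m : ℕ} {v : Fin (m + 1) → ℝ} (h : v ≠ 0) : pt v = Projectivization.mk ℝ v h := dif_pos h

lemma pt_neg {m : ℕ} (v : Fin (m + 1) → ℝ) : pt (-v) = pt v := by
  by_cases h : v = 0
  · rw [h, neg_zero]
  · rw [pt_of_ne h, pt_of_ne (neg_ne_zero.2 h), Projectivization.mk_eq_mk_iff']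
    exact ⟨-1, by simp⟩

lemma pt_rep {m : ℕ} {v : Fin (m + 1) → ℝ} (h : v ≠ 0) : ∃ c : ℝ, c ≠ 0 ∧ v = c • (pt v).rep := by
  rw [pt_of_ne h]
  obtain ⟨c, hc⟩ := Projectivization.exists_smul_eq_mk_rep ℝ v h
  refine ⟨(c⁻¹ : ℝˣ), Units.ne_zero _, ?_⟩
  rw [← hc]
  change v = c⁻¹ • (c • v)
  rw [inv_smul_smul]

lemma continuousOn_pt {m : ℕ} : ContinuousOn (pt : (Fin (m + 1) → ℝ) → RP m) {v | v ≠ 0} := by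
  rw [continuousOn_iff_continuous_domRestrict]
  have e : Set.domRestrict {v | v ≠ 0} (pt : (Fin (m + 1) → ℝ) → RP m) =
      fun v : {v : Fin (m + 1) → ℝ // v ≠ 0} => (Projectivization.mk' ℝ v : RP m) := by
    funext v
    exact pt_of_ne v.2
  rw [e]
  exact continuous_mk' (m := m)

def pr {m n : ℕ} (x : Fin n → Fin (m + 1) → ℝ) : Fin n → RP m := fun i => pt (x i)

lemma pr_neg {m n : ℕ} (x : Fin n → Fin (m + 1) → ℝ) (i : Fin n) : pr (update x i (-(x i))) = pr x := by
  funext j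
  by_cases h : j = i
  · subst h; simp [pr, pt_neg]
  · simp [pr, update_of_ne h]

def Ut {m n : ℕ} (U : Set (Fin n → RP m)) : Set (Fin n → Fin (m + 1) → ℝ) :=
  {x | ∀ i, x i ≠ 0} ∩ pr ⁻¹' U

lemma continuousOn_pr {m n : ℕ} : ContinuousOn (pr : (Fin n → Fin (m + 1) → ℝ) → Fin n → RP m) {x | ∀ i, x i ≠ 0} := by
  rw [continuousOn_pi]
  intro i
  exact continuousOn_pt.comp (continuous_apply i).continuousOn fun x hx => hx i

lemma isOpen_Y {m n : ℕ} : IsOpen {x : Fin n → Fin (m + 1) → ℝ | ∀ i, x i ≠ 0} := by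
  simp only [Set.ofPred_forall]
  exact isOpen_iInter_of_finite fun i => isOpen_ne.preimage (continuous_apply i)

lemma isOpen_Ut {m n : ℕ} {U : Set (Fin n → RP m)} (hU : IsOpen U) : IsOpen (Ut U) :=
  continuousOn_pr.isOpen_inter_preimage isOpen_Y hU

lemma Ut_neg {m n : ℕ} {U : Set (Fin n → RP m)} (x : Fin n → Fin (m + 1) → ℝ) (i : Fin n) :
    update x i (-(x i)) ∈ Ut U ↔ x ∈ Ut U := by
  simp only [Ut, Set.mem_inter_iff, Set.mem_preimage, pr_neg, Set.mem_ofPred_eq]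
  refine and_congr_left fun _ => forall_congr' fun j => ?_
  by_cases h : j = i
  · subst h; simp
  · simp [update_of_ne h]

def pth {m n : ℕ} {U : Set (Fin n → RP m)} (sec : C(U, C(I, RP m))) (x : Fin n → Fin (m + 1) → ℝ) (s : I) : RP m :=
  open Classical in
  if h : pr x ∈ U then sec ⟨pr x, h⟩ s else pt 0

lemma continuousOn_pth {m n : ℕ} {U : Set (Fin n → RP m)} (sec : C(U, C(I, RP m))) :
    ContinuousOn (fun p : (Fin n → Fin (m + 1) → ℝ) × I => pth sec p.1 p.2) (Ut U ×ˢ Set.univ) := by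
  rw [continuousOn_iff_continuous_domRestrict]
  have h1 : Continuous fun p : (Ut U ×ˢ (Set.univ : Set I) : Set _) => pr p.1.1 := by
    have : ContinuousOn (fun p : (Fin n → Fin (m + 1) → ℝ) × I => pr p.1) (Ut U ×ˢ (Set.univ : Set I)) :=
      continuousOn_pr.comp continuous_fst.continuousOn fun p hp => hp.1.1
    exact continuousOn_iff_continuous_domRestrict.1 this
  have h2 : Continuous fun p : (Ut U ×ˢ (Set.univ : Set I) : Set _) =>
      sec ⟨pr p.1.1, p.2.1.2⟩ p.1.2 :=
    (sec.continuous.comp (h1.subtype_mk _)).eval (continuous_snd.comp continuous_subtype_val)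
  convert h2 using 1
  funext p
  exact dif_pos p.2.1.2

lemma pth_neg {m n : ℕ} {U : Set (Fin n → RP m)} (sec : C(U, C(I, RP m))) (x : Fin n → Fin (m + 1) → ℝ) (i : Fin n) :
    pth sec (update x i (-(x i))) = pth sec x := by
  funext s
  unfold pth
  rw [pr_neg]

def tr {m : ℕ} (γ : I → RP m) (τ : ℕ → I) (y : Fin (m + 1) → ℝ) : ℕ → Fin (m + 1) → ℝ
  | 0 => y
  | s + 1 => PM (γ (τ (s + 1))) *ᵥ tr γ τ y s

lemma tr_neg {m : ℕ} (γ : I → RP m) (τ : ℕ → I) (y : Fin (m + 1) → ℝ) (s : ℕ) :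
    tr γ τ (-y) s = - tr γ τ y s := by
  induction s with
  | zero => rfl
  | succ s ih => rw [tr, ih, mulVec_neg, tr]

lemma tr_ne {m : ℕ} (γ : I → RP m) (τ : ℕ → I) (y : Fin (m + 1) → ℝ) (r : ℕ)
    (hy : ∃ c : ℝ, c ≠ 0 ∧ y = c • (γ (τ 0)).rep) (hT : ∀ s < r, TT (γ (τ s)) (γ (τ (s + 1))) ≠ 0) :
    ∀ s ≤ r, ∃ c : ℝ, c ≠ 0 ∧ tr γ τ y s = c • (γ (τ s)).rep := by
  intro s
  induction s with
  | zero => intro _; exact hy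
  | succ s ih =>
    intro hs
    obtain ⟨c, hc, h⟩ := ih (by omega)
    rw [tr, h, PM, PMv_mulVec]
    refine ⟨_, ?_, rfl⟩
    rw [dotProduct_smul, smul_eq_mul, dotProduct_comm]
    exact div_ne_zero (mul_ne_zero hc (TT_ne (hT s (by omega)))) (dot_pos (Projectivization.rep_nonzero _)).ne'

lemma continuousOn_tr {m n : ℕ} {U : Set (Fin n → RP m)} (sec : C(U, C(I, RP m))) (τ : ℕ → I) (i : Fin n) (s : ℕ) :
    ContinuousOn (fun x => tr (pth sec x) τ (x i) s) (Ut U) := by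
  induction s with
  | zero => exact (continuous_apply i).continuousOn
  | succ s ih =>
    have h1 : ContinuousOn (fun x => PM (pth sec x (τ (s + 1)))) (Ut U) := by
      refine continuous_PM.comp_continuousOn ?_
      exact (continuousOn_pth sec).comp (f := fun x => (x, τ (s + 1))) (by fun_prop) fun x hx => ⟨hx, trivial⟩
    rw [continuousOn_iff_continuous_domRestrict] at h1 ih ⊢
    exact Continuous.matrix_mulVec h1 ih

lemma local_f {m n : ℕ} (U : Set (Fin n → RP m)) (sec : C(U, C(I, RP m)))
    (hsec : ∀ u : U, tcPi (RP m) n (sec u) = (u : Fin n → RP m))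
    (i0 l : Fin n) (hil : i0 ≠ l) (K : Set (Fin n → Fin (m + 1) → ℝ)) (hK : IsCompact K) (hKU : K ⊆ Ut U) :
    ∃ f : (Fin n → Fin (m + 1) → ℝ) → ℝ, ContinuousOn f (Ut U) ∧
      (∀ i x, f (update x i (-(x i))) = if i = i0 ∨ i = l then - f x else f x) ∧
      ∀ x ∈ K, f x ≠ 0 := by
  classical
  have hg : UniformContinuousOn (fun p : (Fin n → Fin (m + 1) → ℝ) × I × I =>
      TT (pth sec p.1 p.2.1) (pth sec p.1 p.2.2)) (K ×ˢ Set.univ) := by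
    apply (hK.prod isCompact_univ).uniformContinuousOn_of_continuous
    have h1 : ContinuousOn (fun p : (Fin n → Fin (m + 1) → ℝ) × I × I => pth sec p.1 p.2.1) (K ×ˢ Set.univ) :=
      (continuousOn_pth sec).comp (f := fun p : (Fin n → Fin (m + 1) → ℝ) × I × I => (p.1, p.2.1))
        (Continuous.continuousOn (by fun_prop)) fun p hp => ⟨hKU hp.1, trivial⟩
    have h2 : ContinuousOn (fun p : (Fin n → Fin (m + 1) → ℝ) × I × I => pth sec p.1 p.2.2) (K ×ˢ Set.univ) :=
      (continuousOn_pth sec).comp (f := fun p : (Fin n → Fin (m + 1) → ℝ) × I × I => (p.1, p.2.2))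
        (Continuous.continuousOn (by fun_prop)) fun p hp => ⟨hKU hp.1, trivial⟩
    exact continuousOn_T h1 h2
  rw [Metric.uniformContinuousOn_iff] at hg
  obtain ⟨δ, hδ, hg⟩ := hg 1 one_pos
  have hclose : ∀ x ∈ K, ∀ s s' : I, dist s s' < δ → TT (pth sec x s) (pth sec x s') ≠ 0 := by
    intro x hx s s' hd h0
    have := hg (x, s, s') ⟨hx, trivial⟩ (x, s, s) ⟨hx, trivial⟩ (by
      simp only [Prod.dist_eq, dist_self]
      simp [dist_comm s' s, hd, hδ])
    simp only [h0, TT_self] at this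
    simp at this
  let a : ℝ := (i0 : ℝ) / ((n : ℝ) - 1)
  let b : ℝ := (l : ℝ) / ((n : ℝ) - 1)
  obtain ⟨r', hr'⟩ := exists_nat_gt (|b - a| / δ)
  let r : ℕ := r' + 1
  have hr0 : (0 : ℝ) < r := by simp only [r]; positivity
  have hr : |b - a| / r < δ := by
    rw [div_lt_iff₀ hr0]
    rw [div_lt_iff₀ hδ] at hr'
    have : (r : ℝ) = r' + 1 := by simp [r]
    rw [this]
    nlinarith
  let τ : ℕ → I := fun s => Set.projIcc 0 1 zero_le_one (a + (b - a) * (s / r))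
  have hτ : ∀ s, dist (τ s) (τ (s + 1)) < δ := by
    intro s
    refine lt_of_le_of_lt ?_ hr
    refine ((LipschitzWith.projIcc (zero_le_one (α := ℝ))).dist_le_mul _ _).trans ?_
    rw [NNReal.coe_one, one_mul, Real.dist_eq]
    rw [show a + (b - a) * ((s : ℝ) / r) - (a + (b - a) * (((s + 1 : ℕ) : ℝ) / r)) = - ((b - a) / r) by
      push_cast; field_simp; ring, abs_neg, abs_div, abs_of_pos hr0]
  have hτ0 : τ 0 = Set.projIcc 0 1 zero_le_one a := by simp [τ]
  have hτr : τ r = Set.projIcc 0 1 zero_le_one b := by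
    simp only [τ]; rw [div_self hr0.ne']; congr 1; ring
  have hp : ∀ x ∈ Ut U, ∀ i : Fin n, pth sec x (Set.projIcc 0 1 zero_le_one ((i : ℝ) / ((n : ℝ) - 1))) = pt (x i) := by
    intro x hx i
    unfold pth
    have h2 : pr x ∈ U := hx.2
    rw [dif_pos h2]
    exact congrFun (hsec ⟨pr x, h2⟩) i
  refine ⟨fun x => if x ∈ Ut U then tr (pth sec x) τ (x i0) r ⬝ᵥ x l else 0, ?_, ?_, ?_⟩
  · have : ContinuousOn (fun x => tr (pth sec x) τ (x i0) r ⬝ᵥ x l) (Ut U) := by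
      have h1 := continuousOn_tr sec τ i0 r
      rw [continuousOn_iff_continuous_domRestrict] at h1 ⊢
      exact Continuous.dotProduct h1 ((continuous_apply l).comp continuous_subtype_val)
    refine this.congr fun x hx => ?_
    simp only [if_pos hx]
  · intro i x
    simp only [Ut_neg, pth_neg]
    by_cases hx : x ∈ Ut U
    · simp only [if_pos hx]
      by_cases h1 : i = i0
      · subst h1
        rw [update_self, update_of_ne hil.symm, tr_neg, neg_dotProduct, if_pos (Or.inl rfl)]
      · by_cases h2 : i = l
        · subst h2
          rw [update_self, update_of_ne hil, dotProduct_neg, if_pos (Or.inr rfl)]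
        · rw [update_of_ne (Ne.symm h1), update_of_ne (Ne.symm h2), if_neg (by tauto)]
    · simp only [if_neg hx]
      simp
  · intro x hx
    have hxU := hKU hx
    simp only [if_pos hxU]
    obtain ⟨c, hc, h⟩ := tr_ne (pth sec x) τ (x i0) r (by
      rw [hτ0, hp x hxU i0]
      exact pt_rep (hxU.1 i0)) (fun s _ => hclose x hx _ _ (hτ s)) r le_rfl
    rw [hτr, hp x hxU l] at h
    obtain ⟨c', hc', h'⟩ := pt_rep (hxU.1 l)
    rw [h]
    nth_rewrite 2 [h']
    rw [smul_dotProduct, dotProduct_smul, smul_eq_mul, smul_eq_mul]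
    exact mul_ne_zero hc (mul_ne_zero hc' (dot_pos (Projectivization.rep_nonzero _)).ne')

end HTC
namespace HTC

lemma lower (m t n : ℕ) (hm : 2 ^ t ≤ m) (hn : 2 ≤ n) (k : ℕ) (U : Fin k → Set (Fin n → RP m))
    (hU : ∀ i, IsOpen (U i)) (hcov : (⋃ i, U i) = Set.univ)
    (hsec : ∀ i, ∃ sec : C(U i, C(I, RP m)), ∀ u : U i, tcPi (RP m) n (sec u) = (u : Fin n → RP m)) :
    n * 2 ^ t ≤ k := by
  classical
  by_contra hk
  have hq : 0 < 2 ^ t := by positivity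
  let Z : Set (Fin n → Fin (m + 1) → ℝ) := Set.univ.pi fun _ => Metric.sphere 0 1
  have hZ : IsCompact Z := isCompact_univ_pi fun _ => isCompact_sphere 0 1
  have hZmem : ∀ x : Fin n → Fin (m + 1) → ℝ, x ∈ Z ↔ ∀ i, ‖x i‖ = 1 := by
    intro x; simp [Z, Set.mem_pi]
  have hZc : Z ⊆ ⋃ i ∈ (Finset.univ : Finset (Fin k)), Ut (U i) := by
    intro x hx
    rw [hZmem] at hx
    have : pr x ∈ ⋃ i, U i := by rw [hcov]; trivial
    obtain ⟨i, hi⟩ := Set.mem_iUnion.1 this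
    simp only [Set.mem_iUnion]
    refine ⟨i, Finset.mem_univ i, ?_, hi⟩
    intro j h0
    have := hx j
    rw [h0] at this
    simp at this
  obtain ⟨K, hK, hKU, hZK⟩ := hZ.finite_compact_cover Finset.univ (fun i => Ut (U i)) (fun i _ => isOpen_Ut (hU i)) hZc
  have hidx : ∀ j : Fin k, idx (2 ^ t) j + 2 ≤ n := fun j => idx_lt n (2 ^ t) j hq hn (by have := j.2; omega)
  choose sec hsec using hsec
  have hloc : ∀ j : Fin k, _ := fun j => local_f (U j) (sec j) (hsec j)
    ⟨idx (2 ^ t) j, by have := hidx j; omega⟩ ⟨n - 1, by omega⟩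
    (by have := hidx j; simp only [ne_eq, Fin.mk.injEq]; omega) (K j) (hK j) (hKU j)
  choose f hf heq hne using hloc
  let F : ℕ → (Fin n → Fin (m + 1) → ℝ) → ℝ := fun j => if h : j < k then f ⟨j, h⟩ else 0
  let O : ℕ → Set (Fin n → Fin (m + 1) → ℝ) := fun j =>
    if h : j < k then Ut (U ⟨j, h⟩) ∩ f ⟨j, h⟩ ⁻¹' {0}ᶜ else ∅
  refine bridge m t n hm hn F O ?_ ?_ ?_ ?_ ?_
  · intro j
    by_cases h : j < k
    · simp only [O, dif_pos h]
      exact (hf _).isOpen_inter_preimage (isOpen_Ut (hU _)) isOpen_compl_singleton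
    · simp only [O, dif_neg h]; exact isOpen_empty
  · intro j
    by_cases h : j < k
    · simp only [O, F, dif_pos h]
      exact (hf _).mono Set.inter_subset_left
    · simp only [O, dif_neg h]; exact continuousOn_empty _
  · intro j x hx
    by_cases h : j < k
    · simp only [O, F, dif_pos h] at hx ⊢
      exact hx.2
    · simp only [O, dif_neg h] at hx; exact hx.elim
  · intro j _ i x
    by_cases h : j < k
    · simp only [F, dif_pos h]
      rw [heq]
      have : (i = (⟨idx (2 ^ t) j, by have := hidx ⟨j, h⟩; simp only at this; omega⟩ : Fin n) ∨ i = (⟨n - 1, by omega⟩ : Fin n)) ↔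
          (i.val = idx (2 ^ t) j ∨ i.val + 1 = n) := by
        rw [Fin.ext_iff, Fin.ext_iff]
        simp only
        omega
      simp only [this]
    · simp [F, dif_neg h]
  · intro x hx
    have hx' := hZK ▸ (hZmem x).2 hx
    simp only [Set.mem_iUnion] at hx'
    obtain ⟨j, _, hj⟩ := hx'
    refine ⟨j, by have := j.2; omega, ?_⟩
    simp only [O, dif_pos j.2]
    exact ⟨hKU j hj, hne j x hj⟩

end HTC
namespace HTC

open Matrix

lemma pt_smul_rep {m : ℕ} (p : RP m) (c : ℝ) (hc : c ≠ 0) : pt (c • p.rep) = p := by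
  rw [pt_of_ne (smul_ne_zero hc p.rep_nonzero)]
  conv_rhs => rw [← p.mk_rep]
  rw [Projectivization.mk_eq_mk_iff']
  exact ⟨c, rfl⟩

lemma PM_rep {m : ℕ} (p : RP m) : PM p *ᵥ p.rep = p.rep := by
  rw [PM, PMv_mulVec, div_self (dot_pos p.rep_nonzero).ne', one_smul]

lemma pt_PM {m : ℕ} (p : RP m) (y : Fin (m + 1) → ℝ) (h : PM p *ᵥ y ≠ 0) : pt (PM p *ᵥ y) = p := by
  rw [PM, PMv_mulVec] at h ⊢
  exact pt_smul_rep p _ fun h0 => h (by rw [h0, zero_smul])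

instance compactRP {m : ℕ} : CompactSpace (RP m) := by
  constructor
  have h : IsCompact (pt '' (Metric.sphere (0 : Fin (m + 1) → ℝ) 1)) := by
    refine (isCompact_sphere 0 1).image_of_continuousOn (continuousOn_pt.mono ?_)
    intro v hv h0
    rw [h0] at hv
    simp at hv
  convert h
  symm
  rw [Set.eq_univ_iff_forall]
  intro p
  have hn := norm_ne_zero_iff.2 p.rep_nonzero
  refine ⟨‖p.rep‖⁻¹ • p.rep, ?_, pt_smul_rep p _ (inv_ne_zero hn)⟩
  rw [mem_sphere_zero_iff_norm, norm_smul, norm_inv, norm_norm, inv_mul_cancel₀ hn]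

/-- hat functions -/
def hat (n : ℕ) (i : Fin n) (s : I) : ℝ := max 0 (1 - |(s : ℝ) * ((n : ℝ) - 1) - i|)

def tm (n : ℕ) (i : Fin n) : I := Set.projIcc (0 : ℝ) 1 zero_le_one ((i : ℝ) / ((n : ℝ) - 1))

lemma tm_val {n : ℕ} (hn : 2 ≤ n) (i : Fin n) : (tm n i : ℝ) * ((n : ℝ) - 1) = i := by
  have h1 : (0 : ℝ) < (n : ℝ) - 1 := by
    have : (2 : ℝ) ≤ n := by exact_mod_cast hn
    linarith
  have h2 : (i : ℝ) ≤ (n : ℝ) - 1 := by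
    have : ((i.val + 1 : ℕ) : ℝ) ≤ n := by exact_mod_cast i.2
    push_cast at this
    linarith
  have h3 : (i : ℝ) / ((n : ℝ) - 1) ∈ Set.Icc (0 : ℝ) 1 := ⟨by positivity, (div_le_one h1).2 h2⟩
  rw [tm, Set.projIcc_of_mem zero_le_one h3]
  exact div_mul_cancel₀ _ h1.ne'

lemma hat_tm {n : ℕ} (hn : 2 ≤ n) (i j : Fin n) : hat n i (tm n j) = if i = j then 1 else 0 := by
  rw [hat, tm_val hn]
  by_cases h : i = j
  · subst h; simp
  · rw [if_neg h, max_eq_left]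
    have h1 : (1 : ℤ) ≤ |(j : ℤ) - i| := Int.one_le_abs (by
      intro h0
      apply h
      apply Fin.ext
      omega)
    have h2 : (1 : ℝ) ≤ |(j : ℝ) - i| := by exact_mod_cast h1
    linarith

lemma continuous_hat (n : ℕ) (i : Fin n) : Continuous (hat n i) := by
  unfold hat
  fun_prop

lemma exists_path {m n : ℕ} (hm : 1 ≤ m) (hn : 2 ≤ n) (y : Fin n → Fin (m + 1) → ℝ) (hy : ∀ i, y i ≠ 0) :
    ∃ g : C(I, Fin (m + 1) → ℝ), (∀ s, g s ≠ 0) ∧ ∀ i, g (tm n i) = y i := by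
  have hpc : IsPathConnected ({0}ᶜ : Set (Fin (m + 1) → ℝ)) := by
    apply isPathConnected_compl_singleton_of_one_lt_rank
    rw [rank_fin_fun]
    exact_mod_cast (by omega : 1 < m + 1)
  obtain ⟨n', rfl⟩ : ∃ n', n = n' + 1 := ⟨n - 1, by omega⟩
  obtain ⟨p, hp, hps⟩ := hpc.exists_path_through_family (y : Fin (n' + 1) → _) hy
  choose s hs using hps
  let φ : I → I := fun r => Set.projIcc (0 : ℝ) 1 zero_le_one (∑ i, s i * hat (n' + 1) i r)
  have hφ : Continuous φ := continuous_projIcc.comp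
    (continuous_finsetSum _ fun i _ => continuous_const.mul (continuous_hat _ i))
  refine ⟨⟨fun r => p (φ r), p.continuous.comp hφ⟩, ?_, ?_⟩
  · intro r
    exact hp ⟨φ r, rfl⟩
  · intro i
    have : φ (tm (n' + 1) i) = s i := by
      simp only [φ, hat_tm hn, mul_ite, mul_one, mul_zero, Finset.sum_ite_eq', Finset.mem_univ, if_true]
      exact Set.projIcc_val _ _
    simp only [ContinuousMap.coe_mk, this]
    exact hs i

lemma local_sec {m n : ℕ} (hm : 1 ≤ m) (hn : 2 ≤ n) (p : Fin n → RP m) :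
    ∃ U : Set (Fin n → RP m), IsOpen U ∧ p ∈ U ∧
      ∃ sec : C(U, C(I, RP m)), ∀ u : U, tcPi (RP m) n (sec u) = (u : Fin n → RP m) := by
  obtain ⟨γ, hγ0, hγ⟩ := exists_path hm hn (fun i => (p i).rep) fun i => (p i).rep_nonzero
  let G : C((Fin n → RP m) × I, Fin (m + 1) → ℝ) :=
    ⟨fun q => γ q.2 + ∑ i, hat n i q.2 • (PM (q.1 i) *ᵥ (p i).rep - (p i).rep), by
      refine (γ.continuous.comp continuous_snd).add (continuous_finsetSum _ fun i _ => ?_)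
      refine ((continuous_hat n i).comp continuous_snd).smul (Continuous.sub ?_ continuous_const)
      exact Continuous.matrix_mulVec (continuous_PM.comp ((continuous_apply i).comp continuous_fst)) continuous_const⟩
  have hG : ∀ u i, G (u, tm n i) = PM (u i) *ᵥ (p i).rep := by
    intro u i
    simp only [G, ContinuousMap.coe_mk, hγ, hat_tm hn, ite_smul, one_smul, zero_smul, Finset.sum_ite_eq',
      Finset.mem_univ, if_true]
    abel
  let U : Set (Fin n → RP m) := G.curry ⁻¹' {f | Set.MapsTo f Set.univ {0}ᶜ}
  have hU : ∀ u ∈ U, ∀ s, G (u, s) ≠ 0 := fun u hu s => hu (Set.mem_univ s)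
  have hc : Continuous fun q : U × I => pt (G (q.1.1, q.2)) := by
    apply continuousOn_pt.comp_continuous
    · exact G.continuous.comp ((continuous_subtype_val.comp continuous_fst).prodMk continuous_snd)
    · intro q
      exact hU _ q.1.2 q.2
  refine ⟨U, ?_, ?_, (⟨_, hc⟩ : C(U × I, RP m)).curry, ?_⟩
  · exact (ContinuousMap.isOpen_setOfPred_mapsTo isCompact_univ isOpen_compl_singleton).preimage G.curry.continuous
  · intro s _
    change G (p, s) ≠ 0
    have : G (p, s) = γ s := by
      simp only [G, ContinuousMap.coe_mk, PM_rep, sub_self, smul_zero, Finset.sum_const_zero, add_zero]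
    rw [this]
    exact hγ0 s
  · intro u
    funext i
    change pt (G (u.1, tm n i)) = u.1 i
    have h := hU _ u.2 (tm n i)
    rw [hG] at h ⊢
    exact pt_PM _ _ h

lemma exists_cover {m n : ℕ} (hm : 1 ≤ m) (hn : 2 ≤ n) :
    ∃ k, 0 < k ∧ ∃ U : Fin k → Set (Fin n → RP m),
    (∀ i, IsOpen (U i)) ∧ (⋃ i, U i) = Set.univ ∧
    ∀ i, ∃ sec : C(U i, C(I, RP m)), ∀ u : U i, tcPi (RP m) n (sec u) = (u : Fin n → RP m) := by
  choose U hU hp hsec using fun p : Fin n → RP m => local_sec hm hn p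
  obtain ⟨s, -, hs⟩ := isCompact_univ.elim_nhds_subcover U fun p _ => (hU p).mem_nhds (hp p)
  have hcov : ∀ q, ∃ p ∈ s, q ∈ U p := by
    intro q
    simpa using hs (Set.mem_univ q)
  refine ⟨s.card, ?_, fun i => U (s.equivFin.symm i), fun i => hU _, ?_, fun i => hsec _⟩
  · obtain ⟨p, h, _⟩ := hcov (fun _ => pt 0)
    exact Finset.card_pos.2 ⟨p, h⟩
  · rw [Set.eq_univ_iff_forall]
    intro q
    obtain ⟨p, h, hq⟩ := hcov q
    refine Set.mem_iUnion.2 ⟨s.equivFin ⟨p, h⟩, ?_⟩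
    simpa using hq

end HTC

end HTCmaterial

/-- For a positive integer `t`, `m ≥ 2^t` and `n ≥ 2`:
`TC_n(ℝP^m) ≥ n·2^t`. -/
theorem higherTC_realProj_lower_bound (m t n : ℕ) (ht : 0 < t) (hm : 2 ^ t ≤ m) (hn : 2 ≤ n) :
    n * 2 ^ t ≤ higherTC (Projectivization ℝ (Fin (m + 1) → ℝ)) n := by
  have hm1 : 1 ≤ m := le_trans Nat.one_le_two_pow hm
  have hne : {k | 0 < k ∧ ∃ U : Fin k → Set (Fin n → Projectivization ℝ (Fin (m + 1) → ℝ)),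
    (∀ i, IsOpen (U i)) ∧ (⋃ i, U i) = Set.univ ∧
    ∀ i, ∃ sec : C(U i, C(I, Projectivization ℝ (Fin (m + 1) → ℝ))),
      ∀ u : U i, tcPi (Projectivization ℝ (Fin (m + 1) → ℝ)) n (sec u) = (u : Fin n → _)}.Nonempty :=
    HTC.exists_cover hm1 hn
  obtain ⟨_, U, hU, hcov, hsec⟩ := Nat.sInf_mem hne
  exact HTC.lower m t n hm hn _ U hU hcov hsec
end
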